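/- arXiv:1512.02730 — 2 statements merged into one kernel-verified Lean document; each statement's English description precedes it below -/
import Mathlib

section
/- Let R and B be two disjoint finite sets of points in the plane such that |R| = k|B| for an integer k ≥ 2, B is nonempty, and R ∪ B is in general position. Then there exists a plane bichromatic tree on R ∪ B whose maximum vertex degree is at most k + 1; moreover, such a tree exists in which every vertex of R has degree at most 3. -/
open scoped Classical

noncomputable section

/-- The plane. -/
abbrev Pt : Type := ℝ × ℝ

/-- A set of points is in general position if no three of its points are collinear. -/
def GenPos (P : Set Pt) : Prop :=
  ∀ p ∈ P, ∀ q ∈ P, ∀ r ∈ P, p ≠ q → p ≠ r → q ≠ r →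
    ¬ Collinear ℝ ({p, q, r} : Set Pt)

/-- Degree of a vertex in a simple graph. -/
def deg {V : Type*} (G : SimpleGraph V) (v : V) : ℕ := (G.neighborSet v).ncard

/-- `G` is a plane bichromatic spanning tree on `R ∪ B`: a spanning tree of the
geometric complete bipartite graph `K(R,B)` (every edge joins a point of `R` and a
point of `B`), drawn with straight-line segments, no two of which cross (any point
lying on two distinct closed edges is a common endpoint of both). -/
def PlaneBichromTree (R B : Finset Pt) (G : SimpleGraph {x : Pt // x ∈ R ∪ B}) : Prop :=
  G.IsTree ∧
  (∀ u v : {x : Pt // x ∈ R ∪ B}, G.Adj u v →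
      ((u.1 ∈ R ∧ v.1 ∈ B) ∨ (u.1 ∈ B ∧ v.1 ∈ R))) ∧
  (∀ u v x y : {x : Pt // x ∈ R ∪ B}, G.Adj u v → G.Adj x y →
      s(u, v) ≠ s(x, y) →
      ∀ p : Pt, p ∈ segment ℝ u.1 v.1 → p ∈ segment ℝ x.1 y.1 →
        (p = u.1 ∨ p = v.1) ∧ (p = x.1 ∨ p = y.1))

/-- Orientation of a triple. -/
def ori (a b c : Pt) : ℝ := (b.1 - a.1) * (c.2 - a.2) - (b.2 - a.2) * (c.1 - a.1)

/-- No three points of the finite set are collinear. -/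
def GP (S : Finset Pt) : Prop :=
  ∀ p ∈ S, ∀ q ∈ S, ∀ r ∈ S, p ≠ q → p ≠ r → q ≠ r → ori p q r ≠ 0

/-- Degree in an edge set. -/
def dg (E : Finset (Pt × Pt)) (p : Pt) : ℕ := (E.filter (fun e => e.1 = p ∨ e.2 = p)).card

/-- Adjacency in an edge set. -/
def adjE (E : Finset (Pt × Pt)) (p q : Pt) : Prop := (p, q) ∈ E ∨ (q, p) ∈ E

/-- Plane bichromatic trees, as sets of (red, blue) pairs. -/
structure PT (R S : Finset Pt) (E : Finset (Pt × Pt)) : Prop where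
  sub : ∀ e ∈ E, e.1 ∈ S ∧ e.1 ∈ R ∧ e.2 ∈ S ∧ e.2 ∉ R
  card : E.card + 1 = S.card
  conn : ∀ p ∈ S, ∀ q ∈ S, Relation.ReflTransGen (adjE E) p q
  plane : ∀ e ∈ E, ∀ f ∈ E, e ≠ f → ∀ x, x ∈ segment ℝ e.1 e.2 → x ∈ segment ℝ f.1 f.2 →
    (x = e.1 ∨ x = e.2) ∧ (x = f.1 ∨ x = f.2)

/-- Existence of a plane bichromatic tree with degree caps. -/
def Tr (R S : Finset Pt) (c : Pt → ℕ) : Prop := ∃ E, PT R S E ∧ ∀ p ∈ S, dg E p ≤ c p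

theorem GP.mono {S T : Finset Pt} (h : GP T) (hs : S ⊆ T) : GP S :=
  fun p hp q hq r hr => h p (hs hp) q (hs hq) r (hs hr)

theorem Tr.mono {R S : Finset Pt} {c c' : Pt → ℕ} (h : Tr R S c) (hc : ∀ p ∈ S, c p ≤ c' p) :
    Tr R S c' := by
  obtain ⟨E, hE, hd⟩ := h
  exact ⟨E, hE, fun p hp => (hd p hp).trans (hc p hp)⟩

theorem PT.dg_zero {R S : Finset Pt} {E : Finset (Pt × Pt)} (h : PT R S E) {p : Pt} (hp : p ∉ S) :
    dg E p = 0 := by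
  unfold dg
  rw [Finset.card_eq_zero, Finset.filter_eq_empty_iff]
  rintro e he (rfl | rfl)
  · exact hp (h.sub e he).1
  · exact hp (h.sub e he).2.2.1

theorem dg_union (E F : Finset (Pt × Pt)) (p : Pt) : dg (E ∪ F) p ≤ dg E p + dg F p := by
  unfold dg
  rw [Finset.filter_union]
  exact Finset.card_union_le _ _

theorem ori_of_mem_segment {a b x : Pt} (h : x ∈ segment ℝ a b) : ori a b x = 0 := by
  obtain ⟨s, t, hs, ht, hst, rfl⟩ := h
  have : s = 1 - t := by linarith
  subst this
  simp [ori]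
  ring

/-- Gluing two trees at a vertex, separated by a linear functional. -/
theorem glue {R S S1 S2 : Finset Pt} {c c1 c2 : Pt → ℕ} (v : Pt) (al be : ℝ)
    (h1 : Tr R S1 c1) (h2 : Tr R S2 c2) (hgp : GP S)
    (hS : ∀ p, p ∈ S ↔ p ∈ S1 ∨ p ∈ S2) (hv1 : v ∈ S1) (hv2 : v ∈ S2)
    (hs1 : ∀ p ∈ S1, al * p.1 + be * p.2 ≤ al * v.1 + be * v.2)
    (hs2 : ∀ p ∈ S2, p ≠ v → al * v.1 + be * v.2 < al * p.1 + be * p.2)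
    (hc1 : ∀ p ∈ S1, p ≠ v → c1 p ≤ c p) (hc2 : ∀ p ∈ S2, p ≠ v → c2 p ≤ c p)
    (hcv : c1 v + c2 v ≤ c v) : Tr R S c := by
  have hcommon : ∀ p, p ∈ S1 → p ∈ S2 → p = v := by
    intro p hp1 hp2
    by_contra hne
    have := hs1 p hp1
    have := hs2 p hp2 hne
    linarith
  have hS' : S = S1 ∪ S2 := by ext p; simp [hS]
  obtain ⟨E1, hE1, hd1⟩ := h1
  obtain ⟨E2, hE2, hd2⟩ := h2
  have hcross : ∀ e ∈ E1, ∀ f ∈ E2, ∀ x, x ∈ segment ℝ e.1 e.2 → x ∈ segment ℝ f.1 f.2 →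
      (x = e.1 ∨ x = e.2) ∧ (x = f.1 ∨ x = f.2) := by
    intro e he f hf x hxe hxf
    obtain ⟨he1, he1R, he2, he2R⟩ := hE1.sub e he
    obtain ⟨hf1, hf1R, hf2, hf2R⟩ := hE2.sub f hf
    have hx1 : al * x.1 + be * x.2 ≤ al * v.1 + be * v.2 := by
      obtain ⟨s, t, hs, ht, hst, rfl⟩ := hxe
      have a1 := hs1 _ he1
      have a2 := hs1 _ he2
      have : s = 1 - t := by linarith
      subst this
      simp
      nlinarith
    have key : x = v ∧ (x = f.1 ∨ x = f.2) := by
      obtain ⟨s, t, hs, ht, hst, rfl⟩ := hxf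
      have hstt : s = 1 - t := by linarith
      by_cases h1 : f.1 = v
      · have h2 : f.2 ≠ v := by
          intro h; rw [h, ← h1] at hf2R; exact hf2R hf1R
        have b2 := hs2 _ hf2 h2
        have ht0 : t = 0 := by
          by_contra hne
          have htp : 0 < t := lt_of_le_of_ne ht (Ne.symm hne)
          subst hstt
          rw [h1] at hx1
          simp at hx1
          nlinarith [mul_pos htp (sub_pos.2 b2)]
        subst ht0
        have : s = 1 := by linarith
        subst this
        simp [h1]
      · by_cases h2 : f.2 = v
        · have b1 := hs2 _ hf1 h1
          have ht0 : s = 0 := by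
            by_contra hne
            have htp : 0 < s := lt_of_le_of_ne hs (Ne.symm hne)
            have : t = 1 - s := by linarith
            subst this
            rw [h2] at hx1
            simp at hx1
            nlinarith [mul_pos htp (sub_pos.2 b1)]
          subst ht0
          have : t = 1 := by linarith
          subst this
          simp [h2]
        · exfalso
          have b1 := hs2 _ hf1 h1
          have b2 := hs2 _ hf2 h2
          subst hstt
          simp at hx1
          rcases eq_or_lt_of_le ht with h0 | h0
          · subst h0; simp at hx1; linarith
          · nlinarith [mul_pos h0 (sub_pos.2 b2), mul_nonneg hs (sub_pos.2 b1).le]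
    refine ⟨?_, key.2⟩
    obtain ⟨rfl, -⟩ := key
    by_contra hcon
    push Not at hcon
    have hne : e.1 ≠ e.2 := fun h => he2R (h ▸ he1R)
    exact hgp e.1 ((hS _).2 (Or.inl he1)) e.2 ((hS _).2 (Or.inl he2)) x ((hS _).2 (Or.inl hv1)) hne
      (Ne.symm hcon.1) (Ne.symm hcon.2) (ori_of_mem_segment hxe)
  have hdisj : Disjoint E1 E2 := by
    rw [Finset.disjoint_left]
    intro e he1 he2
    obtain ⟨a1, a2, a3, a4⟩ := hE1.sub e he1
    obtain ⟨b1, b2, b3, b4⟩ := hE2.sub e he2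
    have h1 := hcommon _ a1 b1
    have h2 := hcommon _ a3 b3
    rw [h1] at a2
    rw [h2] at a4
    exact a4 a2
  refine ⟨E1 ∪ E2, ⟨?_, ?_, ?_, ?_⟩, ?_⟩
  · intro e he
    rcases Finset.mem_union.1 he with he | he
    · obtain ⟨a1, a2, a3, a4⟩ := hE1.sub e he
      exact ⟨(hS _).2 (Or.inl a1), a2, (hS _).2 (Or.inl a3), a4⟩
    · obtain ⟨a1, a2, a3, a4⟩ := hE2.sub e he
      exact ⟨(hS _).2 (Or.inr a1), a2, (hS _).2 (Or.inr a3), a4⟩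
  · have hi : S1 ∩ S2 = {v} := by
      ext p
      simp only [Finset.mem_inter, Finset.mem_singleton]
      exact ⟨fun h => hcommon p h.1 h.2, fun h => h ▸ ⟨hv1, hv2⟩⟩
    have h3 := Finset.card_union_add_card_inter S1 S2
    rw [hi, Finset.card_singleton] at h3
    rw [Finset.card_union_of_disjoint hdisj, hS']
    have := hE1.card
    have := hE2.card
    omega
  · have m1 : ∀ p ∈ S1, ∀ q ∈ S1, Relation.ReflTransGen (adjE (E1 ∪ E2)) p q := by
      intro p hp q hq
      refine Relation.ReflTransGen.mono ?_ _ _ (hE1.conn p hp q hq)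
      rintro a b (h | h)
      · exact Or.inl (Finset.mem_union_left _ h)
      · exact Or.inr (Finset.mem_union_left _ h)
    have m2 : ∀ p ∈ S2, ∀ q ∈ S2, Relation.ReflTransGen (adjE (E1 ∪ E2)) p q := by
      intro p hp q hq
      refine Relation.ReflTransGen.mono ?_ _ _ (hE2.conn p hp q hq)
      rintro a b (h | h)
      · exact Or.inl (Finset.mem_union_right _ h)
      · exact Or.inr (Finset.mem_union_right _ h)
    intro p hp q hq
    rcases (hS p).1 hp with hp | hp <;> rcases (hS q).1 hq with hq | hq
    · exact m1 p hp q hq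
    · exact (m1 p hp v hv1).trans (m2 v hv2 q hq)
    · exact (m2 p hp v hv2).trans (m1 v hv1 q hq)
    · exact m2 p hp q hq
  · intro e he f hf hef x hxe hxf
    rcases Finset.mem_union.1 he with he | he <;> rcases Finset.mem_union.1 hf with hf | hf
    · exact hE1.plane e he f hf hef x hxe hxf
    · exact hcross e he f hf x hxe hxf
    · exact (hcross f hf e he x hxf hxe).symm
    · exact hE2.plane e he f hf hef x hxe hxf
  · intro p hp
    refine (dg_union _ _ _).trans ?_
    by_cases hpv : p = v
    · subst hpv
      exact (Nat.add_le_add (hd1 _ hv1) (hd2 _ hv2)).trans hcv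
    · rcases (hS p).1 hp with hp1 | hp2
      · have : p ∉ S2 := fun h => hpv (hcommon p hp1 h)
        rw [hE2.dg_zero this, add_zero]
        exact (hd1 p hp1).trans (hc1 p hp1 hpv)
      · have : p ∉ S1 := fun h => hpv (hcommon p h hp2)
        rw [hE1.dg_zero this, zero_add]
        exact (hd2 p hp2).trans (hc2 p hp2 hpv)

theorem tr_single (R : Finset Pt) (v : Pt) (c : Pt → ℕ) : Tr R {v} c := by
  refine ⟨∅, ⟨by simp, by simp, ?_, by simp⟩, by simp [dg]⟩
  intro p hp q hq
  simp at hp hq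
  subst hp; subst hq
  exact Relation.ReflTransGen.refl

theorem tr_edge {R : Finset Pt} {r b : Pt} (hr : r ∈ R) (hb : b ∉ R) : Tr R {r, b} (fun _ => 1) := by
  have hne : r ≠ b := fun h => hb (h ▸ hr)
  refine ⟨{(r, b)}, ⟨?_, ?_, ?_, ?_⟩, ?_⟩
  · simp [hr, hb]
  · simp [Finset.card_pair hne]
  · intro p hp q hq
    have e1 : adjE {(r, b)} r b := Or.inl (by simp)
    have e2 : adjE {(r, b)} b r := Or.inr (by simp)
    simp at hp hq
    rcases hp with rfl | rfl <;> rcases hq with rfl | rfl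
    · exact Relation.ReflTransGen.refl
    · exact Relation.ReflTransGen.single e1
    · exact Relation.ReflTransGen.single e2
    · exact Relation.ReflTransGen.refl
  · intro e he f hf hef
    simp at he hf
    exact absurd (he.trans hf.symm) hef
  · intro p hp
    unfold dg
    exact (Finset.card_filter_le _ _).trans (by simp)

theorem ori_swap (a b c : Pt) : ori a c b = - ori a b c := by unfold ori; ring

theorem ori_swap' (a b c : Pt) : ori b a c = - ori a b c := by unfold ori; ring

theorem ori_rot (a b c : Pt) : ori b c a = ori a b c := by unfold ori; ring

@[simp] theorem ori_self_left (a b : Pt) : ori a a b = 0 := by unfold ori; ring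

@[simp] theorem ori_self_right (a b : Pt) : ori a b b = 0 := by unfold ori; ring

@[simp] theorem ori_self_outer (a b : Pt) : ori a b a = 0 := by unfold ori; ring

/-- Gluing along a line through `y` and `m`. -/
theorem glueO {R S S1 S2 : Finset Pt} {c c1 c2 : Pt → ℕ} (v y m : Pt) (s : ℝ)
    (h1 : Tr R S1 c1) (h2 : Tr R S2 c2) (hgp : GP S)
    (hS : ∀ p, p ∈ S ↔ p ∈ S1 ∨ p ∈ S2) (hv1 : v ∈ S1) (hv2 : v ∈ S2)
    (hv : ori y m v = 0)
    (hs1 : ∀ p ∈ S1, s * ori y m p ≤ 0)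
    (hs2 : ∀ p ∈ S2, p ≠ v → 0 < s * ori y m p)
    (hc1 : ∀ p ∈ S1, p ≠ v → c1 p ≤ c p) (hc2 : ∀ p ∈ S2, p ≠ v → c2 p ≤ c p)
    (hcv : c1 v + c2 v ≤ c v) : Tr R S c := by
  have hv' : s * ori y m v = 0 := by rw [hv, mul_zero]
  refine glue v (- (s * (m.2 - y.2))) (s * (m.1 - y.1)) h1 h2 hgp hS hv1 hv2 ?_ ?_ hc1 hc2 hcv
  · intro p hp
    have := hs1 p hp
    unfold ori at this hv'
    linarith
  · intro p hp hne
    have := hs2 p hp hne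
    unfold ori at this hv'
    linarith

/-- `y` is exposed with respect to `P`. -/
def Exps (y : Pt) (P : Finset Pt) : Prop :=
  ∃ dx dy : ℝ, ∀ p ∈ P, 0 < dx * (p.2 - y.2) - dy * (p.1 - y.1)

theorem Exps.mono {y : Pt} {P Q : Finset Pt} (h : Exps y P) (hs : Q ⊆ P) : Exps y Q := by
  obtain ⟨dx, dy, h⟩ := h
  exact ⟨dx, dy, fun p hp => h p (hs hp)⟩

theorem exps_of_ori {y z : Pt} {P : Finset Pt} (s : ℝ) (h : ∀ p ∈ P, 0 < s * ori y z p) :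
    Exps y P := by
  refine ⟨s * (z.1 - y.1), s * (z.2 - y.2), fun p hp => ?_⟩
  have := h p hp
  unfold ori at this
  linarith

theorem exps_of_ori' {y z : Pt} {P : Finset Pt} (s : ℝ) (h : ∀ p ∈ P, 0 < s * ori z y p) :
    Exps y P := by
  refine exps_of_ori (z := z) (-s) fun p hp => ?_
  have := h p hp
  rw [ori_swap'] at this
  linarith

theorem Exps.trans {y : Pt} {P : Finset Pt} (h : Exps y P) {s : ℝ} {p q r : Pt} (hp : p ∈ P)
    (hq : q ∈ P) (hr : r ∈ P) (h1 : 0 < s * ori y p q) (h2 : 0 < s * ori y q r) :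
    0 < s * ori y p r := by
  obtain ⟨dx, dy, h⟩ := h
  have a := h p hp
  have b := h q hq
  have c := h r hr
  have e : (dx * (q.2 - y.2) - dy * (q.1 - y.1)) * (s * ori y p r) =
      (dx * (p.2 - y.2) - dy * (p.1 - y.1)) * (s * ori y q r) +
      (dx * (r.2 - y.2) - dy * (r.1 - y.1)) * (s * ori y p q) := by
    unfold ori; ring
  have : 0 < (dx * (q.2 - y.2) - dy * (q.1 - y.1)) * (s * ori y p r) := by
    rw [e]; positivity
  exact (pos_iff_pos_of_mul_pos this).1 b

theorem Exps.exists_max {y : Pt} {P : Finset Pt} (h : Exps y P) (hne : P.Nonempty) {s : ℝ}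
    (hs : s ≠ 0) (hy : y ∉ P) (hgp : GP (insert y P)) :
    ∃ m ∈ P, ∀ p ∈ P, p ≠ m → 0 < s * ori y p m := by
  obtain ⟨dx, dy, h⟩ := h
  obtain ⟨m, hm, hmin⟩ := Finset.exists_min_image P
    (fun p => s * ((dx * (p.1 - y.1) + dy * (p.2 - y.2)) /
      (dx * (p.2 - y.2) - dy * (p.1 - y.1)))) hne
  refine ⟨m, hm, fun p hp hpm => ?_⟩
  have a := h p hp
  have b := h m hm
  have c := hmin p hp
  have hne0 : s * ori y p m ≠ 0 := by
    refine mul_ne_zero hs (hgp y (by simp) p (by simp [hp]) m (by simp [hm]) ?_ ?_ hpm)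
    · rintro rfl; exact hy hp
    · rintro rfl; exact hy hm
  refine lt_of_le_of_ne ?_ (Ne.symm hne0)
  have hd : 0 < dx ^ 2 + dy ^ 2 := by
    rcases eq_or_ne dx 0 with rfl | hx
    · rcases eq_or_ne dy 0 with rfl | hy
      · simp at b
      · positivity
    · positivity
  have e : (dx ^ 2 + dy ^ 2) * (s * ori y p m) =
      (dx * (p.2 - y.2) - dy * (p.1 - y.1)) * (dx * (m.2 - y.2) - dy * (m.1 - y.1)) *
      (s * ((dx * (p.1 - y.1) + dy * (p.2 - y.2)) / (dx * (p.2 - y.2) - dy * (p.1 - y.1))) -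
       s * ((dx * (m.1 - y.1) + dy * (m.2 - y.2)) / (dx * (m.2 - y.2) - dy * (m.1 - y.1)))) := by
    have a' := a.ne'
    have b' := b.ne'
    unfold ori
    field_simp
    ring
  have : 0 ≤ (dx ^ 2 + dy ^ 2) * (s * ori y p m) := by
    rw [e]
    exact mul_nonneg (mul_pos a b).le (sub_nonneg.2 c)
  exact nonneg_of_mul_nonneg_right this hd

theorem Exps.exists_min {y : Pt} {P : Finset Pt} (h : Exps y P) (hne : P.Nonempty) {s : ℝ}
    (hs : s ≠ 0) (hy : y ∉ P) (hgp : GP (insert y P)) :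
    ∃ m ∈ P, ∀ p ∈ P, p ≠ m → 0 < s * ori y m p := by
  obtain ⟨m, hm, H⟩ := h.exists_max hne (neg_ne_zero.2 hs) hy hgp
  refine ⟨m, hm, fun p hp hpm => ?_⟩
  have := H p hp hpm
  rw [ori_swap] at this
  linarith

/-- Weights: red points `-1`, blue points `k`. -/
def wt (R : Finset Pt) (k : ℕ) (p : Pt) : ℤ := if p ∈ R then -1 else k

/-- Total weight. -/
def sm (R : Finset Pt) (k : ℕ) (P : Finset Pt) : ℤ := ∑ p ∈ P, wt R k p

theorem wt_red {R : Finset Pt} {k : ℕ} {p : Pt} (h : p ∈ R) : wt R k p = -1 := by simp [wt, h]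

theorem wt_blue {R : Finset Pt} {k : ℕ} {p : Pt} (h : p ∉ R) : wt R k p = k := by simp [wt, h]

theorem wt_ge (R : Finset Pt) (k : ℕ) (p : Pt) : -1 ≤ wt R k p := by
  unfold wt; split_ifs <;> omega

theorem sm_erase {R : Finset Pt} {k : ℕ} {P : Finset Pt} {p : Pt} (h : p ∈ P) :
    sm R k (P.erase p) = sm R k P - wt R k p := by
  unfold sm
  rw [← Finset.add_sum_erase P _ h]; ring

theorem sm_sdiff {R : Finset Pt} {k : ℕ} {P Q : Finset Pt} (h : Q ⊆ P) :
    sm R k (P \ Q) = sm R k P - sm R k Q := by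
  unfold sm
  rw [← Finset.sum_sdiff h]; ring

@[simp] theorem sm_empty (R : Finset Pt) (k : ℕ) : sm R k ∅ = 0 := rfl

/-- `A` is an initial part of `P` in the angular order around `y`. -/
def Low (s : ℝ) (y : Pt) (A P : Finset Pt) : Prop :=
  A ⊆ P ∧ ∀ p ∈ A, ∀ q ∈ P, q ∉ A → 0 < s * ori y p q

/-- All proper initial parts have nonnegative weight. -/
def First (R : Finset Pt) (k : ℕ) (s : ℝ) (y : Pt) (A : Finset Pt) : Prop :=
  ∀ A', Low s y A' A → A' ≠ A → 0 ≤ sm R k A'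

theorem Low.trans {s : ℝ} {y : Pt} {A B C : Finset Pt} (h1 : Low s y A B) (h2 : Low s y B C) :
    Low s y A C := by
  refine ⟨h1.1.trans h2.1, fun p hp q hq hqA => ?_⟩
  by_cases hqB : q ∈ B
  · exact h1.2 p hp q hqB hqA
  · exact h2.2 p (h1.1 hp) q hq hqB

theorem low_erase_max {s : ℝ} {y m : Pt} {A : Finset Pt}
    (h : ∀ p ∈ A, p ≠ m → 0 < s * ori y p m) : Low s y (A.erase m) A := by
  refine ⟨Finset.erase_subset _ _, fun p hp q hq hqA => ?_⟩
  have : q = m := by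
    by_contra hne; exact hqA (Finset.mem_erase.2 ⟨hne, hq⟩)
  subst this
  exact h p (Finset.mem_of_mem_erase hp) (Finset.ne_of_mem_erase hp)

/-- Minimal initial part with a property. -/
theorem exists_min_low {s : ℝ} {y : Pt} {P : Finset Pt} (Q : Finset Pt → Prop)
    {A0 : Finset Pt} (h0 : Low s y A0 P) (hQ : Q A0) :
    ∃ A, Low s y A P ∧ Q A ∧ ∀ A', Low s y A' A → A' ≠ A → ¬ Q A' := by
  obtain ⟨A, hA, hmin⟩ := Finset.exists_min_image
    (P.powerset.filter (fun A => Low s y A P ∧ Q A)) Finset.card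
    ⟨A0, by simp [h0, h0.1, hQ]⟩
  simp only [Finset.mem_filter, Finset.mem_powerset] at hA hmin
  refine ⟨A, hA.2.1, hA.2.2, fun A' hl hne hQ' => ?_⟩
  have h1 := hmin A' ⟨hl.1.trans hA.1, hl.trans hA.2.1, hQ'⟩
  exact hne (Finset.eq_of_subset_of_card_le hl.1 h1)

theorem low_refl (s : ℝ) (y : Pt) (P : Finset Pt) : Low s y P P :=
  ⟨subset_rfl, fun _ _ q hq hn => absurd hq hn⟩

theorem hit {R : Finset Pt} {k : ℕ} {s : ℝ} {y : Pt} {P : Finset Pt} (hs : s ≠ 0)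
    (he : Exps y P) (hy : y ∉ P) (hgp : GP (insert y P)) (hsum : sm R k P ≤ -1) :
    ∃ A, Low s y A P ∧ sm R k A = -1 ∧ First R k s y A ∧ A.Nonempty := by
  obtain ⟨A, hl, hQ, hmin⟩ := exists_min_low (fun A => sm R k A ≤ -1) (low_refl s y P) hsum
  have hne : A.Nonempty := by
    rw [Finset.nonempty_iff_ne_empty]
    rintro rfl
    simp at hQ
  have hF : First R k s y A := fun A' h1 h2 => by
    have := hmin A' h1 h2
    omega
  refine ⟨A, hl, ?_, hF, hne⟩
  obtain ⟨m, hm, hmax⟩ := (he.mono hl.1).exists_max hne hs (fun h => hy (hl.1 h))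
    (hgp.mono (Finset.insert_subset_insert _ hl.1))
  have h1 := hF _ (low_erase_max hmax) (by
    intro h
    have : m ∉ A.erase m := by simp
    rw [h] at this
    exact this hm)
  rw [sm_erase hm] at h1
  have := wt_ge R k m
  omega

/-- Degree caps. -/
def cap (R : Finset Pt) (k : ℕ) (p : Pt) : ℕ := if p ∈ R then 3 else k + 1

theorem cap_red {R : Finset Pt} {k : ℕ} {p : Pt} (h : p ∈ R) : cap R k p = 3 := by simp [cap, h]

theorem cap_blue {R : Finset Pt} {k : ℕ} {p : Pt} (h : p ∉ R) : cap R k p = k + 1 := by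
  simp [cap, h]

theorem cap_pos (R : Finset Pt) (k : ℕ) (p : Pt) : 1 ≤ cap R k p := by
  unfold cap; split_ifs <;> omega

/-- Trees in which an exposed blue point is a leaf. -/
def VP (R : Finset Pt) (k : ℕ) (L : Finset Pt) (b : Pt) : Prop :=
  b ∉ L → b ∉ R → GP (insert b L) → Exps b L → sm R k L = -1 →
    Tr R (insert b L) (Function.update (cap R k) b 1)

/-- Trees in which an exposed red point has degree at most two. -/
def NP (R : Finset Pt) (k : ℕ) (L : Finset Pt) (u : Pt) : Prop :=
  u ∈ L → u ∈ R → GP L → Exps u (L.erase u) → sm R k L = -1 →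
    Tr R L (Function.update (cap R k) u 2)

/-- Trees in which two adjacent hull blue points are leaves. -/
def DP (R : Finset Pt) (k : ℕ) (s : ℝ) (M : Finset Pt) (a b : Pt) : Prop :=
  s ≠ 0 → a ∉ M → b ∉ M → a ≠ b → a ∉ R → b ∉ R → GP (insert a (insert b M)) →
    (∀ p ∈ M, 0 < s * ori a b p) → sm R k M = -1 → First R k s a M →
    Tr R (insert a (insert b M)) (Function.update (Function.update (cap R k) a 1) b 1)

/-- Star of pieces around an exposed blue hub. -/
theorem hub {R : Finset Pt} {k n : ℕ} {y : Pt} (hyR : y ∉ R)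
    (hV : ∀ L : Finset Pt, L.card ≤ n → VP R k L y) (j : ℕ) :
    ∀ P : Finset Pt, P.card ≤ n → y ∉ P → GP (insert y P) → Exps y P →
      sm R k P = -((j + 1 : ℕ) : ℤ) → Tr R (insert y P) (Function.update (cap R k) y (j + 1)) := by
  induction j with
  | zero =>
    intro P hn hy hgp he hsum
    exact hV P hn hy hyR hgp he (by simpa using hsum)
  | succ j ih =>
    intro P hn hy hgp he hsum
    obtain ⟨A, hl, hsA, -, hA⟩ := hit (R := R) (k := k) (s := 1) one_ne_zero he hy hgp
      (by push_cast at hsum; omega)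
    have hAP := hl.1
    have hAn : A.card ≤ n := (Finset.card_le_card hAP).trans hn
    have t1 := hV A hAn (fun h => hy (hAP h)) hyR
      (hgp.mono (Finset.insert_subset_insert _ hAP)) (he.mono hAP) hsA
    have t2 := ih (P \ A) ((Finset.card_le_card Finset.sdiff_subset).trans hn)
      (fun h => hy (Finset.sdiff_subset h))
      (hgp.mono (Finset.insert_subset_insert _ Finset.sdiff_subset)) (he.mono Finset.sdiff_subset)
      (by rw [sm_sdiff hAP]; push_cast at hsum ⊢; omega)
    obtain ⟨m, hm, hmax⟩ := (he.mono hAP).exists_max hA (one_ne_zero) (fun h => hy (hAP h))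
      (hgp.mono (Finset.insert_subset_insert _ hAP))
    refine glueO y y m 1 t1 t2 hgp ?_ (by simp) (by simp) (by simp) ?_ ?_ ?_ ?_ ?_
    · intro p
      have := @hAP p
      simp only [Finset.mem_insert, Finset.mem_sdiff]
      tauto
    · intro p hp
      rcases Finset.mem_insert.1 hp with rfl | hp
      · simp
      · by_cases h : p = m
        · subst h; simp
        · have := hmax p hp h
          rw [ori_swap]; linarith
    · intro p hp hne
      rcases Finset.mem_insert.1 hp with rfl | hp
      · exact absurd rfl hne
      · rw [Finset.mem_sdiff] at hp
        exact hl.2 m hm p hp.1 hp.2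
    · intro p _ hne
      simp [Function.update_of_ne hne]
    · intro p _ hne
      simp [Function.update_of_ne hne]
    · simp; omega

/-- A red exposed point whose extreme angular neighbour is blue can be a leaf. -/
theorem spike {R : Finset Pt} {k n : ℕ} (hk : 2 ≤ k)
    (hV : ∀ (y : Pt) (L : Finset Pt), L.card ≤ n → VP R k L y)
    {X : Finset Pt} {u q : Pt} {s : ℝ} (hX : X.card ≤ n + 1) (hu : u ∉ X) (hq : q ∈ X) (huR : u ∈ R)
    (hqR : q ∉ R) (hgp : GP (insert u X)) (hside : ∀ p ∈ X, p ≠ q → 0 < s * ori u q p)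
    (hsum : sm R k X = 0) : Tr R (insert u X) (Function.update (cap R k) u 1) := by
  have huq : u ≠ q := fun h => hqR (h ▸ huR)
  have hsub : insert q (X.erase q) = X := Finset.insert_erase hq
  have t2 := hub hqR (hV q) (k - 1) (X.erase q) (by rw [Finset.card_erase_of_mem hq]; omega)
    (by simp) (by rw [hsub]; exact hgp.mono (Finset.subset_insert _ _))
    (exps_of_ori' (z := u) s (fun p hp => hside p (Finset.mem_of_mem_erase hp)
      (Finset.ne_of_mem_erase hp)))
    (by rw [sm_erase hq, wt_blue hqR]; have : k - 1 + 1 = k := by omega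
        rw [this]; omega)
  rw [hsub] at t2
  refine glueO q u q s (tr_edge huR hqR) t2 hgp ?_ (by simp) hq (by simp) ?_ ?_ ?_ ?_ ?_
  · intro p
    simp only [Finset.mem_insert, Finset.mem_singleton]
    constructor
    · rintro (h | h)
      · exact Or.inl (Or.inl h)
      · exact Or.inr h
    · rintro ((h | h) | h)
      · exact Or.inl h
      · exact Or.inr (h ▸ hq)
      · exact Or.inr h
  · intro p hp
    simp only [Finset.mem_insert, Finset.mem_singleton] at hp
    rcases hp with rfl | rfl <;> simp
  · intro p hp hne
    exact hside p hp hne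
  · intro p hp hne
    simp only [Finset.mem_insert, Finset.mem_singleton] at hp
    rcases hp with rfl | rfl
    · simp
    · exact absurd rfl hne
  · intro p hp hne
    have : p ≠ u := fun h => hu (h ▸ hp)
    simp [Function.update_of_ne hne, Function.update_of_ne this]
  · rw [Function.update_of_ne (Ne.symm huq), cap_blue hqR]
    simp; omega

/-- The two-edge path. -/
theorem cherry {R : Finset Pt} {r a b : Pt} (hr : r ∈ R) (ha : a ∉ R) (hb : b ∉ R) (hab : a ≠ b)
    (hgp : GP {a, b, r}) : Tr R {a, b, r} (fun p => if p = r then 2 else 1) := by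
  have har : a ≠ r := fun h => ha (h ▸ hr)
  have hbr : b ≠ r := fun h => hb (h ▸ hr)
  have h0 : ori a r b ≠ 0 := hgp a (by simp) r (by simp) b (by simp) har hab hbr.symm
  refine glueO r a r (ori a r b) (tr_edge hr ha) (tr_edge hr hb) hgp ?_ (by simp) (by simp)
    (by simp) ?_ ?_ ?_ ?_ ?_
  · intro p
    simp only [Finset.mem_insert, Finset.mem_singleton]
    tauto
  · intro p hp
    simp only [Finset.mem_insert, Finset.mem_singleton] at hp
    rcases hp with rfl | rfl <;> simp
  · intro p hp hne
    simp only [Finset.mem_insert, Finset.mem_singleton] at hp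
    rcases hp with rfl | rfl
    · exact absurd rfl hne
    · exact mul_self_pos.2 h0
  · intro p hp hne
    simp [hne]
  · intro p hp hne
    simp [hne]
  · simp

/-- Hub attached to a red point, with pieces on both sides. -/
theorem two_sided {R : Finset Pt} {k n : ℕ} 
    (hV : ∀ (y : Pt) (L : Finset Pt), L.card ≤ n → VP R k L y)
    {A C : Finset Pt} {u m : Pt} {i j : ℕ} (hA : A.card ≤ n) (hC : C.card ≤ n)
    (huR : u ∈ R) (hmR : m ∉ R)
    (hgp : GP (insert u (insert m (A ∪ C))))
    (hsA : ∀ p ∈ A, 0 < ori u p m) (hsC : ∀ p ∈ C, 0 < ori u m p)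
    (hA1 : sm R k A = -((i + 1 : ℕ) : ℤ)) (hC1 : sm R k C = -((j + 1 : ℕ) : ℤ))
    (hij : i + j + 3 ≤ k + 1) :
    Tr R (insert u (insert m (A ∪ C))) (Function.update (cap R k) u 1) := by
  have hum : u ≠ m := fun h => hmR (h ▸ huR)
  have hmA : m ∉ A := fun h => by have := hsA m h; simp at this
  have hmC : m ∉ C := fun h => by have := hsC m h; simp at this
  have huA : u ∉ A := fun h => by have := hsA u h; simp at this
  have huC : u ∉ C := fun h => by have := hsC u h; simp at this
  have s1 : insert m A ⊆ insert u (insert m (A ∪ C)) := by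
    intro p; simp only [Finset.mem_insert, Finset.mem_union]; tauto
  have s2 : insert m C ⊆ insert u (insert m (A ∪ C)) := by
    intro p; simp only [Finset.mem_insert, Finset.mem_union]; tauto
  have s3 : insert u (insert m A) ⊆ insert u (insert m (A ∪ C)) := by
    intro p; simp only [Finset.mem_insert, Finset.mem_union]; tauto
  have sA' : ∀ p ∈ A, 0 < (-1) * ori u m p := fun p hp => by
    have := hsA p hp; rw [ori_swap] at this; linarith
  have sC' : ∀ p ∈ C, 0 < 1 * ori u m p := fun p hp => by
    have := hsC p hp; linarith
  have t1 := hub hmR (hV m) i A hA hmA (hgp.mono s1) (exps_of_ori' _ sA') hA1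
  have t2 := hub hmR (hV m) j C hC hmC (hgp.mono s2) (exps_of_ori' _ sC') hC1
  have t3 : Tr R (insert u (insert m A))
      (Function.update (Function.update (cap R k) m (i + 2)) u 1) := by
    refine glueO m u m (-1) (tr_edge huR hmR) t1 (hgp.mono s3) ?_ (by simp) (by simp) (by simp)
      ?_ ?_ ?_ ?_ ?_
    · intro p; simp only [Finset.mem_insert, Finset.mem_singleton]; tauto
    · intro p hp
      simp only [Finset.mem_insert, Finset.mem_singleton] at hp
      rcases hp with rfl | rfl <;> simp
    · intro p hp hne
      rcases Finset.mem_insert.1 hp with rfl | hp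
      · exact absurd rfl hne
      · exact sA' p hp
    · intro p hp hne
      simp only [Finset.mem_insert, Finset.mem_singleton] at hp
      rcases hp with rfl | rfl
      · simp
      · exact absurd rfl hne
    · intro p hp hne
      have : p ≠ u := by
        rintro rfl
        rcases Finset.mem_insert.1 hp with h | h
        · exact hum h
        · exact huA h
      simp [Function.update_of_ne hne, Function.update_of_ne this]
    · simp [Function.update_of_ne hum.symm]; omega
  refine glueO m u m 1 t3 t2 hgp ?_ (by simp) (by simp) (by simp) ?_ ?_ ?_ ?_ ?_
  · intro p; simp only [Finset.mem_insert, Finset.mem_union]; tauto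
  · intro p hp
    simp only [Finset.mem_insert] at hp
    rcases hp with rfl | rfl | hp
    · simp
    · simp
    · have := sA' p hp; linarith
  · intro p hp hne
    rcases Finset.mem_insert.1 hp with rfl | hp
    · exact absurd rfl hne
    · exact sC' p hp
  · intro p hp hne
    by_cases h : p = u
    · subst h; simp
    · simp [Function.update_of_ne hne, Function.update_of_ne h]
  · intro p hp hne
    have : p ≠ u := by
      rintro rfl
      rcases Finset.mem_insert.1 hp with h | h
      · exact hum h
      · exact huC h
    simp [Function.update_of_ne hne, Function.update_of_ne this]
  · simp [Function.update_of_ne hum.symm, cap_blue hmR]; omega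


theorem erase_ne_of_mem {A : Finset Pt} {m : Pt} (hm : m ∈ A) : A.erase m ≠ A := by
  intro h
  have h2 : m ∉ A.erase m := by simp
  rw [h] at h2
  exact h2 hm

/-- First point at which the running weight becomes positive. -/
theorem split {R : Finset Pt} {k : ℕ} {y : Pt} {X A0 : Finset Pt} (he : Exps y X) (hy : y ∉ X)
    (hgp : GP (insert y X)) (h0 : Low 1 y A0 X) (hsum : 0 < sm R k A0) :
    ∃ A m, Low 1 y A X ∧ m ∈ A ∧ m ∉ R ∧ (∀ p ∈ A, p ≠ m → 0 < ori y p m) ∧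
      (∀ p ∈ X, p ∉ A → 0 < ori y m p) ∧ 0 < sm R k A ∧ sm R k (A.erase m) ≤ 0 ∧
      sm R k (A.erase m) = sm R k A - k ∧
      ∀ A', Low 1 y A' A → A' ≠ A → sm R k A' ≤ 0 := by
  obtain ⟨A, hl, hQ, hmin⟩ := exists_min_low (fun A => 0 < sm R k A) h0 hsum
  have hne : A.Nonempty := by
    rw [Finset.nonempty_iff_ne_empty]
    rintro rfl
    simp at hQ
  obtain ⟨m, hm, hmax⟩ := (he.mono hl.1).exists_max hne one_ne_zero (fun h => hy (hl.1 h))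
    (hgp.mono (Finset.insert_subset_insert _ hl.1))
  have h1 := hmin _ (low_erase_max hmax) (erase_ne_of_mem hm)
  have h2 := sm_erase (R := R) (k := k) hm
  have hmR : m ∉ R := by
    intro h
    rw [wt_red h] at h2
    omega
  rw [wt_blue hmR] at h2
  refine ⟨A, m, hl, hm, hmR, fun p hp hpm => by simpa using hmax p hp hpm,
    fun p hp hpA => by simpa using hl.2 m hm p hp hpA, hQ, by omega, h2, fun A' a b => ?_⟩
  have := hmin A' a b
  omega

theorem nstep {R : Finset Pt} {k n : ℕ} (hk : 2 ≤ k)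
    (hV : ∀ (y : Pt) (L : Finset Pt), L.card ≤ n → VP R k L y)
    {L : Finset Pt} {u : Pt} (hL : L.card ≤ n + 1) : NP R k L u := by
  intro hu huR hgp he hsum
  obtain ⟨X, hX⟩ : ∃ X, X = L.erase u := ⟨_, rfl⟩
  have huX : u ∉ X := by rw [hX]; simp
  have hLX : L = insert u X := by rw [hX, Finset.insert_erase hu]
  have hXc : X.card ≤ n := by rw [hX, Finset.card_erase_of_mem hu]; omega
  have hXs : sm R k X = 0 := by rw [hX, sm_erase hu, wt_red huR]; omega
  rw [← hX] at he
  rw [hLX] at hgp ⊢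
  clear hX hLX hsum hL hu
  have mono1 : Tr R (insert u X) (Function.update (cap R k) u 1) →
      Tr R (insert u X) (Function.update (cap R k) u 2) := fun h => by
    refine h.mono fun p _ => ?_
    by_cases hp : p = u
    · subst hp; simp
    · simp [Function.update_of_ne hp]
  rcases X.eq_empty_or_nonempty with rfl | hne
  · exact tr_single _ _ _
  obtain ⟨p1, hp1, hmin1⟩ := he.exists_min hne one_ne_zero huX hgp
  by_cases hp1R : p1 ∈ R
  swap
  · exact mono1 (spike hk hV (by omega) huX hp1 huR hp1R hgp hmin1 hXs)
  obtain ⟨pn, hpn, hmaxn⟩ := he.exists_max hne one_ne_zero huX hgp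
  by_cases hpnR : pn ∈ R
  swap
  · exact mono1 (spike (s := -1) hk hV (by omega) huX hpn huR hpnR hgp (fun p hp hpp => by
      have := hmaxn p hp hpp
      rw [ori_swap] at this; linarith) hXs)
  obtain ⟨A, m, hl, hmA, hmR, hleft, hright, hpos, hle, hsA, hminA⟩ :=
    split (R := R) (k := k) he huX hgp (low_erase_max hmaxn)
      (by rw [sm_erase hpn, wt_red hpnR, hXs]; norm_num)
  have hAX := hl.1
  have hCs := sm_sdiff (R := R) (k := k) hAX
  have hsub2 : A.erase m ⊆ X := (Finset.erase_subset _ _).trans hAX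
  rcases lt_or_eq_of_le hle with hlt | heq
  · have e : insert u X = insert u (insert m (A.erase m ∪ X \ A)) := by
      ext p
      have := @hAX p
      have h3 : p = m → p ∈ A := fun h => h ▸ hmA
      simp only [Finset.mem_insert, Finset.mem_union, Finset.mem_erase, Finset.mem_sdiff]
      tauto
    rw [e]
    refine (two_sided (i := (-(sm R k (A.erase m)) - 1).toNat)
      (j := (-(sm R k (X \ A)) - 1).toNat) hV ((Finset.card_le_card hsub2).trans hXc)
      ((Finset.card_le_card Finset.sdiff_subset).trans hXc) huR hmR (e ▸ hgp) ?_ ?_ ?_ ?_ ?_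
      ).mono ?_
    · intro p hp
      exact hleft p (Finset.mem_of_mem_erase hp) (Finset.ne_of_mem_erase hp)
    · intro p hp
      rw [Finset.mem_sdiff] at hp
      exact hright p hp.1 hp.2
    · push_cast; omega
    · push_cast; omega
    · omega
    · intro p _
      by_cases hp : p = u
      · subst hp; simp
      · simp [Function.update_of_ne hp]
  · -- the balanced case
    have hp1A : p1 ∈ A := by
      by_contra hc
      have h1 := hl.2 m hmA p1 hp1 hc
      have h2 := hmin1 m (hAX hmA) (fun h => hmR (h ▸ hp1R))
      rw [ori_swap] at h2
      linarith
    have hp1X1 : p1 ∈ A.erase m := Finset.mem_erase.2 ⟨fun h => hmR (h ▸ hp1R), hp1A⟩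
    have hlow1 : Low 1 u (A.erase m) A := low_erase_max (fun p hp hpm => by
      simpa using hleft p hp hpm)
    obtain ⟨m', hm', hmax'⟩ := (he.mono hsub2).exists_max ⟨p1, hp1X1⟩ one_ne_zero
      (fun h => huX (hsub2 h)) (hgp.mono (Finset.insert_subset_insert _ hsub2))
    have hm'R : m' ∉ R := by
      intro h
      have h1 := hminA _ ((low_erase_max hmax').trans hlow1) (by
        intro h
        have h2 : m ∉ (A.erase m).erase m' := by simp
        rw [h] at h2
        exact h2 hmA)
      rw [sm_erase hm', wt_red h] at h1
      omega
    have t1 := spike (s := -1) hk hV (X := A.erase m) (u := u) (q := m')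
      (by have := Finset.card_le_card hsub2; omega) (fun h => huX (hsub2 h)) hm' huR hm'R
      (hgp.mono (Finset.insert_subset_insert _ hsub2)) (fun p hp hpp => by
        have := hmax' p hp hpp
        rw [ori_swap] at this; linarith) heq
    have hmX2 : m ∈ X \ A.erase m := by simp [hAX hmA]
    have t2 := spike (s := 1) hk hV (X := X \ A.erase m) (u := u) (q := m)
      (by have := Finset.card_le_card (Finset.sdiff_subset (s := X) (t := A.erase m)); omega)
      (fun h => huX (Finset.sdiff_subset h)) hmX2 huR hmR
      (hgp.mono (Finset.insert_subset_insert _ Finset.sdiff_subset)) (fun p hp hpp => by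
        rw [Finset.mem_sdiff, Finset.mem_erase] at hp
        simpa using hright p hp.1 (fun h => hp.2 ⟨hpp, h⟩)) (by rw [sm_sdiff hsub2]; omega)
    have hlowX := hlow1.trans hl
    refine glueO u u m' 1 t1 t2 hgp ?_ (by simp) (by simp) (by simp) ?_ ?_ ?_ ?_ ?_
    · intro p
      have := @hsub2 p
      simp only [Finset.mem_insert, Finset.mem_sdiff]
      tauto
    · intro p hp
      rcases Finset.mem_insert.1 hp with rfl | hp
      · simp
      · by_cases h : p = m'
        · subst h; simp
        · have := hmax' p hp h
          rw [ori_swap]; linarith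
    · intro p hp hne
      rcases Finset.mem_insert.1 hp with rfl | hp
      · exact absurd rfl hne
      · rw [Finset.mem_sdiff] at hp
        exact hlowX.2 m' hm' p hp.1 hp.2
    · intro p _ hne
      simp [Function.update_of_ne hne]
    · intro p _ hne
      simp [Function.update_of_ne hne]
    · simp

/-- The step for exposed blue leaves. -/
theorem vstep {R : Finset Pt} {k n : ℕ} (hk : 2 ≤ k)
    (hV : ∀ (y : Pt) (L : Finset Pt), L.card ≤ n → VP R k L y)
    (hD : ∀ (s : ℝ) (M : Finset Pt) (a b : Pt), M.card ≤ n → DP R k s M a b)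
    {L : Finset Pt} {b : Pt} (hL : L.card ≤ n + 1) : VP R k L b := by
  intro hb hbR hgp he hsum
  have hne : L.Nonempty := by
    rw [Finset.nonempty_iff_ne_empty]
    rintro rfl
    simp at hsum
  obtain ⟨c, hc, hmin⟩ := he.exists_min hne one_ne_zero hb hgp
  have hbc : b ≠ c := fun h => hb (h ▸ hc)
  have he' : Exps c (L.erase c) := exps_of_ori' (z := b) 1 (fun p hp =>
    hmin p (Finset.mem_of_mem_erase hp) (Finset.ne_of_mem_erase hp))
  by_cases hcR : c ∈ R
  · have t := nstep hk hV hL hc hcR (hgp.mono (Finset.subset_insert _ _)) he' hsum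
    refine glueO c b c 1 (tr_edge hcR hbR) t hgp ?_ (by simp) hc (by simp) ?_ ?_ ?_ ?_ ?_
    · intro p
      have h3 : p = c → p ∈ L := fun h => h ▸ hc
      simp only [Finset.mem_insert, Finset.mem_singleton]
      tauto
    · intro p hp
      simp only [Finset.mem_insert, Finset.mem_singleton] at hp
      rcases hp with rfl | rfl <;> simp
    · intro p hp hne
      exact hmin p hp hne
    · intro p hp hne
      simp only [Finset.mem_insert, Finset.mem_singleton] at hp
      rcases hp with rfl | rfl
      · exact absurd rfl hne
      · simp
    · intro p hp hne
      have : p ≠ b := fun h => hb (h ▸ hp)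
      simp [Function.update_of_ne hne, Function.update_of_ne this]
    · simp [Function.update_of_ne hbc.symm, cap_red hcR]
  · obtain ⟨P, hP⟩ : ∃ P, P = L.erase c := ⟨_, rfl⟩
    have hLP : L = insert c P := by rw [hP, Finset.insert_erase hc]
    have hcP : c ∉ P := by rw [hP]; simp
    have hPc : P.card ≤ n := by rw [hP, Finset.card_erase_of_mem hc]; omega
    have hPs : sm R k P = -1 - k := by rw [hP, sm_erase hc, wt_blue hcR]; omega
    have hbP : b ∉ P := fun h => hb (by rw [hP] at h; exact Finset.mem_of_mem_erase h)
    have hminP : ∀ p ∈ P, 0 < ori b c p := fun p hp => by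
      rw [hP] at hp
      simpa using hmin p (Finset.mem_of_mem_erase hp) (Finset.ne_of_mem_erase hp)
    rw [← hP] at he'
    rw [hLP] at hgp ⊢
    clear hP hLP hmin hsum hL hc he hne hb
    have hgpc : GP (insert c P) := hgp.mono (Finset.subset_insert _ _)
    obtain ⟨A, hl, hsA, hF, hA⟩ := hit (R := R) (k := k) (s := -1) (by norm_num) he' hcP hgpc
      (by omega)
    have hAP := hl.1
    have t1 := hD (-1) A c b ((Finset.card_le_card hAP).trans hPc) (by norm_num)
      (fun h => hcP (hAP h)) (fun h => hbP (hAP h)) hbc.symm hcR hbR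
      (hgp.mono (by
        intro p
        have := @hAP p
        simp only [Finset.mem_insert]; tauto))
      (fun p hp => by
        have := hminP p (hAP hp)
        rw [ori_swap'] at this; linarith) hsA hF
    have t2 := hub hcR (hV c) (k - 1) (P \ A)
      ((Finset.card_le_card Finset.sdiff_subset).trans hPc) (fun h => hcP (Finset.sdiff_subset h))
      (hgpc.mono (Finset.insert_subset_insert _ Finset.sdiff_subset))
      (he'.mono Finset.sdiff_subset)
      (by rw [sm_sdiff hAP]; have : k - 1 + 1 = k := by omega
          rw [this]; omega)
    obtain ⟨m, hm, hmax⟩ := (he'.mono hAP).exists_max (s := -1) hA (by norm_num)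
      (fun h => hcP (hAP h)) (hgpc.mono (Finset.insert_subset_insert _ hAP))
    refine glueO c c m (-1) t1 t2 hgp ?_ (by simp) (by simp) (by simp) ?_ ?_ ?_ ?_ ?_
    · intro p
      have := @hAP p
      simp only [Finset.mem_insert, Finset.mem_sdiff]
      tauto
    · intro p hp
      simp only [Finset.mem_insert] at hp
      rcases hp with rfl | rfl | hp
      · simp
      · have := hminP m (hAP hm)
        rw [ori_rot]
        linarith
      · by_cases h : p = m
        · subst h; simp
        · have := hmax p hp h
          rw [ori_swap]; linarith
    · intro p hp hne
      rcases Finset.mem_insert.1 hp with rfl | hp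
      · exact absurd rfl hne
      · rw [Finset.mem_sdiff] at hp
        exact hl.2 m hm p hp.1 hp.2
    · intro p _ hne
      by_cases h : p = b
      · subst h; simp
      · simp [Function.update_of_ne hne, Function.update_of_ne h]
    · intro p hp hne
      have : p ≠ b := by
        rintro rfl
        rcases Finset.mem_insert.1 hp with h | h
        · exact hne h
        · exact hbP (Finset.sdiff_subset h)
      simp [Function.update_of_ne hne, Function.update_of_ne this]
    · simp [Function.update_of_ne hbc.symm, cap_blue hcR]; omega

/-- Continuity argument: interpolate between two functionals, one minimised at a blue point and
the other at a red point. -/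
theorem facing {MR MB : Finset Pt} {f0 f1 : Pt → ℝ} {t0 t1 : Pt} (h0 : t0 ∈ MB) (h1 : t1 ∈ MR)
    (hm0 : ∀ p ∈ MR, f0 t0 ≤ f0 p) (hm1 : ∀ p ∈ MB, f1 t1 ≤ f1 p) :
    ∃ σ : ℝ, 0 ≤ σ ∧ σ ≤ 1 ∧ ∃ u ∈ MR, ∃ q ∈ MB,
      (1 - σ) * f0 u + σ * f1 u = (1 - σ) * f0 q + σ * f1 q ∧
      (∀ p ∈ MR, (1 - σ) * f0 u + σ * f1 u ≤ (1 - σ) * f0 p + σ * f1 p) ∧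
      (∀ p ∈ MB, (1 - σ) * f0 u + σ * f1 u ≤ (1 - σ) * f0 p + σ * f1 p) := by
  have hR : MR.Nonempty := ⟨t1, h1⟩
  have hB : MB.Nonempty := ⟨t0, h0⟩
  let F : Pt → ℝ → ℝ := fun p σ => (1 - σ) * f0 p + σ * f1 p
  let φ : ℝ → ℝ := fun σ => MB.inf' hB (fun p => F p σ) - MR.inf' hR (fun p => F p σ)
  have hF : ∀ p, Continuous (F p) := fun p => by
    show Continuous fun σ => (1 - σ) * f0 p + σ * f1 p
    fun_prop
  have hφ : Continuous φ :=
    (Continuous.finset_inf'_apply hB (fun p _ => hF p)).sub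
      (Continuous.finset_inf'_apply hR (fun p _ => hF p))
  have a0 : φ 0 ≤ 0 := by
    show MB.inf' hB (fun p => F p 0) - MR.inf' hR (fun p => F p 0) ≤ 0
    have e1 : MB.inf' hB (fun p => F p 0) ≤ F t0 0 := Finset.inf'_le _ h0
    have e2 : F t0 0 ≤ MR.inf' hR (fun p => F p 0) := by
      refine Finset.le_inf' _ _ fun p hp => ?_
      have := hm0 p hp
      simp only [F]; linarith
    linarith
  have a1 : 0 ≤ φ 1 := by
    show 0 ≤ MB.inf' hB (fun p => F p 1) - MR.inf' hR (fun p => F p 1)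
    have e1 : MR.inf' hR (fun p => F p 1) ≤ F t1 1 := Finset.inf'_le _ h1
    have e2 : F t1 1 ≤ MB.inf' hB (fun p => F p 1) := by
      refine Finset.le_inf' _ _ fun p hp => ?_
      have := hm1 p hp
      simp only [F]; linarith
    linarith
  obtain ⟨σ, hσ, hz⟩ := intermediate_value_Icc (zero_le_one' ℝ) hφ.continuousOn ⟨a0, a1⟩
  have hz' : MB.inf' hB (fun p => F p σ) = MR.inf' hR (fun p => F p σ) := sub_eq_zero.1 hz
  obtain ⟨u, hu, eu⟩ := Finset.exists_mem_eq_inf' hR (fun p => F p σ)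
  obtain ⟨q, hq, eq⟩ := Finset.exists_mem_eq_inf' hB (fun p => F p σ)
  refine ⟨σ, hσ.1, hσ.2, u, hu, q, hq, ?_, ?_, ?_⟩
  · show F u σ = F q σ
    rw [← eu, ← eq, hz']
  · intro p hp
    show F u σ ≤ F p σ
    rw [← eu]
    exact Finset.inf'_le (fun p => F p σ) hp
  · intro p hp
    show F u σ ≤ F p σ
    rw [← eu, ← hz']
    exact Finset.inf'_le (fun p => F p σ) hp

theorem sm_singleton (R : Finset Pt) (k : ℕ) (p : Pt) : sm R k {p} = wt R k p := by simp [sm]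

/-- Affine functional form of `ori`. -/
theorem ori_affine (a b p : Pt) : ori a b p = (-(b.2 - a.2)) * p.1 + (b.1 - a.1) * p.2 +
    ((b.2 - a.2) * a.1 - (b.1 - a.1) * a.2) := by unfold ori; ring

/-- Case of `dstep` where the tangents from `a` and `b` have different colours. -/
theorem dstep_facing {R : Finset Pt} {k n : ℕ} (hk : 2 ≤ k)
    (hV : ∀ (y : Pt) (L : Finset Pt), L.card ≤ n → VP R k L y)
    {s : ℝ} {M : Finset Pt} {a b t y : Pt} (hM : M.card ≤ n + 1)
    (haM : a ∉ M) (hbM : b ∉ M) (hab : a ≠ b) (haR : a ∉ R) (hbR : b ∉ R)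
    (hgp : GP (insert a (insert b M))) (hside : ∀ p ∈ M, 0 < s * ori a b p)
    (hsum : sm R k M = -1) (ht : t ∈ M) (htR : t ∉ R) (hmint : ∀ p ∈ M, p ≠ t → 0 < s * ori a t p)
    (hy : y ∈ M) (hyR : y ∈ R) (hminy : ∀ p ∈ M, p ≠ y → 0 < (-s) * ori b y p) :
    Tr R (insert a (insert b M)) (Function.update (Function.update (cap R k) a 1) b 1) := by
  obtain ⟨σ, hσ0, hσ1, u, hu, q, hq, hguq, hminR, hminB⟩ :=
    facing (MR := M.filter (· ∈ R)) (MB := M.filter (· ∉ R)) (f0 := fun p => s * ori a t p)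
    (f1 := fun p => (-s) * ori b y p) (t0 := t) (t1 := y) (by simp [ht, htR]) (by simp [hy, hyR])
    (fun p hp => by
      rw [Finset.mem_filter] at hp
      have := hmint p hp.1 (fun h => htR (h ▸ hp.2))
      simp only [ori_self_right, mul_zero]; exact this.le)
    (fun p hp => by
      rw [Finset.mem_filter] at hp
      have := hminy p hp.1 (fun h => hp.2 (h ▸ hyR))
      simp only [ori_self_right, mul_zero]; exact this.le)
  rw [Finset.mem_filter] at hu hq
  obtain ⟨huM, huR⟩ := hu
  obtain ⟨hqM, hqR⟩ := hq
  obtain ⟨al, be, ga, hg⟩ : ∃ al be ga : ℝ, ∀ p : Pt,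
      (1 - σ) * (s * ori a t p) + σ * ((-s) * ori b y p) = al * p.1 + be * p.2 + ga := by
    refine ⟨(1 - σ) * (s * (-(t.2 - a.2))) + σ * ((-s) * (-(y.2 - b.2))),
      (1 - σ) * (s * (t.1 - a.1)) + σ * ((-s) * (y.1 - b.1)),
      (1 - σ) * (s * ((t.2 - a.2) * a.1 - (t.1 - a.1) * a.2)) +
        σ * ((-s) * ((y.2 - b.2) * b.1 - (y.1 - b.1) * b.2)), fun p => ?_⟩
    rw [ori_affine, ori_affine]; ring
  have hmin : ∀ p ∈ M, al * u.1 + be * u.2 + ga ≤ al * p.1 + be * p.2 + ga := by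
    intro p hp
    rw [← hg, ← hg]
    by_cases h : p ∈ R
    · exact hminR p (by simp [hp, h])
    · exact hminB p (by simp [hp, h])
  have hut : u ≠ t := fun h => htR (h ▸ huR)
  have hqy : q ≠ y := fun h => hqR (h ▸ hyR)
  have huq : u ≠ q := fun h => hqR (h ▸ huR)
  have hpos : 0 < al * u.1 + be * u.2 + ga := by
    rw [← hg]
    rcases lt_or_eq_of_le hσ1 with h | h
    · have e1 := hmint u huM hut
      have e2 : 0 ≤ (-s) * ori b y u := by
        by_cases h : u = y
        · subst h; simp
        · exact (hminy u huM h).le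
      have : 0 < 1 - σ := by linarith
      positivity
    · rw [hguq, h]
      have := hminy q hqM hqy
      linarith
  have hga : al * a.1 + be * a.2 + ga ≤ 0 := by
    rw [← hg]
    have := hside y hy
    rw [← ori_rot] at this
    simp only [ori_self_outer]
    have h2 := mul_nonneg hσ0 this.le
    linarith
  have hgb : al * b.1 + be * b.2 + ga ≤ 0 := by
    rw [← hg]
    have := hside t ht
    rw [ori_swap] at this
    simp only [ori_self_outer]
    have h2 := mul_nonneg (sub_nonneg.2 hσ1) this.le
    linarith
  rw [hg, hg] at hguq
  have hdet : ∀ p : Pt, (be * (q.1 - u.1) - al * (q.2 - u.2)) * ori u q p =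
      ((q.1 - u.1) ^ 2 + (q.2 - u.2) ^ 2) *
        ((al * p.1 + be * p.2 + ga) - (al * u.1 + be * u.2 + ga)) := by
    intro p
    have e : al * (q.1 - u.1) + be * (q.2 - u.2) = 0 := by linarith
    unfold ori
    linear_combination (-(q.1 - u.1) * (p.1 - u.1) - (q.2 - u.2) * (p.2 - u.2)) * e
  have hd : 0 < (q.1 - u.1) ^ 2 + (q.2 - u.2) ^ 2 := by
    by_contra hc
    have e1 : (q.1 - u.1) ^ 2 = 0 := by nlinarith [sq_nonneg (q.1 - u.1), sq_nonneg (q.2 - u.2)]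
    have e2 : (q.2 - u.2) ^ 2 = 0 := by nlinarith [sq_nonneg (q.1 - u.1), sq_nonneg (q.2 - u.2)]
    exact huq (Prod.ext (by nlinarith [pow_eq_zero_iff (two_ne_zero) |>.1 e1])
      (by nlinarith [pow_eq_zero_iff (two_ne_zero) |>.1 e2]))
  have hs0 : be * (q.1 - u.1) - al * (q.2 - u.2) ≠ 0 := by
    intro h
    have := hdet a
    rw [h, zero_mul] at this
    rcases mul_eq_zero.1 this.symm with h | h <;> linarith
  have hMsub : M ⊆ insert a (insert b M) := by
    intro p; simp only [Finset.mem_insert]; tauto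
  have hins : insert u (M.erase u) = M := Finset.insert_erase huM
  have t1 := spike (s := be * (q.1 - u.1) - al * (q.2 - u.2)) hk hV (X := M.erase u) (u := u)
    (q := q) (by rw [Finset.card_erase_of_mem huM]; omega) (by simp) (by simp [hqM, huq.symm])
    huR hqR (by rw [hins]; exact hgp.mono hMsub) (fun p hp hpq => by
      rw [Finset.mem_erase] at hp
      have h1 : ori u q p ≠ 0 := hgp u (hMsub huM) q (hMsub hqM) p (hMsub hp.2) huq
        (Ne.symm hp.1) (Ne.symm hpq)
      refine lt_of_le_of_ne ?_ (mul_ne_zero hs0 h1).symm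
      rw [hdet]
      exact mul_nonneg hd.le (sub_nonneg.2 (hmin p hp.2)))
    (by rw [sm_erase huM, wt_red huR]; omega)
  rw [hins] at t1
  have hau : a ≠ u := fun h => haM (h ▸ huM)
  have hbu : b ≠ u := fun h => hbM (h ▸ huM)
  have t2 := cherry huR haR hbR hab (hgp.mono (by
    intro p
    have h3 : p = u → p ∈ M := fun h => h ▸ huM
    simp only [Finset.mem_insert, Finset.mem_singleton]; tauto))
  refine glue u (-al) (-be) t1 t2 hgp ?_ huM (by simp) ?_ ?_ ?_ ?_ ?_
  · intro p
    have h3 : p = u → p ∈ M := fun h => h ▸ huM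
    simp only [Finset.mem_insert, Finset.mem_singleton]; tauto
  · intro p hp
    have := hmin p hp
    linarith
  · intro p hp hne
    simp only [Finset.mem_insert, Finset.mem_singleton] at hp
    rcases hp with rfl | rfl | rfl
    · linarith
    · linarith
    · exact absurd rfl hne
  · intro p hp hne
    have h1 : p ≠ a := fun h => haM (h ▸ hp)
    have h2 : p ≠ b := fun h => hbM (h ▸ hp)
    simp [Function.update_of_ne hne, Function.update_of_ne h1, Function.update_of_ne h2]
  · intro p hp hne
    simp only [Finset.mem_insert, Finset.mem_singleton] at hp
    rcases hp with rfl | rfl | rfl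
    · simp [hne, Function.update_of_ne hab]
    · simp [hne]
    · exact absurd rfl hne
  · simp [Function.update_of_ne hau.symm, Function.update_of_ne hbu.symm, cap_red huR]

set_option maxHeartbeats 1000000 in
/-- Case of `dstep` where the tangent point from `b` is blue. -/
theorem dstep_blue {R : Finset Pt} {k n : ℕ} (hk : 2 ≤ k)
    (hV : ∀ (y : Pt) (L : Finset Pt), L.card ≤ n → VP R k L y)
    (hD : ∀ (s : ℝ) (M : Finset Pt) (a b : Pt), M.card ≤ n → DP R k s M a b)
    {s : ℝ} {M : Finset Pt} {a b y : Pt} (hM : M.card ≤ n + 1) (hs : s ≠ 0)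
    (haM : a ∉ M) (hbM : b ∉ M) (hab : a ≠ b) (haR : a ∉ R) (hbR : b ∉ R)
    (hgp : GP (insert a (insert b M))) (hside : ∀ p ∈ M, 0 < s * ori a b p)
    (hsum : sm R k M = -1) (hF : First R k s a M)
    (hy : y ∈ M) (hyR : y ∉ R) (hminy : ∀ p ∈ M, p ≠ y → 0 < (-s) * ori b y p) :
    Tr R (insert a (insert b M)) (Function.update (Function.update (cap R k) a 1) b 1) := by
  have hs' : -s ≠ 0 := neg_ne_zero.2 hs
  have hya : y ≠ a := fun h => haM (h ▸ hy)
  have hyb : y ≠ b := fun h => hbM (h ▸ hy)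
  have hMsub : M ⊆ insert a (insert b M) := by
    intro p; simp only [Finset.mem_insert]; tauto
  have heA : Exps a M := exps_of_ori s hside
  obtain ⟨P, hP⟩ : ∃ P, P = M.erase y := ⟨_, rfl⟩
  have hyP : y ∉ P := by rw [hP]; simp
  have hPM : P ⊆ M := by rw [hP]; exact Finset.erase_subset _ _
  have hMP : ∀ p, p ∈ M ↔ p = y ∨ p ∈ P := by
    intro p
    have h3 : p = y → p ∈ M := fun h => h ▸ hy
    rw [hP, Finset.mem_erase]; tauto
  have hPc : P.card ≤ n := by rw [hP, Finset.card_erase_of_mem hy]; omega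
  have hPs : sm R k P = -1 - k := by rw [hP, sm_erase hy, wt_blue hyR]; omega
  clear hP
  have hPb : ∀ p ∈ P, 0 < s * ori y b p := fun p hp => by
    have := hminy p (hPM hp) (fun h => hyP (h ▸ hp))
    rw [ori_swap'] at this; linarith
  have heY : Exps y P := exps_of_ori s hPb
  have hgpY : GP (insert y P) := hgp.mono (Finset.insert_subset (hMsub hy) (hPM.trans hMsub))
  have haP : a ∉ P := fun h => haM (hPM h)
  have hbP : b ∉ P := fun h => hbM (hPM h)
  obtain ⟨C, hC⟩ : ∃ C, C = P.filter (fun p => 0 < s * ori a p y) := ⟨_, rfl⟩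
  have hCP : C ⊆ P := by rw [hC]; exact Finset.filter_subset _ _
  have hCpos : ∀ p ∈ C, 0 < s * ori a p y := fun p hp => by
    rw [hC, Finset.mem_filter] at hp; exact hp.2
  have hGpos : ∀ p ∈ P, p ∉ C → 0 < s * ori a y p := fun p hp hpC => by
    have h1 : ¬ 0 < s * ori a p y := fun h => hpC (by rw [hC, Finset.mem_filter]; exact ⟨hp, h⟩)
    have h2 : s * ori a y p ≠ 0 := mul_ne_zero hs (hgp a (by simp) y (hMsub hy) p
      (hMsub (hPM hp)) hya.symm (fun h => haP (h ▸ hp)) (fun h => hyP (h ▸ hp)))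
    rw [ori_swap] at h1
    exact lt_of_le_of_ne (by linarith) h2.symm
  clear hC
  have hClow : Low s a C M := by
    refine ⟨hCP.trans hPM, fun p hp q hq hqC => ?_⟩
    rcases (hMP q).1 hq with rfl | hqP
    · exact hCpos p hp
    · exact heA.trans (hPM (hCP hp)) hy hq (hCpos p hp) (hGpos q hqP hqC)
  have hCs : 0 ≤ sm R k C := hF C hClow (fun h => hyP (hCP (h ▸ hy)))
  have hGP : P \ C ⊆ P := Finset.sdiff_subset
  obtain ⟨A1, hl1', hs1, hF1, hne1⟩ := hit (R := R) (k := k) (s := -s) (P := P \ C) hs'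
    (heY.mono hGP) (fun h => hyP (hGP h)) (hgpY.mono (Finset.insert_subset_insert _ hGP))
    (by rw [sm_sdiff hCP]; omega)
  have hA1a : ∀ p ∈ A1, 0 < (-s) * ori y a p := fun p hp => by
    have h1 := hl1'.1 hp
    rw [Finset.mem_sdiff] at h1
    have := hGpos p h1.1 h1.2
    rw [ori_swap'] at this; linarith
  have hl1 : Low (-s) y A1 P := by
    refine ⟨hl1'.1.trans hGP, fun p hp q hq hqA => ?_⟩
    by_cases hqC : q ∈ C
    · have h1 := hl1'.1 hp
      rw [Finset.mem_sdiff] at h1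
      have e1 := hPb q hq
      have e2 := hPb p h1.1
      have e3 := hA1a p hp
      have e4 := hCpos q hqC
      have e5 := hside y hy
      have e : (s * ori a b y) * ((-s) * ori y p q) =
          (s * ori y b q) * ((-s) * ori y a p) + (s * ori y b p) * (s * ori a q y) := by
        unfold ori; ring
      have : 0 < (s * ori a b y) * ((-s) * ori y p q) := by
        rw [e]; exact add_pos (mul_pos e1 e3) (mul_pos e2 e4)
      exact (pos_iff_pos_of_mul_pos this).1 e5
    · exact hl1'.2 p hp q (Finset.mem_sdiff.2 ⟨hq, hqC⟩) hqA
  have hA1P := hl1.1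
  have t1 := hD (-s) A1 y a ((Finset.card_le_card hA1P).trans hPc) hs' (fun h => hyP (hA1P h))
    (fun h => haP (hA1P h)) hya hyR haR (hgp.mono (by
      intro p
      have h1 := @hA1P p
      have h2 := hMP p
      simp only [Finset.mem_insert]; tauto)) hA1a hs1 hF1
  -- the second piece
  obtain ⟨P', hP'⟩ : ∃ P', P' = P \ A1 := ⟨_, rfl⟩
  have hP'P : P' ⊆ P := by rw [hP']; exact Finset.sdiff_subset
  have hP's : sm R k P' = -k := by rw [hP', sm_sdiff hA1P]; omega
  have hPP' : ∀ p, p ∈ P' ↔ p ∈ P ∧ p ∉ A1 := fun p => by rw [hP', Finset.mem_sdiff]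
  clear hP'
  obtain ⟨A2, hl2, hs2, hF2, hne2⟩ := hit (R := R) (k := k) (s := s) (P := P') hs
    (heY.mono hP'P) (fun h => hyP (hP'P h)) (hgpY.mono (Finset.insert_subset_insert _ hP'P))
    (by omega)
  have hA2P' := hl2.1
  have hA2P := hA2P'.trans hP'P
  have t2 := hD s A2 y b ((Finset.card_le_card hA2P).trans hPc) hs (fun h => hyP (hA2P h))
    (fun h => hbP (hA2P h)) hyb hyR hbR (hgp.mono (by
      intro p
      have h1 := @hA2P p
      have h2 := hMP p
      simp only [Finset.mem_insert]; tauto)) (fun p hp => hPb p (hA2P hp)) hs2 hF2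
  have hsub3 : P' \ A2 ⊆ P := Finset.sdiff_subset.trans hP'P
  have t3 := hub hyR (hV y) (k - 2) (P' \ A2) ((Finset.card_le_card hsub3).trans hPc)
    (fun h => hyP (hsub3 h)) (hgpY.mono (Finset.insert_subset_insert _ hsub3))
    (heY.mono hsub3) (by rw [sm_sdiff hA2P']; push_cast; omega)
  obtain ⟨m2, hm2, hmax2⟩ := (heY.mono hA2P).exists_max hne2 hs (fun h => hyP (hA2P h))
    (hgpY.mono (Finset.insert_subset_insert _ hA2P))
  obtain ⟨m1, hm1, hmax1⟩ := (heY.mono hA1P).exists_max hne1 hs' (fun h => hyP (hA1P h))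
    (hgpY.mono (Finset.insert_subset_insert _ hA1P))
  have t4 : Tr R (insert y (insert b P'))
      (Function.update (Function.update (cap R k) b 1) y k) := by
    refine glueO y y m2 s t2 t3 (hgp.mono ?_) ?_ (by simp) (by simp) (by simp) ?_ ?_ ?_ ?_ ?_
    · intro p
      have h1 := @hP'P p
      have h2 := hMP p
      simp only [Finset.mem_insert]; tauto
    · intro p
      have h1 := @hA2P' p
      simp only [Finset.mem_insert, Finset.mem_sdiff]; tauto
    · intro p hp
      simp only [Finset.mem_insert] at hp
      rcases hp with rfl | rfl | hp
      · simp
      · have := hPb m2 (hA2P hm2)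
        rw [ori_swap]; linarith
      · by_cases h : p = m2
        · subst h; simp
        · have := hmax2 p hp h
          rw [ori_swap]; linarith
    · intro p hp hne
      rcases Finset.mem_insert.1 hp with rfl | hp
      · exact absurd rfl hne
      · rw [Finset.mem_sdiff] at hp
        exact hl2.2 m2 hm2 p hp.1 hp.2
    · intro p _ hne
      by_cases h : p = b
      · subst h; simp [Function.update_of_ne hne]
      · simp [Function.update_of_ne hne, Function.update_of_ne h]
    · intro p hp hne
      have : p ≠ b := by
        rintro rfl
        rcases Finset.mem_insert.1 hp with h | h
        · exact hne h
        · exact hbP (hsub3 h)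
      simp [Function.update_of_ne hne, Function.update_of_ne this]
    · simp [Function.update_of_ne hyb]; omega
  refine glueO y y m1 (-s) t1 t4 hgp ?_ (by simp) (by simp) (by simp) ?_ ?_ ?_ ?_ ?_
  · intro p
    have h1 := @hA1P p
    have h2 := hMP p
    have h3 := hPP' p
    simp only [Finset.mem_insert]; tauto
  · intro p hp
    simp only [Finset.mem_insert] at hp
    rcases hp with rfl | rfl | hp
    · simp
    · have := hA1a m1 hm1
      rw [ori_swap]; linarith
    · by_cases h : p = m1
      · subst h; simp
      · have := hmax1 p hp h
        rw [ori_swap]; linarith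
  · intro p hp hne
    simp only [Finset.mem_insert] at hp
    rcases hp with rfl | rfl | hp
    · exact absurd rfl hne
    · have := hPb m1 (hA1P hm1)
      rw [ori_swap]; linarith
    · exact hl1.2 m1 hm1 p ((hPP' p).1 hp).1 ((hPP' p).1 hp).2
  · intro p hp hne
    have hpb : p ≠ b := by
      rintro rfl
      simp only [Finset.mem_insert] at hp
      rcases hp with h | h | h
      · exact hne h
      · exact hab h.symm
      · exact hbP (hA1P h)
    by_cases h : p = a
    · subst h; simp [Function.update_of_ne hpb]
    · simp [Function.update_of_ne hne, Function.update_of_ne h, Function.update_of_ne hpb]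
  · intro p hp hne
    have hpa : p ≠ a := by
      rintro rfl
      simp only [Finset.mem_insert] at hp
      rcases hp with h | h | h
      · exact hne h
      · exact hab h
      · exact haP (hP'P h)
    by_cases h : p = b
    · subst h; simp [Function.update_of_ne hne]
    · simp [Function.update_of_ne hne, Function.update_of_ne h, Function.update_of_ne hpa]
  · simp [Function.update_of_ne hya, Function.update_of_ne hyb, cap_blue hyR]; omega

theorem dstep {R : Finset Pt} {k n : ℕ} (hk : 2 ≤ k)
    (hV : ∀ (y : Pt) (L : Finset Pt), L.card ≤ n → VP R k L y)
    (hD : ∀ (s : ℝ) (M : Finset Pt) (a b : Pt), M.card ≤ n → DP R k s M a b)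
    {s : ℝ} {M : Finset Pt} {a b : Pt} (hM : M.card ≤ n + 1) : DP R k s M a b := by
  intro hs haM hbM hab haR hbR hgp hside hsum hF
  have hne : M.Nonempty := by
    rw [Finset.nonempty_iff_ne_empty]
    rintro rfl
    simp at hsum
  have heA : Exps a M := exps_of_ori s hside
  have heB : Exps b M := exps_of_ori' s hside
  have ga : GP (insert a M) := hgp.mono (by intro p; simp only [Finset.mem_insert]; tauto)
  have gb : GP (insert b M) := hgp.mono (Finset.subset_insert _ _)
  obtain ⟨t, ht, hmint⟩ := heA.exists_min hne hs haM ga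
  by_cases htR : t ∈ R
  · have hMt : M = {t} := by
      by_contra hc
      have := hF {t} ⟨by simpa using ht, fun p hp q hq hqt => by
        rw [Finset.mem_singleton] at hp hqt
        subst hp
        exact hmint q hq hqt⟩ (Ne.symm hc)
      rw [sm_singleton, wt_red htR] at this
      omega
    subst hMt
    refine (cherry htR haR hbR hab hgp).mono ?_
    intro p hp
    simp only [Finset.mem_insert, Finset.mem_singleton] at hp haM hbM
    rcases hp with rfl | rfl | rfl
    · simp [haM, Function.update_of_ne hab]
    · simp [hbM]
    · simp [Function.update_of_ne (Ne.symm haM), Function.update_of_ne (Ne.symm hbM), cap_red htR]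
  · obtain ⟨y, hy, hminy⟩ := heB.exists_min hne (neg_ne_zero.2 hs) hbM gb
    by_cases hyR : y ∈ R
    · exact dstep_facing hk hV hM haM hbM hab haR hbR hgp hside hsum ht htR hmint hy hyR hminy
    · exact dstep_blue hk hV hD hM hs haM hbM hab haR hbR hgp hside hsum hF hy hyR hminy

theorem main_ind {R : Finset Pt} {k : ℕ} (hk : 2 ≤ k) (n : ℕ) :
    (∀ (y : Pt) (L : Finset Pt), L.card ≤ n → VP R k L y) ∧
    (∀ (s : ℝ) (M : Finset Pt) (a b : Pt), M.card ≤ n → DP R k s M a b) := by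
  induction n with
  | zero =>
    constructor
    · intro y L hL _ _ _ _ hsum
      have : L = ∅ := by simpa using hL
      subst this
      simp at hsum
    · intro s M a b hL _ _ _ _ _ _ _ _ hsum
      have : M = ∅ := by simpa using hL
      subst this
      simp at hsum
  | succ n ih =>
    exact ⟨fun y L hL => vstep hk ih.1 ih.2 hL, fun s M a b hM => dstep hk ih.1 ih.2 hM⟩

/-- Variant of `spike` with total weight one. -/
theorem spike2 {R : Finset Pt} {k n : ℕ} (hk : 2 ≤ k)
    (hV : ∀ (y : Pt) (L : Finset Pt), L.card ≤ n → VP R k L y)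
    {X : Finset Pt} {u q : Pt} {s : ℝ} (hX : X.card ≤ n + 1) (hu : u ∉ X) (hq : q ∈ X) (huR : u ∈ R)
    (hqR : q ∉ R) (hgp : GP (insert u X)) (hside : ∀ p ∈ X, p ≠ q → 0 < s * ori u q p)
    (hsum : sm R k X = 1) : Tr R (insert u X) (Function.update (cap R k) u 1) := by
  have huq : u ≠ q := fun h => hqR (h ▸ huR)
  have hsub : insert q (X.erase q) = X := Finset.insert_erase hq
  have t2 := hub hqR (hV q) (k - 2) (X.erase q) (by rw [Finset.card_erase_of_mem hq]; omega)
    (by simp) (by rw [hsub]; exact hgp.mono (Finset.subset_insert _ _))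
    (exps_of_ori' (z := u) s (fun p hp => hside p (Finset.mem_of_mem_erase hp)
      (Finset.ne_of_mem_erase hp)))
    (by rw [sm_erase hq, wt_blue hqR]; push_cast; omega)
  rw [hsub] at t2
  refine glueO q u q s (tr_edge huR hqR) t2 hgp ?_ (by simp) hq (by simp) ?_ ?_ ?_ ?_ ?_
  · intro p
    have h3 : p = q → p ∈ X := fun h => h ▸ hq
    simp only [Finset.mem_insert, Finset.mem_singleton]
    tauto
  · intro p hp
    simp only [Finset.mem_insert, Finset.mem_singleton] at hp
    rcases hp with rfl | rfl <;> simp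
  · intro p hp hne
    exact hside p hp hne
  · intro p hp hne
    simp only [Finset.mem_insert, Finset.mem_singleton] at hp
    rcases hp with rfl | rfl
    · simp
    · exact absurd rfl hne
  · intro p hp hne
    have : p ≠ u := fun h => hu (h ▸ hp)
    simp [Function.update_of_ne hne, Function.update_of_ne this]
  · rw [Function.update_of_ne (Ne.symm huq), cap_blue hqR]
    simp; omega

theorem top_glue {R : Finset Pt} {k : ℕ} (hk : 2 ≤ k) {S W Z : Finset Pt} {y m : Pt} (s : ℝ)
    (hgp : GP S) (hS : ∀ p, p ∈ S ↔ p = y ∨ p ∈ W ∨ p ∈ Z) (hyW : y ∉ W) (hyZ : y ∉ Z)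
    (hyR : y ∈ R) (hm : m ∈ W) (hmR : m ∉ R) (hW : ∀ p ∈ W, p ≠ m → 0 < s * ori y m p)
    (hZ : ∀ p ∈ Z, 0 < (-s) * ori y m p) (hWs : sm R k W = 1) (hZs : sm R k Z = 0) :
    Tr R S (cap R k) := by
  have sW : insert y W ⊆ S := by
    intro p; rw [hS, Finset.mem_insert]; tauto
  have sZ : insert y Z ⊆ S := by
    intro p; rw [hS, Finset.mem_insert]; tauto
  have hV := (main_ind (R := R) hk S.card).1
  have hc1 := Finset.card_le_card sW
  have hc2 := Finset.card_le_card sZ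
  have t1 := spike2 hk hV (u := y) ((Finset.card_le_card (Finset.subset_insert y W)).trans
    (hc1.trans (Nat.le_succ _))) hyW hm hyR hmR (hgp.mono sW) hW hWs
  have hZe : (insert y Z).erase y = Z := Finset.erase_insert hyZ
  have t2 := nstep hk hV (u := y) (hc2.trans (Nat.le_succ _)) (by simp) hyR (hgp.mono sZ)
    (by rw [hZe]; exact exps_of_ori (-s) hZ) (by
      have := sm_erase (R := R) (k := k) (Finset.mem_insert_self y Z)
      rw [hZe, wt_red hyR] at this
      omega)
  refine glueO y y m (-s) t1 t2 hgp ?_ (by simp) (by simp) (by simp) ?_ ?_ ?_ ?_ ?_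
  · intro p
    rw [hS]
    simp only [Finset.mem_insert]; tauto
  · intro p hp
    rcases Finset.mem_insert.1 hp with rfl | hp
    · simp
    · by_cases h : p = m
      · subst h; simp
      · have := hW p hp h
        linarith
  · intro p hp hne
    rcases Finset.mem_insert.1 hp with rfl | hp
    · exact absurd rfl hne
    · exact hZ p hp
  · intro p _ hne
    simp [Function.update_of_ne hne]
  · intro p _ hne
    simp [Function.update_of_ne hne]
  · simp [cap_red hyR]

theorem exists_exps {S : Finset Pt} (hne : S.Nonempty) : ∃ y ∈ S, Exps y (S.erase y) := by
  obtain ⟨y, hy, hmax⟩ := Finset.exists_max_image S (fun p => p.1 ^ 2 + p.2 ^ 2) hne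
  refine ⟨y, hy, -y.2, y.1, fun p hp => ?_⟩
  rw [Finset.mem_erase] at hp
  have h1 := hmax p hp.2
  have h2 : 0 < (p.1 - y.1) ^ 2 + (p.2 - y.2) ^ 2 := by
    by_contra hc
    have e1 : (p.1 - y.1) ^ 2 = 0 := by nlinarith [sq_nonneg (p.1 - y.1), sq_nonneg (p.2 - y.2)]
    have e2 : (p.2 - y.2) ^ 2 = 0 := by nlinarith [sq_nonneg (p.1 - y.1), sq_nonneg (p.2 - y.2)]
    exact hp.1 (Prod.ext (sub_eq_zero.1 (pow_eq_zero_iff (two_ne_zero) |>.1 e1))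
      (sub_eq_zero.1 (pow_eq_zero_iff (two_ne_zero) |>.1 e2)))
  nlinarith

theorem top {R : Finset Pt} {k : ℕ} (hk : 2 ≤ k) {S : Finset Pt} (hgp : GP S) (hne : S.Nonempty)
    (hsum : sm R k S = 0) : Tr R S (cap R k) := by
  have hV := (main_ind (R := R) hk S.card).1
  obtain ⟨y, hy, he⟩ := exists_exps hne
  obtain ⟨X, hX⟩ : ∃ X, X = S.erase y := ⟨_, rfl⟩
  have hyX : y ∉ X := by rw [hX]; simp
  have hSX : insert y X = S := by rw [hX, Finset.insert_erase hy]
  have hXs : sm R k X = - wt R k y := by rw [hX, sm_erase hy]; omega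
  rw [← hX] at he
  clear hX
  have hXS : X ⊆ S := by rw [← hSX]; exact Finset.subset_insert _ _
  have hXc := Finset.card_le_card hXS
  by_cases hyR : y ∈ R
  swap
  · have t := hub hyR (hV y) (k - 1) X hXc hyX (hSX ▸ hgp) he (by
      rw [hXs, wt_blue hyR]; have : k - 1 + 1 = k := by omega
      rw [this])
    rw [hSX] at t
    refine t.mono fun p _ => ?_
    by_cases h : p = y
    · subst h
      rw [Function.update_self, cap_blue hyR]; omega
    · simp [Function.update_of_ne h]
  rw [wt_red hyR] at hXs
  obtain ⟨A, m, hl, hmA, hmR, hleft, hright, hpos, hle, hsA, -⟩ :=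
    split (R := R) (k := k) he hyX (hSX ▸ hgp) (low_refl 1 y X) (by omega)
  have hAX := hl.1
  have hCs := sm_sdiff (R := R) (k := k) hAX
  have hsub2 : A.erase m ⊆ X := (Finset.erase_subset _ _).trans hAX
  have hmem : ∀ p, p ∈ S ↔ p = y ∨ p ∈ X := fun p => by rw [← hSX, Finset.mem_insert]
  have hlf : ∀ p ∈ A, p ≠ m → 0 < (-1) * ori y m p := fun p hp hpm => by
    have := hleft p hp hpm
    rw [ori_swap] at this; linarith
  rcases lt_or_eq_of_le hle with hlt | heq
  · rcases lt_or_ge (sm R k (X \ A)) 0 with hlt2 | hge2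
    · have e : S = insert y (insert m (A.erase m ∪ X \ A)) := by
        ext p
        have := @hAX p
        have h3 : p = m → p ∈ A := fun h => h ▸ hmA
        rw [hmem]
        simp only [Finset.mem_insert, Finset.mem_union, Finset.mem_erase, Finset.mem_sdiff]
        tauto
      have t := two_sided (u := y) (m := m) (i := (-(sm R k (A.erase m)) - 1).toNat)
        (j := (-(sm R k (X \ A)) - 1).toNat) hV ((Finset.card_le_card hsub2).trans hXc)
        ((Finset.card_le_card Finset.sdiff_subset).trans hXc) hyR hmR (e ▸ hgp) 
        (fun p hp => hleft p (Finset.mem_of_mem_erase hp) (Finset.ne_of_mem_erase hp))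
        (fun p hp => by
          rw [Finset.mem_sdiff] at hp
          exact hright p hp.1 hp.2) (by push_cast; omega) (by push_cast; omega) (by omega)
      rw [← e] at t
      refine t.mono fun p _ => ?_
      by_cases h : p = y
      · subst h; simp [cap_red hyR]
      · simp [Function.update_of_ne h]
    · refine top_glue (W := A) (Z := X \ A) (y := y) (m := m) hk (-1) hgp ?_
        (fun h => hyX (hAX h)) (fun h => hyX (Finset.sdiff_subset h)) hyR hmA hmR hlf ?_ ?_ ?_
      · intro p
        have := @hAX p
        rw [hmem, Finset.mem_sdiff]; tauto
      · intro p hp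
        rw [Finset.mem_sdiff] at hp
        simpa using hright p hp.1 hp.2
      · omega
      · omega
  · refine top_glue (W := X \ A.erase m) (Z := A.erase m) (y := y) (m := m) hk 1 hgp ?_
        (fun h => hyX (Finset.sdiff_subset h)) (fun h => hyX (hsub2 h)) hyR
        (by simp [hAX hmA]) hmR ?_ ?_ ?_ ?_
    · intro p
      have := @hsub2 p
      rw [hmem, Finset.mem_sdiff]; tauto
    · intro p hp hpm
      rw [Finset.mem_sdiff, Finset.mem_erase] at hp
      simpa using hright p hp.1 (fun h => hp.2 ⟨hpm, h⟩)
    · intro p hp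
      exact hlf p (Finset.mem_of_mem_erase hp) (Finset.ne_of_mem_erase hp)
    · rw [sm_sdiff hsub2]; omega
    · exact heq

theorem gp_of_genPos {S : Finset Pt} (h : GenPos (↑S : Set Pt)) : GP S := by
  intro p hp q hq r hr hpq hpr hqr h0
  refine h p (by exact_mod_cast hp) q (by exact_mod_cast hq) r (by exact_mod_cast hr) hpq hpr hqr ?_
  rw [collinear_iff_of_mem (p₀ := p) (by simp)]
  refine ⟨q - p, ?_⟩
  have hd : 0 < (q.1 - p.1) ^ 2 + (q.2 - p.2) ^ 2 := by
    by_contra hc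
    have e1 : (q.1 - p.1) ^ 2 = 0 := by nlinarith [sq_nonneg (q.1 - p.1), sq_nonneg (q.2 - p.2)]
    have e2 : (q.2 - p.2) ^ 2 = 0 := by nlinarith [sq_nonneg (q.1 - p.1), sq_nonneg (q.2 - p.2)]
    exact hpq (Prod.ext (sub_eq_zero.1 (pow_eq_zero_iff (two_ne_zero) |>.1 e1))
      (sub_eq_zero.1 (pow_eq_zero_iff (two_ne_zero) |>.1 e2))).symm
  intro x hx
  simp only [Set.mem_insert_iff, Set.mem_singleton_iff] at hx
  rcases hx with rfl | rfl | rfl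
  · exact ⟨0, by simp⟩
  · exact ⟨1, by simp⟩
  · refine ⟨((q.1 - p.1) * (x.1 - p.1) + (q.2 - p.2) * (x.2 - p.2)) /
      ((q.1 - p.1) ^ 2 + (q.2 - p.2) ^ 2), ?_⟩
    unfold ori at h0
    have hd' := hd.ne'
    apply Prod.ext
    · simp
      rw [← sub_eq_iff_eq_add, div_mul_eq_mul_div, eq_div_iff hd']
      linear_combination (-(q.2 - p.2)) * h0
    · simp
      rw [← sub_eq_iff_eq_add, div_mul_eq_mul_div, eq_div_iff hd']
      linear_combination (q.1 - p.1) * h0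

/-- The graph of an edge set. -/
def graphOf (R B : Finset Pt) (E : Finset (Pt × Pt)) (h : PT R (R ∪ B) E) :
    SimpleGraph {x : Pt // x ∈ R ∪ B} where
  Adj u v := adjE E u.1 v.1
  symm := ⟨fun u v huv => huv.symm⟩
  loopless := ⟨fun u hu => by
    rcases hu with hu | hu <;> exact (h.sub _ hu).2.2.2 (h.sub _ hu).2.1⟩

theorem graphOf_connected {R B : Finset Pt} {E : Finset (Pt × Pt)} (h : PT R (R ∪ B) E)
    (hne : (R ∪ B).Nonempty) : (graphOf R B E h).Connected := by
  obtain ⟨z, hz⟩ := hne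
  have : Nonempty {x : Pt // x ∈ R ∪ B} := ⟨⟨z, hz⟩⟩
  refine ⟨fun u v => ?_⟩
  have key : ∀ q, Relation.ReflTransGen (adjE E) u.1 q →
      ∀ hq : q ∈ R ∪ B, (graphOf R B E h).Reachable u ⟨q, hq⟩ := by
    intro q hq
    induction hq with
    | refl => intro _; exact SimpleGraph.Reachable.refl _
    | tail h1 h2 ih =>
      rename_i b c
      intro hc
      have hb : b ∈ R ∪ B := by
        rcases h2 with h2 | h2
        · exact (h.sub _ h2).1
        · exact (h.sub _ h2).2.2.1
      refine (ih hb).trans (SimpleGraph.Adj.reachable ?_)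
      exact h2
  exact key v.1 (h.conn _ u.2 _ v.2) v.2

theorem graphOf_isTree {R B : Finset Pt} {E : Finset (Pt × Pt)} (h : PT R (R ∪ B) E)
    (hne : (R ∪ B).Nonempty) : (graphOf R B E h).IsTree := by
  rw [SimpleGraph.isTree_iff_connected_and_card]
  refine ⟨graphOf_connected h hne, ?_⟩
  have e1 : Nat.card {x : Pt // x ∈ R ∪ B} = (R ∪ B).card := by
    rw [Nat.card_eq_fintype_card, Fintype.card_coe]
  have e2 : Nat.card (graphOf R B E h).edgeSet = Nat.card {e : Pt × Pt // e ∈ E} := by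
    symm
    refine Nat.card_eq_of_bijective (fun e => (⟨s(⟨e.1.1, (h.sub _ e.2).1⟩,
      ⟨e.1.2, (h.sub _ e.2).2.2.1⟩), Or.inl e.2⟩ : (graphOf R B E h).edgeSet)) ⟨?_, ?_⟩
    · intro e f hef
      have hef' := Sym2.eq_iff.1 (congrArg Subtype.val hef)
      simp only [Subtype.mk.injEq] at hef'
      rcases hef' with ⟨a, b⟩ | ⟨a, b⟩
      · exact Subtype.ext (Prod.ext a b)
      · exfalso
        have h1 := (h.sub _ e.2).2.1
        rw [a] at h1
        exact (h.sub _ f.2).2.2.2 h1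
    · rintro ⟨e, he⟩
      induction e using Sym2.ind with
      | _ u v =>
        rcases he with he | he
        · exact ⟨⟨(u.1, v.1), he⟩, rfl⟩
        · exact ⟨⟨(v.1, u.1), he⟩, Subtype.ext Sym2.eq_swap⟩
  rw [e1, e2, Nat.card_eq_fintype_card, Fintype.card_coe]
  exact h.card

theorem graphOf_deg {R B : Finset Pt} {E : Finset (Pt × Pt)} (h : PT R (R ∪ B) E)
    (v : {x : Pt // x ∈ R ∪ B}) : deg (graphOf R B E h) v ≤ dg E v.1 := by
  unfold deg dg
  rw [← Set.ncard_coe_finset]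
  refine Set.ncard_le_ncard_of_injOn
    (fun w => if v.1 ∈ R then (v.1, w.1) else (w.1, v.1)) ?_ ?_ (Finset.finite_toSet _)
  · intro w hw
    rcases hw with hw | hw
    · have := (h.sub _ hw).2.1
      simp only at this
      simp [this, hw]
    · have := (h.sub _ hw).2.2.2
      simp only at this
      simp [this, hw]
  · intro w _ w' _ hww
    by_cases hv : v.1 ∈ R
    · simp [hv] at hww
      exact hww
    · simp [hv] at hww
      exact hww

theorem sm_total {R B : Finset Pt} (hdisj : Disjoint R B) {k : ℕ} (hcard : R.card = k * B.card) :
    sm R k (R ∪ B) = 0 := by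
  unfold sm
  rw [Finset.sum_union hdisj]
  have e1 : ∑ p ∈ R, wt R k p = ∑ p ∈ R, (-1 : ℤ) := Finset.sum_congr rfl fun p hp => wt_red hp
  have e2 : ∑ p ∈ B, wt R k p = ∑ p ∈ B, (k : ℤ) := Finset.sum_congr rfl fun p hp =>
    wt_blue (Finset.disjoint_right.1 hdisj hp)
  rw [e1, e2]
  simp [hcard]
  ring

/-- If `|R| = k|B|` with `k ≥ 2`, `B` nonempty and `R ∪ B` in general
position, then there is a plane bichromatic tree on `R ∪ B` of maximum degree at most
`k + 1` in which moreover every red vertex has degree at most `3`. -/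
theorem statement_4 (R B : Finset Pt) (hdisj : Disjoint R B) (hB : B.Nonempty)
    (k : ℕ) (hk : 2 ≤ k) (hcard : R.card = k * B.card)
    (hgp : GenPos (↑(R ∪ B) : Set Pt)) :
    ∃ G : SimpleGraph {x : Pt // x ∈ R ∪ B},
      PlaneBichromTree R B G ∧ (∀ v, deg G v ≤ k + 1) ∧
      ∀ v : {x : Pt // x ∈ R ∪ B}, v.1 ∈ R → deg G v ≤ 3 := by
  have hne : (R ∪ B).Nonempty := hB.mono Finset.subset_union_right
  obtain ⟨E, hE, hd⟩ := top (R := R) hk (gp_of_genPos hgp) hne (sm_total hdisj hcard)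
  have hmemB : ∀ p, p ∈ R ∪ B → p ∉ R → p ∈ B := fun p hp hn => by
    rcases Finset.mem_union.1 hp with h | h
    · exact absurd h hn
    · exact h
  refine ⟨graphOf R B E hE, ⟨graphOf_isTree hE hne, ?_, ?_⟩, ?_, ?_⟩
  · rintro u v (h | h)
    · exact Or.inl ⟨(hE.sub _ h).2.1, hmemB _ v.2 (hE.sub _ h).2.2.2⟩
    · exact Or.inr ⟨hmemB _ u.2 (hE.sub _ h).2.2.2, (hE.sub _ h).2.1⟩
  · rintro u v x y (h1 | h1) (h2 | h2) hne p hp1 hp2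
    · exact hE.plane _ h1 _ h2 (fun h => hne (by
        rw [Prod.mk.injEq] at h
        rw [Subtype.ext h.1, Subtype.ext h.2])) p hp1 hp2
    · rw [segment_symm] at hp2
      have := hE.plane _ h1 _ h2 (fun h => hne (by
        rw [Prod.mk.injEq] at h
        rw [Subtype.ext h.1, Subtype.ext h.2, Sym2.eq_swap])) p hp1 hp2
      exact ⟨this.1, this.2.symm⟩
    · rw [segment_symm] at hp1
      have := hE.plane _ h1 _ h2 (fun h => hne (by
        rw [Prod.mk.injEq] at h
        rw [Subtype.ext h.1, Subtype.ext h.2, Sym2.eq_swap])) p hp1 hp2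
      exact ⟨this.1.symm, this.2⟩
    · rw [segment_symm] at hp1 hp2
      have := hE.plane _ h1 _ h2 (fun h => hne (by
        rw [Prod.mk.injEq] at h
        rw [Subtype.ext h.1, Subtype.ext h.2])) p hp1 hp2
      exact ⟨this.1.symm, this.2.symm⟩
  · intro v
    refine (graphOf_deg hE v).trans ((hd v.1 v.2).trans ?_)
    unfold cap
    split_ifs <;> omega
  · intro v hv
    refine (graphOf_deg hE v).trans ((hd v.1 v.2).trans ?_)
    rw [cap_red hv]
end
end

section
/- Let R and B be two disjoint finite sets of points in the plane with |B| ≤ |R| and R ∪ B in general position, and let k = ⌈|R|/|B|⌉. If k ≥ 2, then there exists a plane bichromatic tree on R ∪ B whose maximum vertex degree is at most k + 1. (This is Kaneko's Conjecture 2.) -/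
open scoped Classical

noncomputable section

/-- Orientation determinant. -/
def DD (a b c : Pt) : ℝ := (b.1 - a.1) * (c.2 - a.2) - (b.2 - a.2) * (c.1 - a.1)

/-- Affine functions on the plane. -/
def Aff (f : Pt → ℝ) : Prop := ∃ a b c : ℝ, ∀ x : Pt, f x = a * x.1 + b * x.2 + c

lemma aff_DD (s : ℝ) (a b : Pt) : Aff (fun x => s * DD a b x) :=
  ⟨- s * (b.2 - a.2), s * (b.1 - a.1), s * ((b.2 - a.2) * a.1 - (b.1 - a.1) * a.2),
    fun x => by simp only [DD]; ring⟩

lemma Aff.neg {f : Pt → ℝ} (h : Aff f) : Aff (fun x => - f x) := by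
  obtain ⟨a, b, c, h⟩ := h
  exact ⟨-a, -b, -c, fun x => by simp only [h]; ring⟩

lemma Aff.comb {f g : Pt → ℝ} (hf : Aff f) (hg : Aff g) (s t : ℝ) :
    Aff (fun x => s * f x + t * g x) := by
  obtain ⟨a, b, c, h⟩ := hf
  obtain ⟨a', b', c', h'⟩ := hg
  exact ⟨s * a + t * a', s * b + t * b', s * c + t * c', fun x => by simp only [h, h']; ring⟩

lemma Aff.seg {f : Pt → ℝ} (h : Aff f) {u v p : Pt} {s t : ℝ} (hst : s + t = 1)
    (hp : s • u + t • v = p) : f p = s * f u + t * f v := by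
  obtain ⟨a, b, c, h⟩ := h
  subst hp
  rw [h, h, h]
  simp only [Prod.fst_add, Prod.snd_add, Prod.smul_fst, Prod.smul_snd, smul_eq_mul]
  linear_combination (-c) * hst

/-- Three-term identity. -/
lemma Aff.three {f : Pt → ℝ} (h : Aff f) (c x y z : Pt) :
    (f x - f c) * DD c y z + (f y - f c) * DD c z x + (f z - f c) * DD c x y = 0 := by
  obtain ⟨a, b, e, h⟩ := h
  simp only [h, DD]; ring

/-- Ambient data of the proof. -/
structure Ctx where
  R : Finset Pt
  B : Finset Pt
  w : Pt → ℕ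
  k : ℕ
  disj : Disjoint R B
  gp : ∀ a ∈ R ∪ B, ∀ b ∈ R ∪ B, ∀ c ∈ R ∪ B, a ≠ b → a ≠ c → b ≠ c → DD a b c ≠ 0
  w1 : ∀ b, 1 ≤ w b
  wk : ∀ b, w b ≤ k
  k2 : 2 ≤ k

namespace Ctx
variable (C : Ctx)

/-- All points. -/
def S : Finset Pt := C.R ∪ C.B

/-- Values of points. -/
def val (x : Pt) : ℤ := if x ∈ C.R then -1 else (C.w x : ℤ)

/-- Degree caps. -/
def cap (x : Pt) : ℕ := if x ∈ C.R then 3 else C.k + 1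

/-- `G` is a plane bichromatic tree on `V`. -/
structure IsT (V : Finset Pt) (G : SimpleGraph Pt) : Prop where
  mem : ∀ u v, G.Adj u v → u ∈ V
  bic : ∀ u v, G.Adj u v → ((u ∈ C.R ∧ v ∈ C.B) ∨ (u ∈ C.B ∧ v ∈ C.R))
  conn : ∀ u ∈ V, ∀ v ∈ V, G.Reachable u v
  cnt : G.edgeSet.ncard + 1 = V.card
  pl : ∀ u v x y, G.Adj u v → G.Adj x y → s(u, v) ≠ s(x, y) →
      ∀ p : Pt, p ∈ segment ℝ u v → p ∈ segment ℝ x y →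
        (p = u ∨ p = v) ∧ (p = x ∨ p = y)

/-- There is a plane bichromatic tree on `V` with degrees bounded by `g`. -/
def Tr (V : Finset Pt) (g : Pt → ℕ) : Prop :=
  ∃ G, C.IsT V G ∧ ∀ x ∈ V, (G.neighborSet x).ncard ≤ g x

variable {C}

lemma IsT.fin {V : Finset Pt} {G : SimpleGraph Pt} (h : C.IsT V G) : G.edgeSet.Finite := by
  apply Set.Finite.subset ((V ×ˢ V).image (fun p : Pt × Pt => s(p.1, p.2))).finite_toSet
  intro e
  induction e using Sym2.ind with
  | _ u v =>
    intro he
    rw [SimpleGraph.mem_edgeSet] at he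
    simp only [Finset.coe_image, Set.mem_image]
    exact ⟨(u, v), by simp [h.mem u v he, h.mem v u he.symm], rfl⟩

lemma IsT.nfin {V : Finset Pt} {G : SimpleGraph Pt} (h : C.IsT V G) (x : Pt) :
    (G.neighborSet x).Finite :=
  Set.Finite.subset V.finite_toSet (fun y hy => h.mem y x hy.symm)

lemma Tr.mono {V : Finset Pt} {g g' : Pt → ℕ} (h : C.Tr V g) (hg : ∀ x ∈ V, g x ≤ g' x) :
    C.Tr V g' := by
  obtain ⟨G, h1, h2⟩ := h
  exact ⟨G, h1, fun x hx => (h2 x hx).trans (hg x hx)⟩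

lemma tr_single (c : Pt) (g : Pt → ℕ) : C.Tr {c} g := by
  refine ⟨⊥, ⟨by simp, by simp, ?_, by simp, by simp⟩, ?_⟩
  · intro u hu v hv
    simp only [Finset.mem_singleton] at hu hv
    subst hu; subst hv; exact SimpleGraph.Reachable.refl _
  · intro x hx
    have : (⊥ : SimpleGraph Pt).neighborSet x = ∅ := by ext; simp
    rw [this]; simp

lemma tr_edge {a b : Pt} (hab : (a ∈ C.R ∧ b ∈ C.B) ∨ (a ∈ C.B ∧ b ∈ C.R)) (g : Pt → ℕ)
    (ha : 1 ≤ g a) (hb : 1 ≤ g b) : C.Tr {a, b} g := by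
  have hne : a ≠ b := by
    rintro rfl
    have := Finset.disjoint_left.1 C.disj
    rcases hab with h | h
    · exact this h.1 h.2
    · exact this h.2 h.1
  have hadj : ∀ u v, (SimpleGraph.edge a b).Adj u v ↔ (u = a ∧ v = b) ∨ (u = b ∧ v = a) := by
    intro u v
    rw [SimpleGraph.edge_adj]
    constructor
    · rintro ⟨h | h, -⟩
      · left; exact h
      · right; exact h
    · rintro (⟨rfl, rfl⟩ | ⟨rfl, rfl⟩)
      · simp [hne]
      · simp [hne.symm]
  refine ⟨SimpleGraph.edge a b, ⟨?_, ?_, ?_, ?_, ?_⟩, ?_⟩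
  · intro u v h
    rw [hadj] at h
    simp; tauto
  · intro u v h
    rw [hadj] at h
    rcases h with ⟨rfl, rfl⟩ | ⟨rfl, rfl⟩ <;> tauto
  · have h1 : (SimpleGraph.edge a b).Reachable a b :=
      SimpleGraph.Adj.reachable ((hadj a b).2 (Or.inl ⟨rfl, rfl⟩))
    intro u hu v hv
    simp only [Finset.mem_insert, Finset.mem_singleton] at hu hv
    rcases hu with rfl | rfl <;> rcases hv with rfl | rfl
    · exact SimpleGraph.Reachable.refl _
    · exact h1
    · exact h1.symm
    · exact SimpleGraph.Reachable.refl _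
  · rw [SimpleGraph.edgeSet_edge_of_ne hne]
    simp [hne]
  · intro u v x y h h' hs
    rw [hadj] at h h'
    exfalso; apply hs
    rcases h with ⟨rfl, rfl⟩ | ⟨rfl, rfl⟩ <;> rcases h' with ⟨rfl, rfl⟩ | ⟨rfl, rfl⟩ <;>
      simp [Sym2.eq_swap]
  · intro x hx
    simp only [Finset.mem_insert, Finset.mem_singleton] at hx
    rcases hx with rfl | rfl
    · refine le_trans (Set.ncard_le_ncard (t := {b}) ?_ (Set.finite_singleton _)) (by simpa using ha)
      intro y hy
      have := (hadj _ _).1 hy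
      simp; tauto
    · refine le_trans (Set.ncard_le_ncard (t := {a}) ?_ (Set.finite_singleton _)) (by simpa using hb)
      intro y hy
      have := (hadj _ _).1 hy
      simp; tauto

/-- Gluing two plane trees at a common vertex. -/
lemma glue {V1 V2 : Finset Pt} {g1 g2 g : Pt → ℕ} (c : Pt) (f : Pt → ℝ) (hf : Aff f)
    (hS : V1 ⊆ C.S) (h1 : C.Tr V1 g1) (h2 : C.Tr V2 g2) (c1 : c ∈ V1) (c2 : c ∈ V2)
    (f1 : ∀ x ∈ V1, f c ≤ f x) (f2 : ∀ x ∈ V2, x ≠ c → f x < f c)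
    (hg1 : ∀ x ∈ V1, x ≠ c → g1 x ≤ g x) (hg2 : ∀ x ∈ V2, x ≠ c → g2 x ≤ g x)
    (hc : g1 c + g2 c ≤ g c) : C.Tr (V1 ∪ V2) g := by
  obtain ⟨G1, t1, d1⟩ := h1
  obtain ⟨G2, t2, d2⟩ := h2
  have hinter : ∀ x, x ∈ V1 → x ∈ V2 → x = c := by
    intro x hx1 hx2
    by_contra hne
    exact absurd (f1 x hx1) (not_le.2 (f2 x hx2 hne))
  have hIs : V1 ∩ V2 = {c} := by
    ext x; simp only [Finset.mem_inter, Finset.mem_singleton]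
    exact ⟨fun h => hinter x h.1 h.2, fun h => by subst h; exact ⟨c1, c2⟩⟩
  -- crossing statement
  have key0 : ∀ u v y, G1.Adj u v → y ∈ V2 → y ≠ c → ∀ p : Pt, p ∈ segment ℝ u v →
      p ∈ segment ℝ c y → (p = u ∨ p = v) ∧ p = c := by
    intro u v y huv hy hyc p hp1 hp2
    obtain ⟨a, b, ha, hb, hab, hp⟩ := hp1
    obtain ⟨a', b', ha', hb', hab', hp'⟩ := hp2
    have e1 := hf.seg hab hp
    have e2 := hf.seg hab' hp'
    have hu := f1 u (t1.mem _ _ huv)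
    have hv := f1 v (t1.mem _ _ huv.symm)
    have hy' := f2 y hy hyc
    have hfp : f c ≤ f p := by
      obtain rfl : b = 1 - a := by linarith
      rw [e1]; nlinarith
    have hb0 : b' = 0 := by
      by_contra hne
      have : 0 < b' := lt_of_le_of_ne hb' (Ne.symm hne)
      have : f p < f c := by
        obtain rfl : a' = 1 - b' := by linarith
        rw [e2]; nlinarith
      linarith
    have ha1 : a' = 1 := by linarith
    have hpc : p = c := by rw [← hp', hb0, ha1]; simp
    refine ⟨?_, hpc⟩
    by_contra hcon
    push Not at hcon
    rw [hpc] at hcon hp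
    refine C.gp c (hS c1) u (hS (t1.mem _ _ huv)) v (hS (t1.mem _ _ huv.symm)) hcon.1 hcon.2
      huv.ne ?_
    have q1 : c.1 = a * u.1 + b * v.1 := by rw [← hp]; simp
    have q2 : c.2 = a * u.2 + b * v.2 := by rw [← hp]; simp
    have hb1 : b = 1 - a := by linarith
    simp only [DD]
    rw [q1, q2, hb1]; ring
  have key : ∀ u v x y, G1.Adj u v → G2.Adj x y → ∀ p : Pt, p ∈ segment ℝ u v →
      p ∈ segment ℝ x y → (p = u ∨ p = v) ∧ (p = x ∨ p = y) := by
    intro u v x y huv hxy p hp1 hp2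
    have mx := t2.mem _ _ hxy
    have my := t2.mem _ _ hxy.symm
    by_cases hx : x = c
    · subst hx
      have := key0 u v y huv my hxy.ne' p hp1 hp2
      exact ⟨this.1, Or.inl this.2⟩
    by_cases hy : y = c
    · subst hy
      rw [segment_symm] at hp2
      have := key0 u v x huv mx hxy.ne p hp1 hp2
      exact ⟨this.1, Or.inr this.2⟩
    exfalso
    obtain ⟨a, b, ha, hb, hab, hp⟩ := hp1
    obtain ⟨a', b', ha', hb', hab', hp'⟩ := hp2
    have e1 := hf.seg hab hp
    have e2 := hf.seg hab' hp'
    have hu := f1 u (t1.mem _ _ huv)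
    have hv := f1 v (t1.mem _ _ huv.symm)
    have hy' := f2 y my hy
    have hx' := f2 x mx hx
    have hfp : f c ≤ f p := by
      obtain rfl : b = 1 - a := by linarith
      rw [e1]; nlinarith
    have hfp' : f p < f c := by
      rw [e2]
      rcases eq_or_lt_of_le ha' with h | h
      · have : b' = 1 := by linarith
        rw [← h, this]; linarith
      · obtain rfl : b' = 1 - a' := by linarith
        nlinarith
    linarith
  refine ⟨G1 ⊔ G2, ⟨?_, ?_, ?_, ?_, ?_⟩, ?_⟩
  · rintro u v (h | h)
    · exact Finset.mem_union_left _ (t1.mem _ _ h)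
    · exact Finset.mem_union_right _ (t2.mem _ _ h)
  · rintro u v (h | h)
    · exact t1.bic _ _ h
    · exact t2.bic _ _ h
  · have hr : ∀ u ∈ V1 ∪ V2, (G1 ⊔ G2).Reachable u c := by
      intro u hu
      rcases Finset.mem_union.1 hu with h | h
      · exact (t1.conn u h c c1).mono le_sup_left
      · exact (t2.conn u h c c2).mono le_sup_right
    intro u hu v hv
    exact (hr u hu).trans (hr v hv).symm
  · rw [SimpleGraph.edgeSet_sup, Set.ncard_union_eq ?_ t1.fin t2.fin]
    · have := Finset.card_union_add_card_inter V1 V2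
      rw [hIs, Finset.card_singleton] at this
      have := t1.cnt
      have := t2.cnt
      omega
    · rw [Set.disjoint_left]
      intro e
      induction e using Sym2.ind with
      | _ u v =>
        intro he1 he2
        rw [SimpleGraph.mem_edgeSet] at he1 he2
        have e1 := hinter u (t1.mem _ _ he1) (t2.mem _ _ he2)
        have e2 := hinter v (t1.mem _ _ he1.symm) (t2.mem _ _ he2.symm)
        exact he1.ne (e1.trans e2.symm)
  · rintro u v x y (h | h) (h' | h') hs p hp hp'
    · exact t1.pl u v x y h h' hs p hp hp'
    · exact key u v x y h h' p hp hp'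
    · exact (key x y u v h' h p hp' hp).symm
    · exact t2.pl u v x y h h' hs p hp hp'
  · have hz1 : ∀ x, x ∉ V1 → G1.neighborSet x = ∅ := by
      intro x hx; ext y; simp only [SimpleGraph.mem_neighborSet, Set.mem_empty_iff_false, iff_false]
      exact fun h => hx (t1.mem _ _ h)
    have hz2 : ∀ x, x ∉ V2 → G2.neighborSet x = ∅ := by
      intro x hx; ext y; simp only [SimpleGraph.mem_neighborSet, Set.mem_empty_iff_false, iff_false]
      exact fun h => hx (t2.mem _ _ h)
    have hn : ∀ x, (G1 ⊔ G2).neighborSet x = G1.neighborSet x ∪ G2.neighborSet x := by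
      intro x; ext y; simp
    intro x hx
    rw [hn]
    by_cases hxc : x = c
    · subst hxc
      exact (Set.ncard_union_le _ _).trans ((add_le_add (d1 x c1) (d2 x c2)).trans hc)
    · rcases Finset.mem_union.1 hx with h | h
      · rw [hz2 x (fun h' => hxc (hinter x h h')), Set.union_empty]
        exact (d1 x h).trans (hg1 x h hxc)
      · rw [hz1 x (fun h' => hxc (hinter x h' h)), Set.empty_union]
        exact (d2 x h).trans (hg2 x h hxc)

end Ctx


lemma DD_rot (a b c : Pt) : DD a b c = DD b c a := by simp only [DD]; ring
lemma DD_swap (a b c : Pt) : DD a b c = - DD a c b := by simp only [DD]; ring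
lemma DD_swap' (a b c : Pt) : DD a b c = - DD b a c := by simp only [DD]; ring
lemma DD_self (a b : Pt) : DD a b b = 0 := by simp only [DD]; ring
lemma DD_self' (a b : Pt) : DD a a b = 0 := by simp only [DD]; ring
lemma DD_self'' (a b : Pt) : DD a b a = 0 := by simp only [DD]; ring

/-- `l` is sorted by angle around `c`. -/
def Srt (s : ℝ) (c : Pt) (l : List Pt) : Prop := l.Pairwise (fun x y => 0 < s * DD c x y)

lemma Srt.nodup {s : ℝ} {c : Pt} {l : List Pt} (h : Srt s c l) : l.Nodup := by
  refine List.Pairwise.imp ?_ h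
  rintro x y h rfl
  rw [DD_self] at h
  simp at h

lemma Srt.reverse {s : ℝ} {c : Pt} {l : List Pt} (h : Srt s c l) : Srt (-s) c l.reverse := by
  unfold Srt
  rw [List.pairwise_reverse]
  refine List.Pairwise.imp ?_ h
  intro x y h
  rw [DD_swap]
  linarith

lemma srt_trans {f : Pt → ℝ} (hf : Aff f) {s : ℝ} {c x y z : Pt} (hx : f c < f x) (hy : f c < f y)
    (hz : f c < f z) (h1 : 0 < s * DD c x y) (h2 : 0 < s * DD c y z) : 0 < s * DD c x z := by
  have h := hf.three c x y z
  have e : (f y - f c) * (s * DD c x z) =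
      (f x - f c) * (s * DD c y z) + (f z - f c) * (s * DD c x y) := by
    rw [DD_swap c x z]
    linear_combination -s * h
  have p1 : 0 < (f x - f c) * (s * DD c y z) := mul_pos (by linarith) h2
  have p2 : 0 < (f z - f c) * (s * DD c x y) := mul_pos (by linarith) h1
  have : 0 < (f y - f c) * (s * DD c x z) := by rw [e]; linarith
  exact pos_of_mul_pos_right this (by linarith)

lemma sort_lemma {f : Pt → ℝ} (hf : Aff f) {s : ℝ} (hs : s ≠ 0) (c : Pt) (X : Finset Pt)
    (hX : ∀ x ∈ X, f c < f x) (hD : ∀ x ∈ X, ∀ y ∈ X, x ≠ y → DD c x y ≠ 0) :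
    ∃ l : List Pt, l.toFinset = X ∧ Srt s c l := by
  induction X using Finset.induction_on with
  | empty => exact ⟨[], by simp, by simp [Srt]⟩
  | insert x X hx ih =>
    obtain ⟨l, hl, hp⟩ := ih (fun y hy => hX y (Finset.mem_insert_of_mem hy))
      (fun y hy z hz => hD y (Finset.mem_insert_of_mem hy) z (Finset.mem_insert_of_mem hz))
    have hm : ∀ y, y ∈ l ↔ y ∈ X := by intro y; rw [← hl]; simp
    have hne : ∀ y ∈ l, 0 < s * DD c y x ∨ 0 < s * DD c x y := by
      intro y hy
      have h1 : DD c y x ≠ 0 := by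
        refine hD y (Finset.mem_insert_of_mem ((hm y).1 hy)) x (Finset.mem_insert_self _ _) ?_
        rintro rfl
        exact hx ((hm _).1 hy)
      rw [DD_swap c x y]
      rcases lt_or_gt_of_ne (mul_ne_zero hs h1) with h | h
      · right; linarith
      · left; exact h
    have hfx := hX x (Finset.mem_insert_self _ _)
    have hfl : ∀ y ∈ l, f c < f y := fun y hy => hX y (Finset.mem_insert_of_mem ((hm y).1 hy))
    refine ⟨l.filter (fun y => 0 < s * DD c y x) ++ x :: l.filter (fun y => 0 < s * DD c x y),
      ?_, ?_⟩
    · ext y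
      simp only [List.mem_toFinset, List.mem_append, List.mem_filter, List.mem_cons,
        decide_eq_true_eq, Finset.mem_insert, ← hm]
      constructor
      · tauto
      · rintro (h | h)
        · tauto
        · have := hne y h
          tauto
    · unfold Srt
      rw [List.pairwise_append, List.pairwise_cons]
      refine ⟨hp.filter _, ⟨?_, hp.filter _⟩, ?_⟩
      · intro y hy
        simpa using (List.mem_filter.1 hy).2
      · intro y hy z hz
        have hy1 := (List.mem_filter.1 hy).1
        have hy2 : 0 < s * DD c y x := by simpa using (List.mem_filter.1 hy).2
        rcases List.mem_cons.1 hz with rfl | hz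
        · exact hy2
        · have hz1 := (List.mem_filter.1 hz).1
          have hz2 : 0 < s * DD c x z := by simpa using (List.mem_filter.1 hz).2
          exact srt_trans hf (hfl y hy1) hfx (hfl z hz1) hy2 hz2

namespace Ctx
variable (C : Ctx)

/-- sum over a list -/
def ls (l : List Pt) : ℤ := (l.map C.val).sum

/-- sum over a finset -/
def phi (W : Finset Pt) : ℤ := ∑ x ∈ W, C.val x

/-- half plane condition -/
def HH (c : Pt) (W : Finset Pt) : Prop := ∃ f, Aff f ∧ ∀ x ∈ W, f c < f x

lemma _root_.HH_mono {c : Pt} {W W' : Finset Pt} (h : HH c W) (hs : W' ⊆ W) : HH c W' := by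
  obtain ⟨f, hf, h⟩ := h
  exact ⟨f, hf, fun x hx => h x (hs hx)⟩

variable {C}

@[simp] lemma ls_nil : C.ls [] = 0 := rfl
@[simp] lemma ls_cons (x : Pt) (l : List Pt) : C.ls (x :: l) = C.val x + C.ls l := by simp [ls]
@[simp] lemma ls_append (l l' : List Pt) : C.ls (l ++ l') = C.ls l + C.ls l' := by simp [ls]
@[simp] lemma ls_reverse (l : List Pt) : C.ls l.reverse = C.ls l := by
  induction l with
  | nil => rfl
  | cons x l ih => simp [ih]; ring

lemma phi_toFinset {l : List Pt} (h : l.Nodup) : C.phi l.toFinset = C.ls l := by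
  unfold phi ls
  exact List.sum_toFinset _ h

lemma phi_erase {W : Finset Pt} {x : Pt} (h : x ∈ W) : C.phi (W.erase x) = C.phi W - C.val x := by
  have := Finset.add_sum_erase W C.val h
  unfold phi
  linarith

lemma val_R {x : Pt} (h : x ∈ C.R) : C.val x = -1 := by simp [val, h]
lemma not_R {x : Pt} (h : x ∈ C.B) : x ∉ C.R := fun h' => Finset.disjoint_left.1 C.disj h' h
lemma not_B {x : Pt} (h : x ∈ C.R) : x ∉ C.B := fun h' => Finset.disjoint_left.1 C.disj h h'
lemma val_B {x : Pt} (h : x ∈ C.B) : C.val x = C.w x := by simp [val, not_R h]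
lemma cap_R {x : Pt} (h : x ∈ C.R) : C.cap x = 3 := by simp [cap, h]
lemma cap_B {x : Pt} (h : x ∈ C.B) : C.cap x = C.k + 1 := by simp [cap, not_R h]
lemma mem_S {x : Pt} : x ∈ C.S ↔ x ∈ C.R ∨ x ∈ C.B := by simp [S]
lemma S_R {x : Pt} (h : x ∈ C.R) : x ∈ C.S := mem_S.2 (Or.inl h)
lemma S_B {x : Pt} (h : x ∈ C.B) : x ∈ C.S := mem_S.2 (Or.inr h)
lemma val_ge (x : Pt) : -1 ≤ C.val x := by
  unfold val; split_ifs <;> omega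
lemma B_of_val {x : Pt} (hx : x ∈ C.S) (h : 0 ≤ C.val x) : x ∈ C.B := by
  rcases mem_S.1 hx with h' | h'
  · rw [val_R h'] at h; omega
  · exact h'

lemma sort_HH {c : Pt} {X : Finset Pt} (hc : c ∈ C.S) (hX : X ⊆ C.S) (h : HH c X) {s : ℝ}
    (hs : s ≠ 0) : ∃ l : List Pt, l.toFinset = X ∧ Srt s c l := by
  obtain ⟨f, hf, h⟩ := h
  refine sort_lemma hf hs c X h ?_
  have : ∀ x ∈ X, c ≠ x := by rintro x hx rfl; exact lt_irrefl _ (h _ hx)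
  intro x hx y hy hxy
  exact C.gp c hc x (hX hx) y (hX hy) (this x hx) (this y hy) hxy

lemma _root_.HH_of_DD {a c : Pt} {X : Finset Pt} {s : ℝ} (h : ∀ x ∈ X, 0 < s * DD a c x) :
    HH a X ∧ HH c X := by
  constructor
  · refine ⟨_, aff_DD s a c, fun x hx => ?_⟩
    have := h x hx
    simp only [DD_self'']; linarith
  · refine ⟨_, aff_DD s a c, fun x hx => ?_⟩
    have := h x hx
    simp only [DD_self]; linarith

/-- Sort around `a` starting with `c`. -/
lemma sort_from {a c : Pt} {X : Finset Pt} (ha : a ∈ C.S) (hX : X ⊆ C.S) {s : ℝ}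
    (h : ∀ x ∈ X, 0 < s * DD a c x) (hs : s ≠ 0) :
    ∃ l : List Pt, l.toFinset = X ∧ Srt s a (c :: l) := by
  obtain ⟨l, hl, hp⟩ := sort_HH ha hX (HH_of_DD h).1 hs
  refine ⟨l, hl, ?_⟩
  unfold Srt
  rw [List.pairwise_cons]
  refine ⟨fun x hx => h x ?_, hp⟩
  rw [← hl]; simpa using hx

lemma walk1 (l : List Pt) (s : ℤ) (h0 : 0 ≤ s) (h : s + C.ls l ≤ -1) :
    ∃ l1 l2, l = l1 ++ l2 ∧ s + C.ls l1 = -1 ∧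
      ∀ a b, l1 = a ++ b → b ≠ [] → 0 ≤ s + C.ls a := by
  induction l generalizing s with
  | nil => simp at h; omega
  | cons x t ih =>
    rw [ls_cons] at h
    have hv := C.val_ge x
    by_cases hx : s + C.val x = -1
    · refine ⟨[x], t, rfl, by simpa using hx, ?_⟩
      intro a b hab hb
      have : a = [] := by
        cases a with
        | nil => rfl
        | cons y a => simp at hab; exact absurd hab.2.2 hb
      subst this; simpa using h0
    · obtain ⟨l1, l2, h1, h2, h3⟩ := ih (s + C.val x) (by omega) (by omega)
      refine ⟨x :: l1, l2, by simp [h1], by rw [ls_cons]; omega, ?_⟩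
      intro a b hab hb
      cases a with
      | nil => simpa using h0
      | cons y a =>
        simp only [List.cons_append, List.cons.injEq] at hab
        have := h3 a b hab.2 hb
        rw [ls_cons, ← hab.1]; omega

lemma walk2 (l : List Pt) (s : ℤ) (h0 : s ≤ 0) (h : 1 ≤ s + C.ls l) :
    ∃ L g Rt, l = L ++ g :: Rt ∧ 1 ≤ s + C.ls L + C.val g ∧
      ∀ a b, L = a ++ b → s + C.ls a ≤ 0 := by
  induction l generalizing s with
  | nil => simp at h; omega
  | cons x t ih =>
    rw [ls_cons] at h
    by_cases hx : 1 ≤ s + C.val x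
    · refine ⟨[], x, t, rfl, by simpa using hx, ?_⟩
      intro a b hab
      have : a = [] := by simp at hab; exact hab.1
      subst this; simpa using h0
    · obtain ⟨L, g, Rt, h1, h2, h3⟩ := ih (s + C.val x) (by omega) (by omega)
      refine ⟨x :: L, g, Rt, by simp [h1], by rw [ls_cons]; omega, ?_⟩
      intro a b hab
      cases a with
      | nil => simpa using h0
      | cons y a =>
        simp only [List.cons_append, List.cons.injEq] at hab
        have := h3 a b hab.2
        rw [ls_cons, ← hab.1]; omega

/-- Separation of consecutive pieces of a sorted list. -/
lemma split_fun {s : ℝ} {a : Pt} {L T : List Pt} (h : Srt s a (L ++ T)) (hL : L ≠ []) :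
    ∃ f, Aff f ∧ f a = 0 ∧ (∀ x ∈ L, 0 ≤ f x) ∧ ∀ x ∈ T, f x < 0 := by
  obtain ⟨L', y, rfl⟩ : ∃ L' y, L = L' ++ [y] := by
    rcases List.eq_nil_or_concat L with h | ⟨L', y, h⟩
    · exact absurd h hL
    · exact ⟨L', y, by simpa using h⟩
  unfold Srt at h
  rw [List.pairwise_append, List.pairwise_append] at h
  refine ⟨_, aff_DD (-s) a y, by rw [DD_self'']; simp, ?_, ?_⟩
  · intro x hx
    rcases List.mem_append.1 hx with hx | hx
    · have := h.1.2.2 x hx y (by simp)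
      rw [DD_swap] at this
      linarith
    · simp at hx; subst hx; rw [DD_self]; simp
  · intro x hx
    have := h.2.2 y (by simp) x hx
    linarith

variable (C)

/-- Statement B. -/
def PB (n : ℕ) : Prop := ∀ (W : Finset Pt) (c : Pt) (m : ℕ), W.card < n → W ⊆ C.S → c ∈ C.B →
  HH c W → C.phi W ≤ 0 → 1 ≤ m → - C.phi W ≤ m →
  C.Tr (insert c W) (Function.update C.cap c m)

/-- Statement R2. -/
def PR (n : ℕ) : Prop := ∀ (U : Finset Pt) (p : Pt), U.card < n → U ⊆ C.S → p ∈ C.R →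
  HH p U → 0 ≤ C.phi U → C.phi U ≤ 1 →
  C.Tr (insert p U) (Function.update C.cap p 2)

/-- Statement QQ. -/
def PQ (n : ℕ) : Prop := ∀ (l : List Pt) (v o : Pt) (s : ℝ), l.length < n →
  (∀ x ∈ l, x ∈ C.S) → v ∈ C.B → o ∈ C.B → s ≠ 0 → Srt s v (o :: l) → C.ls l = -1 →
  (∀ a b, l = a ++ b → b ≠ [] → 0 ≤ C.ls a) →
  C.Tr (insert v (insert o l.toFinset)) (Function.update (Function.update C.cap v 1) o 1)

end Ctx

set_option linter.unusedSimpArgs false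

namespace Ctx
variable {C : Ctx}

lemma R1 {n : ℕ} (hB : C.PB n) {U : Finset Pt} {p d : Pt} (s : ℝ) (hn : U.card < n + 1)
    (hU : U ⊆ C.S) (hp : p ∈ C.R) (hdU : d ∈ U) (hd : d ∈ C.B)
    (hs : ∀ x ∈ U, x ≠ d → 0 < s * DD p d x) (h0 : 0 ≤ C.phi U) (h1 : C.phi U ≤ 1) :
    C.Tr (insert p U) (Function.update C.cap p 1) := by
  have hpd : p ≠ d := by rintro rfl; exact not_R hd hp
  have hw1 := C.w1 d
  have hwk := C.wk d
  have hpU : p ∉ U := by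
    intro h
    have := hs p h hpd
    rw [DD_self''] at this
    simp at this
  have hs' : ∀ x ∈ U.erase d, 0 < s * DD p d x := fun x hx =>
    hs x (Finset.mem_of_mem_erase hx) (Finset.ne_of_mem_erase hx)
  have he := C.phi_erase hdU
  rw [val_B hd] at he
  have hc := Finset.card_erase_add_one hdU
  have t2 := hB (U.erase d) d (C.w d) (by omega) ((Finset.erase_subset _ _).trans hU) hd
    (HH_of_DD hs').2 (by omega) hw1 (by omega)
  have t1 : C.Tr {p, d} (fun _ => 1) := tr_edge (Or.inl ⟨hp, hd⟩) _ le_rfl le_rfl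
  have t := glue (g := Function.update C.cap p 1) d _ (aff_DD (-s) p d) ?_ t1 t2 (by simp) (by simp)
    ?_ ?_ ?_ ?_ ?_
  · convert t using 1
    rw [Finset.insert_erase hdU]
    ext x
    simp only [Finset.mem_insert, Finset.mem_union, Finset.mem_singleton]
    constructor
    · tauto
    · rintro ((h | rfl) | h) <;> tauto
  · intro x hx
    simp only [Finset.mem_insert, Finset.mem_singleton] at hx
    rcases hx with rfl | rfl
    · exact S_R hp
    · exact S_B hd
  · intro x hx
    simp only [Finset.mem_insert, Finset.mem_singleton] at hx
    rcases hx with rfl | rfl <;> simp [DD_self, DD_self'']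
  · intro x hx hxd
    rw [Finset.insert_erase hdU] at hx
    have := hs x hx hxd
    rw [DD_self]; linarith
  · intro x hx hxd
    simp only [Finset.mem_insert, Finset.mem_singleton] at hx
    rcases hx with rfl | rfl
    · simp
    · exact absurd rfl hxd
  · intro x hx hxd
    rw [Finset.insert_erase hdU] at hx
    have : x ≠ p := by rintro rfl; exact hpU hx
    simp [Function.update_apply, hxd, this]
  · simp [Function.update_apply, hpd.symm, cap_B hd]; omega

lemma stepR {n : ℕ} (hB : C.PB n) : C.PR (n + 1) := by
  intro U p hn hU hp hH h0 h1
  have hpS : p ∈ C.S := S_R hp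
  have hpU : p ∉ U := by
    intro h
    obtain ⟨f, _, hf⟩ := hH
    exact lt_irrefl _ (hf p h)
  obtain ⟨l, hl, hs⟩ := sort_HH hpS hU hH (one_ne_zero)
  have hm : ∀ x, x ∈ l ↔ x ∈ U := by intro x; rw [← hl]; simp
  have hphi : C.phi U = C.ls l := by rw [← hl, phi_toFinset hs.nodup]
  rcases List.eq_nil_or_concat l with rfl | ⟨l0, y, hly⟩
  · simp at hl; subst hl
    simpa using tr_single p _
  rw [List.concat_eq_append] at hly
  have hyU : y ∈ U := by rw [← hm, hly]; simp
  by_cases hy : y ∈ C.B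
  · refine (R1 hB (-1) hn hU hp hyU hy ?_ h0 h1).mono ?_
    · intro x hx hxy
      rw [← hm, hly] at hx
      have hx : x ∈ l0 := by simpa [hxy] using hx
      rw [hly] at hs
      have := (List.pairwise_append.1 hs).2.2 x hx y (by simp)
      rw [DD_swap] at this; linarith
    · intro x hx
      simp only [Function.update_apply]; split_ifs <;> simp
  have hyR : y ∈ C.R := by
    have := mem_S.1 (hU hyU); tauto
  have hlsum : C.ls l = C.ls l0 - 1 := by rw [hly]; simp [val_R hyR]; ring
  obtain ⟨L, g, Rt0, hl0, hg, hpre⟩ := C.walk2 l0 0 le_rfl (by omega)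
  have hL0 := hpre L [] (by simp)
  simp only [zero_add] at hg hL0 hpre
  have hll : l = L ++ g :: (Rt0 ++ [y]) := by rw [hly, hl0]; simp
  have hgU : g ∈ U := by rw [← hm, hll]; simp
  have hgB : g ∈ C.B := B_of_val (hU hgU) (by omega)
  have hw1 := C.w1 g
  have hwk := C.wk g
  rw [val_B hgB] at hg
  set Rt := Rt0 ++ [y] with hRt
  rw [hll] at hs
  have hs2 := List.pairwise_append.1 hs
  have hs3 := List.pairwise_cons.1 hs2.2.1
  have hLU : ∀ x ∈ L, x ∈ U := fun x hx => by rw [← hm, hll]; simp [hx]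
  have hRU : ∀ x ∈ Rt, x ∈ U := fun x hx => by rw [← hm, hll]; simp [hx]
  have hlen : l.length = U.card := by
    rw [← hl, List.toFinset_card_of_nodup]; rw [hll]; exact Srt.nodup hs
  have hsum : C.ls l = C.ls L + C.w g + C.ls Rt := by rw [hll]; simp [val_B hgB]; ring
  have hlen2 : L.length + Rt.length + 1 = U.card := by
    rw [← hlen, hll]; simp; omega
  by_cases hi : C.ls L = 0
  · by_cases hLe : L = []
    · subst hLe
      refine (R1 hB 1 hn hU hp hgU hgB ?_ h0 h1).mono ?_
      · intro x hx hxy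
        rw [← hm, hll] at hx
        have hx : x ∈ Rt := by simpa [hxy] using hx
        exact hs3.1 x hx
      · intro x hx
        simp only [Function.update_apply]; split_ifs <;> simp
    obtain ⟨L', b, hLb⟩ : ∃ L' b, L = L' ++ [b] := by
      rcases List.eq_nil_or_concat L with h | ⟨L', y, h⟩
      · exact absurd h hLe
      · exact ⟨L', y, by simpa using h⟩
    have hbL : b ∈ L := by rw [hLb]; simp
    have hb : b ∈ C.B := by
      refine B_of_val (hU (hLU b hbL)) ?_
      have := hpre L' [b] hLb
      rw [hLb] at hi; simp at hi; omega
    have ndL : L.Nodup := Srt.nodup hs2.1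
    have ndR : (g :: Rt).Nodup := Srt.nodup hs2.2.1
    have t1 := R1 hB (U := L.toFinset) (p := p) (d := b) (-1)
      (by rw [List.toFinset_card_of_nodup ndL]; omega)
      (fun x hx => hU (hLU x (by simpa using hx))) hp (by simpa using hbL) hb
      (by
        intro x hx hxb
        have hx : x ∈ L := by simpa using hx
        have h := hs2.1
        rw [hLb] at h hx
        have hx : x ∈ L' := by simpa [hxb] using hx
        have := (List.pairwise_append.1 h).2.2 x hx b (by simp)
        rw [DD_swap] at this; linarith)
      (by rw [phi_toFinset ndL]; omega) (by rw [phi_toFinset ndL]; omega)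
    have t2 := R1 hB (U := (g :: Rt).toFinset) (p := p) (d := g) 1
      (by rw [List.toFinset_card_of_nodup ndR]; simp; omega)
      (fun x hx => by
        simp only [List.mem_toFinset, List.mem_cons] at hx
        rcases hx with rfl | hx
        · exact hU hgU
        · exact hU (hRU x hx)) hp (by simp) hgB
      (by
        intro x hx hxb
        have hx : x ∈ Rt := by simpa [hxb] using hx
        exact hs3.1 x hx)
      (by rw [phi_toFinset ndR]; simp [val_B hgB]; omega)
      (by rw [phi_toFinset ndR]; simp [val_B hgB]; omega)
    obtain ⟨f, hf, f0, f1, f2⟩ := split_fun hs hLe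
    have t := glue (g := Function.update C.cap p 2) p f hf ?_ t1 t2 (by simp) (by simp)
      ?_ ?_ ?_ ?_ ?_
    · convert t using 1
      rw [← hl, hll]
      ext x
      simp only [Finset.mem_insert, Finset.mem_union, List.mem_toFinset, List.mem_append]
      tauto
    · intro x hx
      simp only [Finset.mem_insert, List.mem_toFinset] at hx
      rcases hx with rfl | hx
      · exact hpS
      · exact hU (hLU x hx)
    · intro x hx
      simp only [Finset.mem_insert, List.mem_toFinset] at hx
      rcases hx with rfl | hx
      · exact le_rfl
      · rw [f0]; exact f1 x hx
    · intro x hx hxp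
      simp only [Finset.mem_insert, List.mem_toFinset, hxp, false_or] at hx
      rw [f0]; exact f2 x hx
    · intro x hx hxp
      simp [Function.update_apply, hxp]
    · intro x hx hxp
      simp [Function.update_apply, hxp]
    · simp
  · have hgp : g ≠ p := by rintro rfl; exact hpU hgU
    have ndL : L.Nodup := Srt.nodup hs2.1
    have ndR : Rt.Nodup := Srt.nodup hs3.2
    have dL : ∀ x ∈ L, 0 < (-1) * DD p g x := by
      intro x hx
      have := hs2.2.2 x hx g (by simp)
      rw [DD_swap] at this; linarith
    have dR : ∀ x ∈ Rt, 0 < 1 * DD p g x := hs3.1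
    obtain ⟨i, hi'⟩ : ∃ i : ℕ, (i : ℤ) = - C.ls L := ⟨(- C.ls L).toNat, by omega⟩
    obtain ⟨j, hj'⟩ : ∃ j : ℕ, (j : ℤ) = C.w g + C.ls L := ⟨(C.w g + C.ls L).toNat, by omega⟩
    have tL := hB L.toFinset g i (by rw [List.toFinset_card_of_nodup ndL]; omega)
      (fun x hx => hU (hLU x (by simpa using hx))) hgB
      (HH_of_DD (fun x hx => dL x (by simpa using hx))).2
      (by rw [phi_toFinset ndL]; omega) (by omega) (by rw [phi_toFinset ndL]; omega)
    have tR := hB Rt.toFinset g j (by rw [List.toFinset_card_of_nodup ndR]; omega)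
      (fun x hx => hU (hRU x (by simpa using hx))) hgB
      (HH_of_DD (fun x hx => dR x (by simpa using hx))).2
      (by rw [phi_toFinset ndR]; omega) (by omega) (by rw [phi_toFinset ndR]; omega)
    have t1 : C.Tr {p, g} (fun _ => 1) := tr_edge (Or.inl ⟨hp, hgB⟩) _ le_rfl le_rfl
    have t := glue (g := Function.update (Function.update C.cap p 1) g (1 + i)) g _ (aff_DD 1 p g)
      ?_ t1 tL (by simp) (by simp) ?_ ?_ ?_ ?_ ?_
    rotate_left
    · intro x hx
      simp only [Finset.mem_insert, Finset.mem_singleton] at hx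
      rcases hx with rfl | rfl
      · exact hpS
      · exact S_B hgB
    · intro x hx
      simp only [Finset.mem_insert, Finset.mem_singleton] at hx
      rcases hx with rfl | rfl <;> simp [DD_self, DD_self'']
    · intro x hx hxd
      simp only [Finset.mem_insert, List.mem_toFinset, hxd, false_or] at hx
      have := dL x hx
      rw [DD_self]; linarith
    · intro x hx hxd
      simp only [Finset.mem_insert, Finset.mem_singleton, hxd, or_false] at hx
      subst hx
      simp [Function.update_apply, hxd]
    · intro x hx hxd
      simp only [Finset.mem_insert, List.mem_toFinset, hxd, false_or] at hx
      have : x ≠ p := by rintro rfl; exact hpU (hLU _ hx)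
      simp [Function.update_apply, hxd, this]
    · simp
    have t' := glue (g := Function.update C.cap p 2) g _ (aff_DD (-1) p g)
      ?_ t tR (by simp) (by simp) ?_ ?_ ?_ ?_ ?_
    · convert t' using 1
      rw [← hl, hll]
      ext x
      simp only [Finset.mem_insert, Finset.mem_union, List.mem_toFinset, List.mem_append,
        List.mem_cons, Finset.mem_singleton]
      tauto
    · intro x hx
      simp only [Finset.mem_insert, Finset.mem_singleton, Finset.mem_union,
        List.mem_toFinset] at hx
      rcases hx with (rfl | rfl) | (rfl | hx)
      · exact hpS
      · exact S_B hgB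
      · exact S_B hgB
      · exact hU (hLU x hx)
    · intro x hx
      simp only [Finset.mem_insert, Finset.mem_singleton, Finset.mem_union,
        List.mem_toFinset] at hx
      rcases hx with (rfl | rfl) | (rfl | hx)
      · simp [DD_self, DD_self'']
      · simp [DD_self, DD_self'']
      · simp [DD_self, DD_self'']
      · have := dL x hx
        rw [DD_self]; linarith
    · intro x hx hxd
      simp only [Finset.mem_insert, List.mem_toFinset, hxd, false_or] at hx
      have := dR x hx
      rw [DD_self]; linarith
    · intro x hx hxd
      simp only [Function.update_apply, hxd, if_false]
      split_ifs <;> simp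
    · intro x hx hxd
      simp only [Finset.mem_insert, List.mem_toFinset, hxd, false_or] at hx
      have : x ≠ p := by rintro rfl; exact hpU (hRU _ hx)
      simp [Function.update_apply, hxd, this]
    · simp [Function.update_apply, hgp, cap_B hgB]; omega

end Ctx

set_option linter.unusedSimpArgs false

namespace Ctx
variable {C : Ctx}

lemma stepB {n : ℕ} (hB : C.PB n) (hR : C.PR n) (hQ : C.PQ n) : C.PB (n + 1) := by
  intro W c m hn hW hc hH h0 hm1 hm
  have hcS : c ∈ C.S := S_B hc
  have hcW : c ∉ W := by
    intro h
    obtain ⟨f, _, hf⟩ := hH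
    exact lt_irrefl _ (hf c h)
  obtain ⟨l, hl, hs⟩ := sort_HH hcS hW hH (one_ne_zero)
  have hmm : ∀ x, x ∈ l ↔ x ∈ W := by intro x; rw [← hl]; simp
  have hphi : C.phi W = C.ls l := by rw [← hl, phi_toFinset hs.nodup]
  have hlen : l.length = W.card := by rw [← hl, List.toFinset_card_of_nodup hs.nodup]
  by_cases h2 : C.phi W ≤ -2
  · obtain ⟨l1, l2, h12, hs1, -⟩ := C.walk1 l 0 le_rfl (by omega)
    rw [zero_add] at hs1
    have hs2 : C.ls l2 = C.phi W + 1 := by rw [hphi, h12]; simp; omega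
    have n1 : l1 ≠ [] := by rintro rfl; simp at hs1
    have n2 : l2 ≠ [] := by rintro rfl; simp at hs2; omega
    have p1 := List.length_pos_of_ne_nil n1
    have p2 := List.length_pos_of_ne_nil n2
    have hlen2 : l1.length + l2.length = W.card := by rw [← hlen, h12]; simp
    rw [h12] at hs
    have hp := List.pairwise_append.1 hs
    have nd1 : l1.Nodup := Srt.nodup hp.1
    have nd2 : l2.Nodup := Srt.nodup hp.2.1
    have i1 : ∀ x ∈ l1, x ∈ W := fun x hx => by rw [← hmm, h12]; simp [hx]
    have i2 : ∀ x ∈ l2, x ∈ W := fun x hx => by rw [← hmm, h12]; simp [hx]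
    have s1 : l1.toFinset ⊆ W := fun x hx => i1 x (by simpa using hx)
    have s2 : l2.toFinset ⊆ W := fun x hx => i2 x (by simpa using hx)
    have t1 := hB l1.toFinset c 1 (by rw [List.toFinset_card_of_nodup nd1]; omega)
      (s1.trans hW) hc (HH_mono hH s1) (by rw [phi_toFinset nd1]; omega) le_rfl
      (by rw [phi_toFinset nd1]; omega)
    have t2 := hB l2.toFinset c (m - 1) (by rw [List.toFinset_card_of_nodup nd2]; omega)
      (s2.trans hW) hc (HH_mono hH s2) (by rw [phi_toFinset nd2]; omega) (by omega)
      (by rw [phi_toFinset nd2]; omega)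
    obtain ⟨f, hf, f0, f1, f2⟩ := split_fun hs n1
    have t := glue (g := Function.update C.cap c m) c f hf ?_ t1 t2 (by simp) (by simp)
      ?_ ?_ ?_ ?_ ?_
    · convert t using 1
      rw [← hl, h12]
      ext x
      simp only [Finset.mem_insert, Finset.mem_union, List.mem_toFinset, List.mem_append]
      tauto
    · intro x hx
      simp only [Finset.mem_insert, List.mem_toFinset] at hx
      rcases hx with rfl | hx
      · exact hcS
      · exact hW (i1 x hx)
    · intro x hx
      simp only [Finset.mem_insert, List.mem_toFinset] at hx
      rcases hx with rfl | hx
      · exact le_rfl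
      · rw [f0]; exact f1 x hx
    · intro x hx hxp
      simp only [Finset.mem_insert, List.mem_toFinset, hxp, false_or] at hx
      rw [f0]; exact f2 x hx
    · intro x hx hxp
      simp [Function.update_apply, hxp]
    · intro x hx hxp
      simp [Function.update_apply, hxp]
    · simp; omega
  cases l with
  | nil =>
    simp at hl; subst hl
    simpa using tr_single c _
  | cons x t =>
    have hxW : x ∈ W := by rw [← hmm]; simp
    have hxc : x ≠ c := by rintro rfl; exact hcW hxW
    have hp := List.pairwise_cons.1 hs
    have ndt : t.Nodup := Srt.nodup hp.2
    have it : ∀ y ∈ t, y ∈ W := fun y hy => by rw [← hmm]; simp [hy]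
    have st : t.toFinset ⊆ W := fun y hy => it y (by simpa using hy)
    simp only [List.length_cons] at hlen
    rw [ls_cons] at hphi
    by_cases hx : x ∈ C.R
    · rw [val_R hx] at hphi
      have hdt : ∀ y ∈ t.toFinset, 0 < 1 * DD c x y := fun y hy => hp.1 y (by simpa using hy)
      have t2 := hR t.toFinset x (by rw [List.toFinset_card_of_nodup ndt]; omega)
        (st.trans hW) hx (HH_of_DD hdt).2 (by rw [phi_toFinset ndt]; omega)
        (by rw [phi_toFinset ndt]; omega)
      have t1 : C.Tr {c, x} (fun _ => 1) := tr_edge (Or.inr ⟨hc, hx⟩) _ le_rfl le_rfl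
      have t := glue (g := Function.update C.cap c m) x _ (aff_DD (-1) c x) ?_ t1 t2 (by simp)
        (by simp) ?_ ?_ ?_ ?_ ?_
      · convert t using 1
        rw [← hl]
        ext x
        simp only [Finset.mem_insert, Finset.mem_union, List.mem_toFinset, List.mem_cons,
          Finset.mem_singleton]
        tauto
      · intro y hy
        simp only [Finset.mem_insert, Finset.mem_singleton] at hy
        rcases hy with rfl | rfl
        · exact hcS
        · exact hW hxW
      · intro y hy
        simp only [Finset.mem_insert, Finset.mem_singleton] at hy
        rcases hy with rfl | rfl <;> simp [DD_self, DD_self'']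
      · intro y hy hyx
        simp only [Finset.mem_insert, hyx, false_or] at hy
        have := hdt y hy
        rw [DD_self]; linarith
      · intro y hy hyx
        simp only [Finset.mem_insert, Finset.mem_singleton, hyx, or_false] at hy
        subst hy
        simpa using hm1
      · intro y hy hyx
        simp only [Finset.mem_insert, hyx, false_or] at hy
        have : y ≠ c := by rintro rfl; exact hcW (st hy)
        simp [Function.update_apply, hyx, this]
      · simp [Function.update_apply, hxc, cap_R hx]
    · have hxB : x ∈ C.B := by have := mem_S.1 (hW hxW); tauto
      rw [val_B hxB] at hphi
      have hw1 := C.w1 x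
      have hwk := C.wk x
      obtain ⟨l', hl', hs'⟩ := sort_from (a := x) (c := c) (X := t.toFinset) (s := -1) (hW hxW)
        (st.trans hW) (by
          intro y hy
          have := hp.1 y (by simpa using hy)
          rw [DD_swap'] at this; linarith) (by norm_num)
      have hnd' : l'.Nodup := (List.nodup_cons.1 hs'.nodup).2
      have hls' : C.ls l' = C.ls t := by
        rw [← phi_toFinset hnd', hl', phi_toFinset ndt]
      have hlen' : l'.length = t.length := by
        rw [← List.toFinset_card_of_nodup hnd', hl', List.toFinset_card_of_nodup ndt]
      obtain ⟨A, Z, hAZ, hA, hpre⟩ := C.walk1 l' 0 le_rfl (by omega)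
      simp only [zero_add] at hA hpre
      have hlen2 : A.length + Z.length = l'.length := by rw [hAZ]; simp
      have hZ : C.ls l' = -1 + C.ls Z := by rw [hAZ, ls_append, hA]
      have il' : ∀ y ∈ l', y ∈ W := fun y hy => st (by rw [← hl']; simpa using hy)
      have iA : ∀ y ∈ A, y ∈ W := fun y hy => il' y (by rw [hAZ]; simp [hy])
      have iZ : ∀ y ∈ Z, y ∈ W := fun y hy => il' y (by rw [hAZ]; simp [hy])
      have nZ : A.length ≠ 0 := by
        intro h
        have := List.length_eq_zero_iff.1 h
        subst this; simp at hA
      have hs2 : Srt (-1) x ((c :: A) ++ Z) := by rw [hAZ] at hs'; exact hs'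
      have hp2 := List.pairwise_append.1 hs2
      have ndZ : Z.Nodup := Srt.nodup hp2.2.1
      have t1 := hQ A x c (-1) (by omega) (fun y hy => hW (iA y hy)) hxB hc (by norm_num)
        hp2.1 hA hpre
      have t2 := hB Z.toFinset x (C.w x) (by rw [List.toFinset_card_of_nodup ndZ]; omega)
        (fun y hy => hW (iZ y (by simpa using hy))) hxB
        (HH_of_DD (a := x) (c := c) (s := -1) (fun y hy => by
          exact hp2.2.2 c (by simp) y (by simpa using hy))).1
        (by rw [phi_toFinset ndZ]; omega) hw1 (by rw [phi_toFinset ndZ]; omega)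
      obtain ⟨f, hf, f0, f1, f2⟩ := split_fun hs2 (by simp)
      have t := glue (g := Function.update C.cap c m) x f hf ?_ t1 t2 (by simp) (by simp)
        ?_ ?_ ?_ ?_ ?_
      · convert t using 1
        have e : W = insert x (A ++ Z).toFinset := by
          rw [← hAZ, hl', ← hl]; simp
        rw [e]
        ext x
        simp only [Finset.mem_insert, Finset.mem_union, List.mem_toFinset, List.mem_append]
        tauto
      · intro y hy
        simp only [Finset.mem_insert, List.mem_toFinset] at hy
        rcases hy with rfl | rfl | hy
        · exact hW hxW
        · exact hcS
        · exact hW (iA y hy)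
      · intro y hy
        simp only [Finset.mem_insert, List.mem_toFinset] at hy
        rcases hy with rfl | rfl | hy
        · exact le_rfl
        · rw [f0]; exact f1 _ (by simp)
        · rw [f0]; exact f1 _ (by simp [hy])
      · intro y hy hyx
        simp only [Finset.mem_insert, List.mem_toFinset, hyx, false_or] at hy
        rw [f0]; exact f2 _ hy
      · intro y hy hyx
        simp only [Function.update_apply, hyx, if_false]
        split_ifs
        · exact hm1
        · exact le_rfl
      · intro y hy hyx
        simp only [Finset.mem_insert, List.mem_toFinset, hyx, false_or] at hy
        have : y ≠ c := by rintro rfl; exact hcW (iZ _ hy)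
        simp [Function.update_apply, hyx, this]
      · simp [Function.update_apply, hxc, cap_B hxB]; omega

end Ctx

set_option linter.unusedSimpArgs false

lemma exists_first_mem {α : Type*} (P : α → Prop) (l : List α) (h : ∃ x ∈ l, P x) :
    ∃ a y b, l = a ++ y :: b ∧ P y ∧ ∀ x ∈ a, ¬ P x := by
  induction l with
  | nil => simp at h
  | cons x t ih =>
    by_cases hx : P x
    · exact ⟨[], x, t, rfl, hx, by simp⟩
    · obtain ⟨a, y, b, h1, h2, h3⟩ := ih (by
        obtain ⟨z, hz, hz'⟩ := h
        rcases List.mem_cons.1 hz with rfl | hz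
        · exact absurd hz' hx
        · exact ⟨z, hz, hz'⟩)
      refine ⟨x :: a, y, b, by simp [h1], h2, ?_⟩
      intro z hz
      rcases List.mem_cons.1 hz with rfl | hz
      · exact hx
      · exact h3 z hz

namespace Ctx
variable {C : Ctx}

lemma tr_path {a b z : Pt} (ha : a ∈ C.B) (hb : b ∈ C.B) (hz : z ∈ C.R) (hD : DD a z b ≠ 0) :
    C.Tr {a, z, b} (Function.update (fun _ => 1) z 2) := by
  have t1 : C.Tr {a, z} (fun _ => 1) := tr_edge (Or.inr ⟨ha, hz⟩) _ le_rfl le_rfl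
  have t2 : C.Tr {b, z} (fun _ => 1) := tr_edge (Or.inr ⟨hb, hz⟩) _ le_rfl le_rfl
  have t := glue (g := (Function.update (fun _ => 1) z 2)) z _ (aff_DD (- DD a z b) a z) ?_ t1 t2
    (by simp) (by simp) ?_ ?_ ?_ ?_ ?_
  · convert t using 1
    ext x
    simp only [Finset.mem_insert, Finset.mem_union, Finset.mem_singleton]
    tauto
  · intro x hx
    simp only [Finset.mem_insert, Finset.mem_singleton] at hx
    rcases hx with rfl | rfl
    · exact S_B ha
    · exact S_R hz
  · intro x hx
    simp only [Finset.mem_insert, Finset.mem_singleton] at hx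
    rcases hx with rfl | rfl <;> simp [DD_self, DD_self'']
  · intro x hx hxz
    simp only [Finset.mem_insert, Finset.mem_singleton, hxz, or_false] at hx
    subst hx
    rw [DD_self]
    have := mul_self_pos.2 hD
    linarith
  · intro x _ hxz; simp [hxz]
  · intro x _ hxz; simp [hxz]
  · simp

/-- Red-first-point case of QQ. -/
lemma stepQ_red {n : ℕ} (hB : C.PB n) {l : List Pt} {v o t e : Pt} {s : ℝ} (hn : l.length < n + 1)
    (hl : ∀ x ∈ l, x ∈ C.S) (hv : v ∈ C.B) (ho : o ∈ C.B) (hnd : l.Nodup) (hvl : v ∉ l)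
    (hol : o ∉ l) (hov : o ≠ v) (hsum : C.ls l = -1) (htl : t ∈ l) (htB : t ∈ C.B)
    (hel : e ∈ l) (heR : e ∈ C.R) (hα : ∀ x ∈ l, x ≠ e → 0 < (-s) * DD o e x)
    (hαv : (-s) * DD o e v < 0) (hβ : ∀ x ∈ l, x ≠ t → 0 < s * DD v t x)
    (hβo : s * DD v t o < 0) :
    C.Tr (insert v (insert o l.toFinset)) (Function.update (Function.update C.cap v 1) o 1) := by
  set F : ℝ → Pt → ℝ := fun τ x => (1 - τ) * ((-s) * DD o e x) + τ * (s * DD v t x) with hF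
  have hAff : ∀ τ, Aff (F τ) := fun τ => (aff_DD (-s) o e).comb (aff_DD s v t) (1 - τ) τ
  have hcont : ∀ x, Continuous (fun τ => F τ x) := by intro x; simp only [hF]; fun_prop
  have hαe : (-s) * DD o e e = 0 := by rw [DD_self]; simp
  have hβt : s * DD v t t = 0 := by rw [DD_self]; simp
  have hαo : (-s) * DD o e o = 0 := by rw [DD_self'']; simp
  have hβv : s * DD v t v = 0 := by rw [DD_self'']; simp
  have hα0 : ∀ x ∈ l, 0 ≤ (-s) * DD o e x := by
    intro x hx
    by_cases h : x = e
    · rw [h, hαe]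
    · exact (hα x hx h).le
  have hβ0 : ∀ x ∈ l, 0 ≤ s * DD v t x := by
    intro x hx
    by_cases h : x = t
    · rw [h, hβt]
    · exact (hβ x hx h).le
  have hte : t ≠ e := by rintro rfl; exact not_R htB heR
  set Rd := l.toFinset.filter (fun x => x ∈ C.R) with hRd
  set Bl := l.toFinset.filter (fun x => x ∈ C.B) with hBl
  have nR : Rd.Nonempty := ⟨e, by simp [hRd, hel, heR]⟩
  have nB : Bl.Nonempty := ⟨t, by simp [hBl, htl, htB]⟩
  have cR : Continuous (fun τ => Rd.inf' nR (fun x => F τ x)) :=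
    Continuous.finset_inf'_apply nR (fun x _ => hcont x)
  have cB : Continuous (fun τ => Bl.inf' nB (fun x => F τ x)) :=
    Continuous.finset_inf'_apply nB (fun x _ => hcont x)
  have end0 : Rd.inf' nR (fun x => F 0 x) - Bl.inf' nB (fun x => F 0 x) < 0 := by
    have h1 : Rd.inf' nR (fun x => F 0 x) ≤ F 0 e :=
      Finset.inf'_le _ (by simp [hRd, hel, heR])
    have h2 : 0 < Bl.inf' nB (fun x => F 0 x) := by
      rw [Finset.lt_inf'_iff]
      intro x hx
      simp only [hBl, Finset.mem_filter, List.mem_toFinset] at hx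
      have : x ≠ e := by rintro rfl; exact not_R hx.2 heR
      have := hα x hx.1 this
      simp only [hF]; linarith
    have h3 : F 0 e = 0 := by simp only [hF]; rw [hαe]; simp
    linarith
  have end1 : 0 < Rd.inf' nR (fun x => F 1 x) - Bl.inf' nB (fun x => F 1 x) := by
    have h1 : Bl.inf' nB (fun x => F 1 x) ≤ F 1 t :=
      Finset.inf'_le _ (by simp [hBl, htl, htB])
    have h2 : 0 < Rd.inf' nR (fun x => F 1 x) := by
      rw [Finset.lt_inf'_iff]
      intro x hx
      simp only [hRd, Finset.mem_filter, List.mem_toFinset] at hx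
      have : x ≠ t := by rintro rfl; exact not_R htB hx.2
      have := hβ x hx.1 this
      simp only [hF]; linarith
    have h3 : F 1 t = 0 := by simp only [hF]; rw [hβt]; simp
    linarith
  obtain ⟨τ, hτ, hτ0⟩ := intermediate_value_Icc (zero_le_one (α := ℝ))
    ((cR.sub cB).continuousOn) ⟨end0.le, end1.le⟩
  have hτ0 : Rd.inf' nR (fun x => F τ x) - Bl.inf' nB (fun x => F τ x) = 0 := hτ0
  have τ0 : 0 < τ := by
    rcases eq_or_lt_of_le hτ.1 with h | h
    · subst h; linarith
    · exact h
  have τ1 : τ < 1 := by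
    rcases eq_or_lt_of_le hτ.2 with h | h
    · subst h; linarith
    · exact h
  obtain ⟨z, hzm, hz⟩ := Finset.exists_mem_eq_inf' nR (fun x => F τ x)
  obtain ⟨u, hum, hu⟩ := Finset.exists_mem_eq_inf' nB (fun x => F τ x)
  have hzu : F τ z = F τ u := by rw [← hz, ← hu]; linarith
  have hmin : ∀ x ∈ l, F τ z ≤ F τ x := by
    intro x hx
    rcases mem_S.1 (hl x hx) with h | h
    · rw [← hz]; exact Finset.inf'_le _ (by simp [hRd, hx, h])
    · rw [hzu, ← hu]; exact Finset.inf'_le _ (by simp [hBl, hx, h])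
  simp only [hRd, Finset.mem_filter, List.mem_toFinset] at hzm
  simp only [hBl, Finset.mem_filter, List.mem_toFinset] at hum
  obtain ⟨hzl, hzR⟩ := hzm
  obtain ⟨hul, huB⟩ := hum
  have huz : u ≠ z := by rintro rfl; exact not_R huB hzR
  have hz0 : 0 ≤ F τ z := by
    have h1 := mul_nonneg (by linarith : (0:ℝ) ≤ 1 - τ) (hα0 z hzl)
    have h2 := mul_nonneg τ0.le (hβ0 z hzl)
    simp only [hF]; linarith
  have hFo : F τ o < 0 := by
    have h1 := mul_neg_of_pos_of_neg τ0 hβo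
    simp only [hF]; rw [hαo]; linarith
  have hFv : F τ v < 0 := by
    have h1 := mul_neg_of_pos_of_neg (by linarith : (0:ℝ) < 1 - τ) hαv
    simp only [hF]; rw [hβv]; linarith
  have hstrict : ∀ x ∈ l, x ≠ z → x ≠ u → F τ z < F τ x := by
    intro x hx hxz hxu
    refine lt_of_le_of_ne (hmin x hx) ?_
    intro heq
    have h3 := (hAff τ).three z u x o
    have hd := C.gp z (hl z hzl) u (hl u hul) x (hl x hx) huz.symm hxz.symm hxu.symm
    have : (F τ o - F τ z) * DD z u x = 0 := by
      rw [← heq, ← hzu] at h3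
      linarith
    rcases mul_eq_zero.1 this with h | h
    · linarith
    · exact hd h
  -- build tree
  set X := (l.toFinset.erase z).erase u with hX
  have hXm : ∀ x, x ∈ X ↔ x ≠ u ∧ x ≠ z ∧ x ∈ l := by intro x; simp [hX]
  have huz' : u ∈ l.toFinset.erase z := by simp [huz, hul]
  have hphi : C.phi X = - C.w u := by
    rw [hX, phi_erase huz', phi_erase (by simpa using hzl), phi_toFinset hnd, hsum, val_R hzR,
      val_B huB]; ring
  have hcard : X.card + 1 + 1 = l.length := by
    rw [hX, Finset.card_erase_add_one huz', Finset.card_erase_add_one (by simpa using hzl),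
      List.toFinset_card_of_nodup hnd]
  have hw1 := C.w1 u
  have hwk := C.wk u
  have tB := hB X u (C.w u) (by omega) (fun x hx => hl x ((hXm x).1 hx).2.2) huB
    ⟨F τ, hAff τ, fun x hx => by
      have := (hXm x).1 hx
      rw [← hzu]; exact hstrict x this.2.2 this.2.1 this.1⟩ (by omega) hw1 (by omega)
  have tE : C.Tr {z, u} (fun _ => 1) := tr_edge (Or.inl ⟨hzR, huB⟩) _ le_rfl le_rfl
  have t1 := glue (g := Function.update C.cap z 1) u _ (hAff τ).neg ?_ tE tB (by simp) (by simp)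
    ?_ ?_ ?_ ?_ ?_
  rotate_left
  · intro x hx
    simp only [Finset.mem_insert, Finset.mem_singleton] at hx
    rcases hx with rfl | rfl
    · exact S_R hzR
    · exact S_B huB
  · intro x hx
    simp only [Finset.mem_insert, Finset.mem_singleton] at hx
    rcases hx with rfl | rfl
    · rw [hzu]
    · exact le_rfl
  · intro x hx hxu
    simp only [Finset.mem_insert, hxu, false_or] at hx
    have := (hXm x).1 hx
    have := hstrict x this.2.2 this.2.1 this.1
    linarith
  · intro x hx hxu
    simp only [Finset.mem_insert, Finset.mem_singleton, hxu, or_false] at hx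
    subst hx; simp
  · intro x hx hxu
    simp only [Finset.mem_insert, hxu, false_or] at hx
    have := (hXm x).1 hx
    simp [Function.update_apply, hxu, this.2.1]
  · simp [Function.update_apply, huz, cap_B huB]; omega
  have hsetA : ({z, u} : Finset Pt) ∪ insert u X = l.toFinset := by
    ext x
    simp only [Finset.mem_insert, Finset.mem_union, Finset.mem_singleton, hXm, List.mem_toFinset]
    constructor
    · rintro ((rfl | rfl) | (rfl | h))
      · exact hzl
      · exact hul
      · exact hul
      · exact h.2.2
    · tauto
  rw [hsetA] at t1
  have hzo : z ≠ o := by rintro rfl; exact hol hzl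
  have hzv : z ≠ v := by rintro rfl; exact hvl hzl
  have t2 := tr_path (C := C) ho hv hzR
    (C.gp o (S_B ho) z (S_R hzR) v (S_B hv) hzo.symm hov hzv)
  have t := glue (g := Function.update (Function.update C.cap v 1) o 1) z _ (hAff τ) ?_ t1 t2
    (by simpa using hzl) (by simp) ?_ ?_ ?_ ?_ ?_
  · convert t using 1
    ext x
    simp only [Finset.mem_insert, Finset.mem_union, Finset.mem_singleton, List.mem_toFinset]
    constructor
    · tauto
    · rintro (h | rfl | rfl | rfl) <;> tauto
  · intro x hx; exact hl x (by simpa using hx)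
  · intro x hx; exact hmin x (by simpa using hx)
  · intro x hx hxz
    simp only [Finset.mem_insert, Finset.mem_singleton, hxz, false_or] at hx
    rcases hx with rfl | rfl <;> linarith
  · intro x hx hxz
    have hx : x ∈ l := by simpa using hx
    have h1 : x ≠ o := by rintro rfl; exact hol hx
    have h2 : x ≠ v := by rintro rfl; exact hvl hx
    simp [Function.update_apply, hxz, h1, h2]
  · intro x hx hxz
    simp only [Finset.mem_insert, Finset.mem_singleton, hxz, false_or] at hx
    rcases hx with rfl | rfl <;> simp [Function.update_apply, hxz]
  · simp [Function.update_apply, hzo, hzv, cap_R hzR]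

end Ctx

set_option linter.unusedSimpArgs false

namespace Ctx
variable {C : Ctx}

set_option maxHeartbeats 1000000 in
/-- Blue-first-point case of QQ. -/
lemma stepQ_blue {n : ℕ} (hB : C.PB n) (hQ : C.PQ n) {l : List Pt} {v o e : Pt} {s : ℝ}
    (hs : s ≠ 0) (hn : l.length < n + 1)
    (hl : ∀ x ∈ l, x ∈ C.S) (hv : v ∈ C.B) (ho : o ∈ C.B) (hsrt : Srt s v l) (hvl : v ∉ l)
    (hol : o ∉ l) (hov : o ≠ v) (hsum : C.ls l = -1)
    (hpre : ∀ a b, l = a ++ b → b ≠ [] → 0 ≤ C.ls a)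
    (hel : e ∈ l) (heB : e ∈ C.B) (hα : ∀ x ∈ l, x ≠ e → 0 < (-s) * DD o e x)
    (hαv : 0 < (-s) * DD o v e) :
    C.Tr (insert v (insert o l.toFinset)) (Function.update (Function.update C.cap v 1) o 1) := by
  have hw1 := C.w1 e
  have hwk := C.wk e
  have hk2 := C.k2
  have hev : e ≠ v := by rintro rfl; exact hvl hel
  have heo : e ≠ o := by rintro rfl; exact hol hel
  have hnd := hsrt.nodup
  have hel' : e ∈ l.toFinset := by simpa using hel
  obtain ⟨m, hm, hms⟩ := sort_from (C := C) (a := e) (c := o) (X := l.toFinset.erase e) (s := s)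
    (hl e hel) (fun x hx => hl x (by simpa using Finset.mem_of_mem_erase hx)) (by
      intro x hx
      simp only [Finset.mem_erase, List.mem_toFinset] at hx
      have := hα x hx.2 hx.1
      rw [DD_swap']; linarith) hs
  have hmm : ∀ x, x ∈ m ↔ x ≠ e ∧ x ∈ l := by
    intro x; rw [← List.mem_toFinset, hm]; simp
  have ndm : m.Nodup := (List.nodup_cons.1 hms.nodup).2
  have hmsum : C.ls m = -1 - C.w e := by
    rw [← phi_toFinset ndm, hm, phi_erase hel', phi_toFinset hnd, hsum, val_B heB]
  have hmlen : m.length + 1 = l.length := by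
    rw [← List.toFinset_card_of_nodup ndm, hm, Finset.card_erase_add_one hel',
      List.toFinset_card_of_nodup hnd]
  obtain ⟨lp, lr, hlpr⟩ := List.append_of_mem hel
  have hsrt' := hsrt
  rw [hlpr] at hsrt'
  have hpl := List.pairwise_append.1 hsrt'
  have hpr := List.pairwise_cons.1 hpl.2.1
  have hlp : ∀ x ∈ lp, s * DD e x v < 0 := by
    intro x hx
    have := hpl.2.2 x hx e (by simp)
    rw [DD_swap, DD_rot] at this
    linarith
  have hlr : ∀ x ∈ lr, 0 < s * DD e x v := by
    intro x hx
    have := hpr.1 x hx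
    rwa [DD_rot] at this
  have hlp0 : 0 ≤ C.ls lp := hpre lp (e :: lr) hlpr (by simp)
  have hlrs : C.ls lr = -1 - C.w e - C.ls lp := by
    rw [hlpr] at hsum; simp [val_B heB] at hsum; omega
  have hmem : ∀ x, x ∈ m → x ∈ lp ∨ x ∈ lr := by
    intro x hx
    have := (hmm x).1 hx
    rw [hlpr] at this
    simpa [this.1] using this.2
  have heov : s * DD e o v < 0 := by rw [DD_rot]; linarith
  -- splitting m
  obtain ⟨m1, rest, hm1, hs1, hpre1⟩ := C.walk1 m 0 le_rfl (by omega)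
  simp only [zero_add] at hs1 hpre1
  have hrest : C.ls rest = - C.w e := by rw [hm1] at hmsum; simp at hmsum; omega
  obtain ⟨r1, r2, hr, hsr1, hprer⟩ := C.walk1 rest.reverse 0 le_rfl (by rw [ls_reverse]; omega)
  simp only [zero_add] at hsr1 hprer
  have hrest2 : rest = r2.reverse ++ r1.reverse := by
    rw [← List.reverse_append, ← hr, List.reverse_reverse]
  have hr2 : C.ls r2 = 1 - C.w e := by
    rw [hrest2] at hrest; simp at hrest; omega
  have hmeq : m = m1 ++ (r2.reverse ++ r1.reverse) := by rw [hm1, hrest2]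
  have hmrev : m.reverse = r1 ++ (r2 ++ m1.reverse) := by rw [hmeq]; simp
  have hmsc := List.pairwise_cons.1 hms
  have hmrs : Srt (-s) e m.reverse := Srt.reverse hmsc.2
  have hr1m : ∀ x ∈ r1, x ∈ m := fun x hx => by rw [hmeq]; simp [hx]
  have hr2m : ∀ x ∈ r2, x ∈ m := fun x hx => by rw [hmeq]; simp [hx]
  have hm1m : ∀ x ∈ m1, x ∈ m := fun x hx => by rw [hmeq]; simp [hx]
  -- initial segment property
  have hinit : ∀ x y, x ∈ m → y ∈ m → 0 < s * DD e y x → x ∈ lp → y ∈ lp := by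
    intro x y hx hy hyx hxp
    rcases hmem y hy with h | h
    · exact h
    exfalso
    have a1 := hlp x hxp
    have a2 := hlr y h
    have a3 := hmsc.1 x hx
    have a4 := hmsc.1 y hy
    have key : (s * DD e y x) * (s * DD e o v) =
        (s * DD e o y) * (- (s * DD e x v)) + (s * DD e o x) * (s * DD e y v) := by
      simp only [DD]; ring
    have b1 := mul_neg_of_pos_of_neg hyx heov
    have b2 := mul_pos a4 (by linarith : 0 < - (s * DD e x v))
    have b3 := mul_pos a3 a2
    linarith
  have hr1v : ∀ x ∈ r1, 0 < s * DD e x v := by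
    intro x0 hx0
    rcases hmem x0 (hr1m x0 hx0) with hx0p | hx0p
    swap
    · exact hlr x0 hx0p
    exfalso
    obtain ⟨a, y, b, hab, hy, ha⟩ := exists_first_mem (fun x => x ∈ lp) r1 ⟨x0, hx0, hx0p⟩
    have hage := hprer a (y :: b) hab (by simp)
    have hrev : m.reverse = a ++ y :: (b ++ (r2 ++ m1.reverse)) := by rw [hmrev, hab]; simp
    have hmrs' := hmrs
    rw [hrev] at hmrs'
    have q1 := List.pairwise_append.1 hmrs'
    have q2 := List.pairwise_cons.1 q1.2.1
    have nda : a.Nodup := Srt.nodup q1.1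
    have ndr : lr.Nodup := Srt.nodup hpr.2
    have hym : y ∈ m := hr1m y (by rw [hab]; simp)
    have heq : a.toFinset = lr.toFinset := by
      ext x
      simp only [List.mem_toFinset]
      constructor
      · intro hx
        have := hmem x (hr1m x (by rw [hab]; simp [hx]))
        have := ha x hx
        tauto
      · intro hx
        have hxlp : x ∉ lp := by
          intro h
          have := hlp x h
          have := hlr x hx
          linarith
        have hxe : x ≠ e := by
          rintro rfl
          have := hlr x hx
          rw [DD_self'] at this; simp at this
        have hxm : x ∈ m := (hmm x).2 ⟨hxe, by rw [hlpr]; simp [hx]⟩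
        have hxm' : x ∈ m.reverse := by simpa using hxm
        rw [hrev] at hxm'
        rcases List.mem_append.1 hxm' with h | h
        · exact h
        · exfalso
          rcases List.mem_cons.1 h with h | h
          · subst h; exact hxlp hy
          · have := q2.1 x h
            refine hxlp (hinit y x hym hxm ?_ hy)
            rw [DD_swap]; linarith
    have : C.ls a = C.ls lr := by rw [← phi_toFinset nda, ← phi_toFinset ndr, heq]
    omega
  -- three trees
  have hmlen2 : m1.length + (r2.length + r1.length) = m.length := by rw [hmeq]; simp
  have hmS : ∀ x ∈ m, x ∈ C.S := fun x hx => hl x ((hmm x).1 hx).2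
  have hsrtA : Srt s e ((o :: m1) ++ (r2.reverse ++ r1.reverse)) := by
    rw [hmeq] at hms; exact hms
  have hA := List.pairwise_append.1 hsrtA
  have hA2 := List.pairwise_append.1 hA.2.1
  have hmrs2 := hmrs
  rw [hmrev] at hmrs2
  have hr1s : Srt (-s) e r1 := (List.pairwise_append.1 hmrs2).1
  have t1 := hQ m1 e o s (by omega) (fun x hx => hmS x (hm1m x hx)) heB ho hs hA.1 hs1 hpre1
  have t3 := hQ r1 e v (-s) (by omega) (fun x hx => hmS x (hr1m x hx)) heB hv (neg_ne_zero.2 hs)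
    (by
      unfold Srt
      rw [List.pairwise_cons]
      refine ⟨fun x hx => ?_, hr1s⟩
      have := hr1v x hx
      rw [DD_swap]; linarith) hsr1 hprer
  have ndr2 : r2.Nodup := List.nodup_reverse.1 (Srt.nodup hA2.1)
  obtain ⟨mm, hmm1, hmm2, hmm3⟩ : ∃ mm : ℕ, 1 ≤ mm ∧ C.w e ≤ mm + 1 ∧ mm + 1 ≤ C.k :=
    ⟨C.k - 1, by omega, by omega, by omega⟩
  have t2 := hB r2.toFinset e mm (by rw [List.toFinset_card_of_nodup ndr2]; omega)
    (fun x hx => hmS x (hr2m x (by simpa using hx))) heB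
    (HH_of_DD (a := e) (c := o) (s := s) (fun x hx =>
      hmsc.1 x (hr2m x (by simpa using hx)))).1
    (by rw [phi_toFinset ndr2]; omega) hmm1 (by rw [phi_toFinset ndr2]; omega)
  have hsrtB : Srt s e ((o :: m1) ++ r2.reverse) := by
    unfold Srt
    rw [List.pairwise_append]
    exact ⟨hA.1, hA2.1, fun x hx y hy => hA.2.2 x hx y (by
      rw [List.mem_append]; exact Or.inl hy)⟩
  obtain ⟨f, hf, f0, f1, f2⟩ := split_fun hsrtB (by simp)
  have hom : o ∉ m := fun h => hol ((hmm o).1 h).2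
  have hvm : v ∉ m := fun h => hvl ((hmm v).1 h).2
  have hem : e ∉ m := fun h => ((hmm e).1 h).1 rfl
  have t12 := glue (g := Function.update (Function.update C.cap e (1 + mm)) o 1) e f hf ?_ t1 t2
    (by simp) (by simp) ?_ ?_ ?_ ?_ ?_
  rotate_left
  · intro x hx
    simp only [Finset.mem_insert, List.mem_toFinset] at hx
    rcases hx with rfl | rfl | hx
    · exact S_B heB
    · exact S_B ho
    · exact hmS x (hm1m x hx)
  · intro x hx
    simp only [Finset.mem_insert, List.mem_toFinset] at hx
    rcases hx with rfl | rfl | hx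
    · exact le_rfl
    · rw [f0]; exact f1 _ (by simp)
    · rw [f0]; exact f1 _ (by simp [hx])
  · intro x hx hxe
    simp only [Finset.mem_insert, List.mem_toFinset, hxe, false_or] at hx
    rw [f0]; exact f2 _ (by simp [hx])
  · intro x hx hxe
    simp [Function.update_apply, hxe]
  · intro x hx hxe
    simp only [Finset.mem_insert, List.mem_toFinset, hxe, false_or] at hx
    have : x ≠ o := by rintro rfl; exact hom (hr2m _ hx)
    simp [Function.update_apply, hxe, this]
  · simp [Function.update_apply, heo]
  have hr1ne : r1 ≠ [] := by rintro rfl; simp at hsr1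
  obtain ⟨r1', x3, hx3⟩ : ∃ L' y, r1 = L' ++ [y] := by
    rcases List.eq_nil_or_concat r1 with h | ⟨L', y, h⟩
    · exact absurd h hr1ne
    · exact ⟨L', y, by simpa using h⟩
  have hx3r : x3 ∈ r1 := by rw [hx3]; simp
  have g1 : ∀ x ∈ r1, 0 ≤ s * DD e x3 x := by
    intro x hx
    by_cases h : x = x3
    · rw [h, DD_self]; simp
    · rw [hx3] at hr1s hx
      have hx : x ∈ r1' := by simpa [h] using hx
      have := (List.pairwise_append.1 hr1s).2.2 x hx x3 (by simp)
      rw [DD_swap] at this; linarith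
  have g2 : ∀ x, x ∈ o :: m1 → s * DD e x3 x < 0 := by
    intro x hx
    have := hA.2.2 x hx x3 (by simp [hx3r])
    rw [DD_swap] at this; linarith
  have g3 : ∀ x ∈ r2, s * DD e x3 x < 0 := by
    intro x hx
    have := hA2.2.2 x (by simpa using hx) x3 (by simpa using hx3r)
    rw [DD_swap] at this; linarith
  have t := glue (g := Function.update (Function.update C.cap v 1) o 1) e _ (aff_DD s e x3) ?_ t3
    t12 (by simp) (by simp) ?_ ?_ ?_ ?_ ?_
  · convert t using 1
    have e1 : l.toFinset = insert e m.toFinset := by rw [hm, Finset.insert_erase hel']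
    rw [e1, hmeq]
    ext x
    simp only [Finset.mem_insert, Finset.mem_union, List.mem_toFinset, List.mem_append,
      List.mem_reverse]
    clear * -
    tauto
  · intro x hx
    simp only [Finset.mem_insert, List.mem_toFinset] at hx
    rcases hx with rfl | rfl | hx
    · exact S_B heB
    · exact S_B hv
    · exact hmS x (hr1m x hx)
  · intro x hx
    simp only [Finset.mem_insert, List.mem_toFinset] at hx
    rcases hx with rfl | rfl | hx
    · exact le_rfl
    · rw [DD_self'']; have := hr1v x3 hx3r; linarith
    · rw [DD_self'']; have := g1 x hx; linarith
  · intro x hx hxe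
    simp only [Finset.mem_insert, Finset.mem_union, List.mem_toFinset, hxe, false_or] at hx
    rw [DD_self'', mul_zero]
    rcases hx with (rfl | hx) | hx
    · exact g2 _ (by simp)
    · exact g2 _ (by simp [hx])
    · exact g3 _ hx
  · intro x hx hxe
    simp only [Finset.mem_insert, List.mem_toFinset, hxe, false_or] at hx
    rcases hx with rfl | hx
    · simp [Function.update_apply]
    · have h1 : x ≠ o := by rintro rfl; exact hom (hr1m _ hx)
      have h2 : x ≠ v := by rintro rfl; exact hvm (hr1m _ hx)
      simp [Function.update_apply, hxe, h1, h2]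
  · intro x hx hxe
    simp only [Finset.mem_insert, Finset.mem_union, List.mem_toFinset, hxe, false_or] at hx
    have h2 : x ≠ v := by
      rintro rfl
      rcases hx with (rfl | hx) | hx
      · exact hov rfl
      · exact hvm (hm1m _ hx)
      · exact hvm (hr2m _ hx)
    simp [Function.update_apply, hxe, h2]
  · simp [Function.update_apply, hev, heo, cap_B heB]; omega

lemma stepQ {n : ℕ} (hB : C.PB n) (hQ : C.PQ n) : C.PQ (n + 1) := by
  intro l v o s hn hl hv ho hs hsrt hsum hpre
  have hc := List.pairwise_cons.1 hsrt
  have hlsrt : Srt s v l := hc.2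
  have hol : o ∉ l := (List.nodup_cons.1 hsrt.nodup).1
  have hvl : v ∉ l := by
    intro h
    have := hc.1 v h
    rw [DD_self''] at this; simp at this
  cases hll : l with
  | nil => rw [hll] at hsum; simp at hsum
  | cons t l1 =>
  have htl : t ∈ l := by rw [hll]; simp
  have hov : o ≠ v := by
    rintro rfl
    have := hc.1 t htl
    rw [DD_self'] at this; simp at this
  rw [← hll]
  by_cases hl1 : l1 = []
  · subst hl1
    have htR : t ∈ C.R := by
      rcases mem_S.1 (hl t htl) with h | h
      · exact h
      · rw [hll] at hsum; simp [val_B h] at hsum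
    have htv : t ≠ v := by rintro rfl; exact hvl htl
    have hto : t ≠ o := by rintro rfl; exact hol htl
    have := tr_path (C := C) hv ho htR
      (C.gp v (S_B hv) t (S_R htR) o (S_B ho) htv.symm hov.symm hto)
    rw [hll]
    have e : insert v (insert o [t].toFinset) = ({v, t, o} : Finset Pt) := by
      ext x; simp only [Finset.mem_insert, List.mem_toFinset, List.mem_singleton,
        Finset.mem_singleton]; clear * -; tauto
    rw [e]
    refine this.mono ?_
    intro x hx
    simp only [Finset.mem_insert, Finset.mem_singleton] at hx
    rcases hx with rfl | rfl | rfl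
    · simp [Function.update_apply, htv.symm, hov.symm]
    · simp [Function.update_apply, htv, hto, cap_R htR]
    · simp [Function.update_apply, hto.symm]
  have htB : t ∈ C.B := by
    refine B_of_val (hl t htl) ?_
    have := hpre [t] l1 (by rw [hll]; rfl) hl1
    simpa using this
  obtain ⟨q, hq, hqs⟩ := sort_from (C := C) (a := o) (c := v) (X := l.toFinset) (s := -s)
    (S_B ho) (fun x hx => hl x (by simpa using hx)) (by
      intro x hx
      have := hc.1 x (by simpa using hx)
      rw [DD_swap'] at this; linarith) (neg_ne_zero.2 hs)
  have hqm : ∀ x, x ∈ q ↔ x ∈ l := by intro x; rw [← List.mem_toFinset, hq]; simp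
  cases q with
  | nil => have := (hqm t).2 htl; simp at this
  | cons e q1 =>
    have hel : e ∈ l := (hqm e).1 (by simp)
    have hq1 := List.pairwise_cons.1 hqs
    have hq2 := List.pairwise_cons.1 hq1.2
    have hα : ∀ x ∈ l, x ≠ e → 0 < (-s) * DD o e x := by
      intro x hx hxe
      have := (hqm x).2 hx
      exact hq2.1 x (by simpa [hxe] using this)
    have hαv : 0 < (-s) * DD o v e := hq1.1 e (by simp)
    by_cases heB : e ∈ C.B
    · exact stepQ_blue hB hQ hs hn hl hv ho hlsrt hvl hol hov hsum hpre hel heB hα hαv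
    · have heR : e ∈ C.R := by have := mem_S.1 (hl e hel); tauto
      refine stepQ_red hB hn hl hv ho hlsrt.nodup hvl hol hov hsum htl htB hel heR hα ?_ ?_ ?_
      · rw [DD_swap] ; linarith
      · intro x hx hxt
        rw [hll] at hlsrt hx
        exact (List.pairwise_cons.1 hlsrt).1 x (by simpa [hxt] using hx)
      · have := hc.1 t htl
        rw [DD_swap] at this; linarith

lemma main_ind (n : ℕ) : C.PB n ∧ C.PR n ∧ C.PQ n := by
  induction n with
  | zero =>
    refine ⟨?_, ?_, ?_⟩
    · intro W c m h; omega
    · intro W c h; omega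
    · intro l v o s h; omega
  | succ n ih => exact ⟨stepB ih.1 ih.2.1 ih.2.2, stepR ih.1, stepQ ih.1 ih.2.2⟩

end Ctx


lemma DD_ne_of_not_collinear {a b c : Pt} (hab : a ≠ b)
    (h : ¬ Collinear ℝ ({a, b, c} : Set Pt)) : DD a b c ≠ 0 := by
  intro hD
  apply h
  rw [collinear_iff_of_mem (p₀ := a) (by simp)]
  refine ⟨b - a, ?_⟩
  have hc : ∃ r : ℝ, c = r • (b - a) +ᵥ a := by
    simp only [DD] at hD
    by_cases h1 : b.1 - a.1 = 0
    · have h2 : b.2 - a.2 ≠ 0 := by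
        intro h2
        exact hab (Prod.ext (by linarith) (by linarith))
      refine ⟨(c.2 - a.2) / (b.2 - a.2), ?_⟩
      have h3 : c.1 - a.1 = 0 := by
        rw [h1] at hD
        have : (b.2 - a.2) * (c.1 - a.1) = 0 := by linarith
        exact (mul_eq_zero.1 this).resolve_left h2
      ext
      · simp [h1]; linarith
      · simp; field_simp; ring
    · refine ⟨(c.1 - a.1) / (b.1 - a.1), ?_⟩
      ext
      · simp; field_simp; ring
      · simp; field_simp; linarith
  intro p hp
  simp only [Set.mem_insert_iff, Set.mem_singleton_iff] at hp
  rcases hp with rfl | rfl | rfl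
  · exact ⟨0, by simp⟩
  · exact ⟨1, by simp⟩
  · exact hc

lemma exists_weights (k : ℕ) (hk : 1 ≤ k) (B : Finset Pt) (N : ℕ) (h1 : B.card ≤ N)
    (h2 : N ≤ k * B.card) :
    ∃ w : Pt → ℕ, (∀ b, 1 ≤ w b) ∧ (∀ b, w b ≤ k) ∧ ∑ b ∈ B, w b = N := by
  induction B using Finset.induction_on generalizing N with
  | empty =>
    simp at h2
    exact ⟨fun _ => 1, by simp, by simp [hk], by simp [h2]⟩
  | insert b B hb ih =>
    rw [Finset.card_insert_of_notMem hb] at h1 h2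
    obtain ⟨x, hx1, hxk, hx2, hx3⟩ : ∃ x, 1 ≤ x ∧ x ≤ k ∧ B.card + x ≤ N ∧
        N ≤ k * B.card + x := by
      rcases le_total k (N - B.card) with h | h
      · exact ⟨k, hk, le_rfl, by omega, by linarith⟩
      · refine ⟨N - B.card, by omega, h, by omega, ?_⟩
        have : B.card ≤ k * B.card := Nat.le_mul_of_pos_left _ hk
        omega
    obtain ⟨w, hw1, hw2, hw3⟩ := ih (N - x) (by omega) (by omega)
    refine ⟨Function.update w b x, ?_, ?_, ?_⟩
    · intro y; simp only [Function.update_apply]; split_ifs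
      · exact hx1
      · exact hw1 y
    · intro y; simp only [Function.update_apply]; split_ifs
      · exact hxk
      · exact hw2 y
    · rw [Finset.sum_insert hb, Function.update_self, Finset.sum_update_of_notMem hb, hw3]
      omega

namespace Ctx
variable {C : Ctx}

lemma IsT.transfer {G : SimpleGraph Pt} (h : C.IsT C.S G) (hne : C.S.Nonempty) :
    PlaneBichromTree C.R C.B (G.comap (Subtype.val : {x : Pt // x ∈ C.R ∪ C.B} → Pt)) := by
  refine ⟨?_, ?_, ?_⟩
  · rw [SimpleGraph.isTree_iff_connected_and_card]
    have hr : ∀ u v (p : G.Walk u v) (hu : u ∈ C.R ∪ C.B) (hv : v ∈ C.R ∪ C.B),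
        (G.comap (Subtype.val : {x : Pt // x ∈ C.R ∪ C.B} → Pt)).Reachable ⟨u, hu⟩ ⟨v, hv⟩ := by
      intro u v p
      induction p with
      | nil => intro hu hv; exact SimpleGraph.Reachable.refl _
      | cons hadj p ih =>
        intro hu hv
        have hw := h.mem _ _ hadj.symm
        refine SimpleGraph.Reachable.trans (SimpleGraph.Adj.reachable ?_) (ih hw hv)
        exact hadj
    constructor
    · haveI : Nonempty {x : Pt // x ∈ C.R ∪ C.B} := by
        obtain ⟨x, hx⟩ := hne
        exact ⟨⟨x, hx⟩⟩
      refine SimpleGraph.Connected.mk ?_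
      rintro ⟨u, hu⟩ ⟨v, hv⟩
      obtain ⟨p⟩ := h.conn u hu v hv
      exact hr u v p hu hv
    · have e : (Sym2.map (Subtype.val : {x : Pt // x ∈ C.R ∪ C.B} → Pt)) ''
          (G.comap (Subtype.val : {x : Pt // x ∈ C.R ∪ C.B} → Pt)).edgeSet = G.edgeSet := by
        ext e
        constructor
        · rintro ⟨e', he', rfl⟩
          induction e' using Sym2.ind with
          | _ u v => exact he'
        · induction e using Sym2.ind with
          | _ u v =>
            intro he
            rw [SimpleGraph.mem_edgeSet] at he
            exact ⟨s(⟨u, h.mem _ _ he⟩, ⟨v, h.mem _ _ he.symm⟩), he, rfl⟩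
      have hc := h.cnt
      rw [← e, Set.ncard_image_of_injective _ (Sym2.map.injective Subtype.val_injective)] at hc
      rw [Nat.card_coe_set_eq, hc]
      rw [Nat.card_eq_fintype_card, Fintype.card_coe]; rfl
  · intro u v hadj
    exact h.bic _ _ hadj
  · intro u v x y h1 h2 hs p hp1 hp2
    refine h.pl u.1 v.1 x.1 y.1 h1 h2 ?_ p hp1 hp2
    intro he
    apply hs
    apply Sym2.map.injective Subtype.val_injective
    simpa using he

lemma tr_all (hsum : ∑ b ∈ C.B, C.w b + 1 = C.R.card) : C.Tr C.S (fun _ => C.k + 1) := by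
  have hk2 := C.k2
  have hphi : C.phi C.S = -1 := by
    unfold phi S
    rw [Finset.sum_union C.disj, Finset.sum_congr rfl (fun x hx => val_R hx),
      Finset.sum_congr (s₁ := C.B) rfl (fun x hx => val_B hx)]
    simp
    have : ((∑ b ∈ C.B, C.w b + 1 : ℕ) : ℤ) = C.R.card := by rw [hsum]
    push_cast at this
    omega
  have hne : C.S.Nonempty := by
    have : 0 < C.R.card := by omega
    obtain ⟨x, hx⟩ := Finset.card_pos.1 this
    exact ⟨x, S_R hx⟩
  obtain ⟨p, hp, hmax⟩ := Finset.exists_max_image C.S (fun x : Pt => x.1 ^ 2 + x.2 ^ 2) hne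
  have hH : HH p (C.S.erase p) := by
    refine ⟨fun x => -(p.1 * x.1 + p.2 * x.2), ⟨-p.1, -p.2, 0, fun x => by ring⟩, ?_⟩
    intro x hx
    rw [Finset.mem_erase] at hx
    have h1 := hmax x hx.2
    have h2 : 0 < (p.1 - x.1) ^ 2 + (p.2 - x.2) ^ 2 := by
      rcases eq_or_ne p.1 x.1 with h | h
      · have h' : p.2 ≠ x.2 := fun h' => hx.1 (Prod.ext h h').symm
        have := sq_pos_of_ne_zero (sub_ne_zero.2 h')
        positivity
      · have := sq_pos_of_ne_zero (sub_ne_zero.2 h)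
        positivity
    simp only at h1 ⊢
    nlinarith
  obtain ⟨hB, hR, -⟩ := C.main_ind ((C.S.erase p).card + 1)
  have he := C.phi_erase hp
  have hcap : ∀ x, C.cap x ≤ C.k + 1 := by intro x; unfold cap; split_ifs <;> omega
  rcases mem_S.1 hp with h | h
  · have t := hR (C.S.erase p) p (by omega) (Finset.erase_subset _ _) h hH
      (by rw [he, hphi, val_R h]; norm_num) (by rw [he, hphi, val_R h]; norm_num)
    rw [Finset.insert_erase hp] at t
    refine t.mono ?_
    intro x hx
    simp only [Function.update_apply]; split_ifs
    · omega
    · exact hcap x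
  · have hwk := C.wk p
    rw [val_B h] at he
    have t := hB (C.S.erase p) p (C.w p + 1) (by omega) (Finset.erase_subset _ _) h hH
      (by omega) (by omega) (by push_cast; omega)
    rw [Finset.insert_erase hp] at t
    refine t.mono ?_
    intro x hx
    simp only [Function.update_apply]; split_ifs
    · omega
    · exact hcap x

end Ctx

/-- Kaneko's Conjecture 2. If `|B| ≤ |R|`, `R ∪ B` is in general
position and `k = ⌈|R|/|B|⌉ ≥ 2`, then there is a plane bichromatic tree on `R ∪ B`
of maximum degree at most `k + 1`. -/
theorem statement_5 (R B : Finset Pt) (hdisj : Disjoint R B) (hB : B.Nonempty)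
    (hBR : B.card ≤ R.card) (hgp : GenPos (↑(R ∪ B) : Set Pt))
    (k : ℕ) (hk : (k : ℤ) = ⌈(R.card : ℚ) / (B.card : ℚ)⌉) (hk2 : 2 ≤ k) :
    ∃ G : SimpleGraph {x : Pt // x ∈ R ∪ B},
      PlaneBichromTree R B G ∧ ∀ v, deg G v ≤ k + 1 := by
  have hBpos : 0 < B.card := Finset.card_pos.2 hB
  have hBq : (0 : ℚ) < B.card := by exact_mod_cast hBpos
  have hk' := (Int.ceil_eq_iff.1 hk.symm)
  obtain ⟨hka, hkb⟩ := hk'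
  rw [lt_div_iff₀ hBq] at hka
  rw [div_le_iff₀ hBq] at hkb
  have h1 : R.card ≤ k * B.card := by exact_mod_cast hkb
  have h2 : B.card < R.card := by
    have : (2 : ℚ) ≤ k := by exact_mod_cast hk2
    have : (B.card : ℚ) < R.card := by
      push_cast at hka
      nlinarith
    exact_mod_cast this
  obtain ⟨w, hw1, hwk, hws⟩ := exists_weights k (by omega) B (R.card - 1) (by omega) (by omega)
  let C : Ctx :=
    { R := R, B := B, w := w, k := k, disj := hdisj
      gp := by
        intro a ha b hb c hc hab hac hbc
        exact DD_ne_of_not_collinear hab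
          (hgp a (by exact_mod_cast ha) b (by exact_mod_cast hb) c (by exact_mod_cast hc)
            hab hac hbc)
      w1 := hw1, wk := hwk, k2 := hk2 }
  obtain ⟨G, hG, hdeg⟩ := Ctx.tr_all (C := C) (by
    change ∑ b ∈ B, w b + 1 = R.card
    omega)
  have hne : C.S.Nonempty := by
    obtain ⟨b, hb⟩ := hB
    exact ⟨b, Ctx.S_B hb⟩
  refine ⟨_, hG.transfer hne, ?_⟩
  intro v
  refine le_trans ?_ (hdeg v.1 v.2)
  unfold deg
  rw [← Set.ncard_image_of_injective _ Subtype.val_injective]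
  refine Set.ncard_le_ncard ?_ (hG.nfin _)
  rintro _ ⟨y, hy, rfl⟩
  exact hy
end
end
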